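/- If b = {b_1, …, b_{n(n+1)/2}} is a set of distinct real numbers, then the number of points in the fibre Y(b) = Y ∩ X(b⋆) equals |SST(δ)|, the number of standard shifted tableaux of staircase shape δ = (n > n−1 > … > 1). -/

import Mathlib

section FrozenDefs
open Polynomial OnePoint

namespace OG

/-! ### Tableaux, diagrams, jeu de taquin / tableau switching -/

/-- A cell `(row, column)` (0-indexed). -/
abbrev Cell := ℕ × ℕ

/-- A filling: a finite set of (cell, entry) pairs. -/
abbrev Filling := Finset (Cell × ℕ)

def cellsOf (f : Filling) : Finset Cell := f.image Prod.fst

def entriesOf (f : Filling) : Finset ℕ := f.image Prod.snd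

/-- A (perforated/partial) standard filling: at most one entry per cell, all entries
distinct, and entries strictly increase along rows and down columns. -/
def IsPartialTableau (f : Filling) : Prop :=
  (∀ p ∈ f, ∀ q ∈ f, p.1 = q.1 → p = q) ∧
  (∀ p ∈ f, ∀ q ∈ f, p.2 = q.2 → p = q) ∧
  (∀ p ∈ f, ∀ q ∈ f, p.1.1 = q.1.1 → p.1.2 < q.1.2 → p.2 < q.2) ∧
  (∀ p ∈ f, ∀ q ∈ f, p.1.2 = q.1.2 → p.1.1 < q.1.1 → p.2 < q.2)

/-- A standard tableau on the diagram `D` with entry set `E`. -/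
def IsTableauOn (f : Filling) (D : Finset Cell) (E : Finset ℕ) : Prop :=
  IsPartialTableau f ∧ cellsOf f = D ∧ entriesOf f = E

/-- One elementary switch of the tableau switching (jeu de taquin) algorithm:
an entry `u` of the inner (sliding) family `p.2` at cell `c` is interchanged with an
entry `t` of the outer family `p.1` lying immediately east or south of `c`, provided
both families remain partial standard tableaux. -/
def SwitchStep (p q : Filling × Filling) : Prop :=
  ∃ c u d t, (c, u) ∈ p.2 ∧ (d, t) ∈ p.1 ∧
    (d = (c.1, c.2 + 1) ∨ d = (c.1 + 1, c.2)) ∧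
    q.1 = insert (c, t) (p.1.erase (d, t)) ∧
    q.2 = insert (d, u) (p.2.erase (c, u)) ∧
    IsPartialTableau q.1 ∧ IsPartialTableau q.2

/-- `Switched T U A B`: applying the tableau switching algorithm to the outer tableau `T`
and the inner tableau `U` terminates with `A` (the rectification of `T`) inside and
`B` (the new outer tableau) outside. -/
def Switched (T U A B : Filling) : Prop :=
  Relation.ReflTransGen SwitchStep (T, U) (A, B) ∧ ∀ q, ¬ SwitchStep (A, B) q

/-- `R` is the jeu de taquin rectification of the skew tableau `T` whose inner
(empty) region is the diagram `Din`. -/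
def RectifiesTo (T : Filling) (Din : Finset Cell) (R : Filling) : Prop :=
  ∃ U B, IsTableauOn U Din (Finset.Icc 1 Din.card) ∧ Switched T U R B

/-- Dual equivalence of two skew tableaux with common inner diagram `Din`:
switching with any standard tableau `U` of shape `Din` produces the same outer
tableau `Û`. -/
def DualEquiv (Din : Finset Cell) (T T' : Filling) : Prop :=
  ∀ U A A' B B', IsTableauOn U Din (Finset.Icc 1 Din.card) →
    Switched T U A B → Switched T' U A' B' → B = B'

/-- A partition `λ` with at most `n` parts, each of size at most `n+1`
(the indexing set `Λ` for the Schubert classes of `Gr(n, 2n+1)`). -/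
structure PartitionIn (n : ℕ) where
  part : ℕ → ℕ
  antitone : Antitone part
  head_le : part 0 ≤ n + 1
  vanish : ∀ i, n ≤ i → part i = 0

/-- The weight `|λ|` of a partition. -/
def wt (n : ℕ) (lam : PartitionIn n) : ℕ := ∑ i ∈ Finset.range n, lam.part i

/-- The Young diagram of a partition `λ ∈ Λ`. -/
def partDiag (n : ℕ) (lam : PartitionIn n) : Finset Cell :=
  (Finset.range n ×ˢ Finset.range (n+1)).filter fun c => c.2 < lam.part c.1

/-- The `n × (n+1)` rectangular diagram `⊞`. -/
def rectDiag (n : ℕ) : Finset Cell := Finset.range n ×ˢ Finset.range (n+1)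

/-- A standard Young tableau of rectangular shape `⊞`, with entries `1, …, n(n+1)`. -/
def IsSYTRect (n : ℕ) (T : Filling) : Prop :=
  IsTableauOn T (rectDiag n) (Finset.Icc 1 (n*(n+1)))

/-- A strict partition with all parts distinct, of size at most `n`, and at most
`n` parts (the indexing set `Σ` for Schubert classes of `OG(n, 2n+1)`). -/
structure StrictPartitionIn (n : ℕ) where
  part : ℕ → ℕ
  le_n : ∀ i, part i ≤ n
  strict : ∀ i, part i = 0 ∨ part (i+1) < part i

/-- The weight `|σ|` of a strict partition. -/
def swt (n : ℕ) (s : StrictPartitionIn n) : ℕ := ∑ i ∈ Finset.range n, s.part i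

/-- The shifted diagram of a strict partition: row `i` has `σ i` boxes starting
at column `i`. -/
def shiftedDiag (n : ℕ) (s : StrictPartitionIn n) : Finset Cell :=
  (Finset.range n ×ˢ Finset.range (2*n)).filter fun c => c.1 ≤ c.2 ∧ c.2 < c.1 + s.part c.1

/-- The staircase strict partition `δ = (n > n-1 > … > 1)`. -/
def staircase (n : ℕ) : StrictPartitionIn n where
  part i := n - i
  le_n i := Nat.sub_le n i
  strict i := by
    show n - i = 0 ∨ n - (i+1) < n - i
    omega

/-- A standard shifted tableau of staircase shape `δ`, with entries `1, …, n(n+1)/2`. -/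
def IsSSTstaircase (n : ℕ) (T : Filling) : Prop :=
  IsTableauOn T (shiftedDiag n (staircase n)) (Finset.Icc 1 (n*(n+1)/2))

/-- The partition `σ̃` associated to a strict partition `σ`:
`σ̃ⁱ = σⁱ + #{j : j ≤ i < j + σʲ}` (0-indexed). -/
def tildeFun {n : ℕ} (s : StrictPartitionIn n) (i : ℕ) : ℕ :=
  s.part i + ((Finset.range n).filter fun j => j ≤ i ∧ i < j + s.part j).card

/-- Doubling a shifted (skew) tableau `T` to a symmetrical tableau `T⋆`: an entry `k` at
shifted cell `(i,j)` produces the even entry `2k` at `(i, j+1)` and the odd entry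
`2k-1` at the transposed cell `(j, i)`. -/
def doubleFill (T : Filling) : Filling :=
  T.image (fun p => ((p.1.1, p.1.2 + 1), 2 * p.2)) ∪
  T.image (fun p => ((p.1.2, p.1.1), 2 * p.2 - 1))

/-- Deleting the odd entries of a tableau, dividing the remaining entries by `2` and
shifting each remaining cell one column to the left. -/
def halveFill (T : Filling) : Filling :=
  (T.filter fun p => 2 ∣ p.2).image fun p => ((p.1.1, p.1.2 - 1), p.2 / 2)

/-- A rectangular standard tableau is symmetrical if whenever `2k-1` occupies cell
`(i,j)`, the entry `2k` occupies cell `(j, i+1)` (0-indexed version of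
`i₂ₖ = j₂ₖ₋₁`, `j₂ₖ = i₂ₖ₋₁ + 1`). -/
def IsSymmetrical (T : Filling) : Prop :=
  ∀ i j k : ℕ, 1 ≤ k → ((i, j), 2*k - 1) ∈ T → ((j, i + 1), 2*k) ∈ T

/-- The subtableau `T_{[i,j]}` of entries lying in the interval `[i, j]`. -/
def subTab (T : Filling) (i j : ℕ) : Filling := T.filter fun p => i ≤ p.2 ∧ p.2 ≤ j

/-- The subtableau `T_{<i}`. -/
def lowTab (T : Filling) (i : ℕ) : Filling := T.filter fun p => p.2 < i

/-- The subtableau `T_{>j}`. -/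
def highTab (T : Filling) (j : ℕ) : Filling := T.filter fun p => j < p.2

/-! ### The Grassmannian, the Wronski map and the orthogonal Grassmannian -/

/-- The Wronskian of an `n`-tuple of polynomials. -/
noncomputable def wronskian (n : ℕ) (f : Fin n → ℂ[X]) : ℂ[X] :=
  (Matrix.of fun i j : Fin n => (fun p : ℂ[X] => derivative p)^[(i : ℕ)] (f j)).det

/-- `x` is a point of `X = Gr(n, C_{2n}[z])`: an `n`-dimensional subspace of the
space of polynomials of degree at most `2n`. -/
def IsGrassPt (n : ℕ) (x : Submodule ℂ ℂ[X]) : Prop :=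
  x ≤ degreeLT ℂ (2*n+1) ∧ Module.finrank ℂ x = n

/-- `Wr(x; z) = h(z)` up to a nonzero scalar: some (hence any) basis of `x` has
Wronskian a nonzero scalar multiple of `h`. -/
def WrEq (n : ℕ) (x : Submodule ℂ ℂ[X]) (h : ℂ[X]) : Prop :=
  ∃ f : Fin n → ℂ[X], Submodule.span ℂ (Set.range f) = x ∧
    ∃ c : ℂ, c ≠ 0 ∧ wronskian n f = c • h

/-- The symmetric bilinear form
`⟨Σ aₖ zᵏ/k!, Σ bₗ zˡ/l!⟩ = Σ_{m} (-1)ᵐ aₘ b_{2n-m}` on `C_{2n}[z]`. -/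
noncomputable def form (n : ℕ) (p q : ℂ[X]) : ℂ :=
  ∑ m ∈ Finset.range (2*n+1),
    (-1 : ℂ)^m * (Nat.factorial m : ℂ) * (Nat.factorial (2*n-m) : ℂ) *
      p.coeff m * q.coeff (2*n-m)

/-- `y` is a point of the orthogonal Grassmannian `Y = OG(n, C_{2n}[z])`:
an `n`-dimensional isotropic subspace. -/
def IsOGPt (n : ℕ) (y : Submodule ℂ ℂ[X]) : Prop :=
  IsGrassPt n y ∧ ∀ p ∈ y, ∀ q ∈ y, form n p q = 0

/-- The flag `F_•(a)`, for `a ∈ ℂ ∪ {∞}` (with `none` playing the role of `∞`):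
`F_i(a)` is the space of polynomials of degree at most `2n` divisible by
`(z+a)^{2n+1-i}`, and `F_i(∞) = C_{i-1}[z]`. -/
noncomputable def flag (n : ℕ) (a : Option ℂ) (i : ℕ) : Submodule ℂ ℂ[X] :=
  match a with
  | Option.none => degreeLT ℂ i
  | Option.some a0 =>
    { carrier := {p : ℂ[X] | p ∈ degreeLT ℂ (2*n+1) ∧ (X + C a0)^(2*n+1-i) ∣ p}
      add_mem' := fun hp hq => ⟨add_mem hp.1 hq.1, dvd_add hp.2 hq.2⟩
      zero_mem' := ⟨zero_mem _, dvd_zero _⟩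
      smul_mem' := by
        rintro c p ⟨h1, h2⟩
        refine ⟨Submodule.smul_mem _ _ h1, ?_⟩
        rw [Polynomial.smul_eq_C_mul]
        exact h2.mul_left _ }

/-- The Schubert variety `X_λ(a) ⊆ X` relative to the flag `F_•(a)`. -/
def SchubertX (n : ℕ) (lam : PartitionIn n) (a : Option ℂ) : Set (Submodule ℂ ℂ[X]) :=
  {x | IsGrassPt n x ∧
    ∀ i < n, i + 1 ≤ Module.finrank ℂ ↥(x ⊓ flag n a (n + 2 + i - lam.part i))}

/-- The Schubert variety `Y_σ(a) = Y ∩ X_{σ̃}(a) ⊆ Y`. -/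
def SchubertY (n : ℕ) (s : StrictPartitionIn n) (a : Option ℂ) : Set (Submodule ℂ ℂ[X]) :=
  {y | IsOGPt n y ∧
    ∀ i < n, i + 1 ≤ Module.finrank ℂ ↥(y ⊓ flag n a (n + 2 + i - tildeFun s i))}

/-! ### `ℝP¹`, fibres of the Wronski map, zones and the correspondence -/

/-- The inclusion `ℝP¹ = ℝ ∪ {∞} ↪ ℂ ∪ {∞}`. -/
def toC (t : OnePoint ℝ) : Option ℂ := Option.map (fun r : ℝ => (r : ℂ)) t

/-- The linear factor `z + a` associated to `a ∈ ℝP¹` (equal to `1` for `a = ∞`). -/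
noncomputable def linFactor (t : OnePoint ℝ) : ℂ[X] :=
  (toC t).elim 1 fun a0 => X + C a0

/-- The polynomial `∏_{aᵢ ≠ ∞} (z + aᵢ)` associated to a multiset `a` of points
of `ℝP¹`. -/
noncomputable def fibrePoly (a : Multiset (OnePoint ℝ)) : ℂ[X] := (a.map linFactor).prod

/-- The fibre `X(a)` of the Wronski map over `∏_{aᵢ ≠ ∞} (z + aᵢ)`. -/
def fibre (n : ℕ) (a : Multiset (OnePoint ℝ)) : Set (Submodule ℂ ℂ[X]) :=
  {x | IsGrassPt n x ∧ WrEq n x (fibrePoly a)}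

/-- The total order `⪯` on `ℝP¹` refining `|a| ≤ |b|`:
`a ⪯ b` iff `a = b`, `|a| < |b|`, or `0 < a = -b < ∞`. -/
def ple (x y : OnePoint ℝ) : Prop :=
  x = y ∨ (y = (∞ : OnePoint ℝ) ∧ x ≠ (∞ : OnePoint ℝ)) ∨
    ∃ r s : ℝ, x = (r : OnePoint ℝ) ∧ y = (s : OnePoint ℝ) ∧
      (|r| < |s| ∨ (0 < r ∧ r = -s))

/-- The multiset `{v 1, …, v N}`. -/
def msOfN (N : ℕ) (v : ℕ → OnePoint ℝ) : Multiset (OnePoint ℝ) :=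
  (Finset.Icc 1 N).val.map v

/-- `v 1 ⪯ v 2 ⪯ … ⪯ v N`. -/
def SortedOn (N : ℕ) (v : ℕ → OnePoint ℝ) : Prop :=
  ∀ k l, 1 ≤ k → k ≤ l → l ≤ N → ple (v k) (v l)

/-- The `⪯`-zone of `A` determined by a choice of signs `ε`. -/
def zoneN (N : ℕ) (eps : ℕ → Bool) : Set (ℕ → OnePoint ℝ) :=
  {v | SortedOn N v ∧ ∀ k, 1 ≤ k → k ≤ N →
    (v k = (∞ : OnePoint ℝ) ∨
      ∃ r : ℝ, v k = (r : OnePoint ℝ) ∧ (if eps k then 0 ≤ r else r ≤ 0))}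

/-- The doubled multiset `b⋆ = {b₁, b₁, …, b_M, b_M}`. -/
def starMs (M : ℕ) (v : ℕ → OnePoint ℝ) : Multiset (OnePoint ℝ) :=
  msOfN M v + msOfN M v

/-- The polynomial with coefficient vector `v`. -/
noncomputable def polyOfVec {m : ℕ} (v : Fin m → ℂ) : ℂ[X] :=
  ∑ i, C (v i) * X ^ (i : ℕ)

/-- The topology of the Grassmannian `Gr(n, C_{2n}[z])`: the quotient (coinduced)
topology along the map sending a linearly independent `n`-tuple of coefficient
vectors to its span. -/
noncomputable def grassTop (n : ℕ) : TopologicalSpace (Submodule ℂ ℂ[X]) :=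
  TopologicalSpace.coinduced
    (fun M : {M : Fin n → Fin (2*n+1) → ℂ // LinearIndependent ℂ M} =>
      Submodule.span ℂ (Set.range fun i => polyOfVec (M.1 i)))
    inferInstance

/-- The tangent space at `x` to the Schubert variety `X_λ(a)` (at a point of the
open cell), viewed inside `Hom(x, ℂ[z]/x)`: the maps `φ` with
`φ(x ∩ F_j(a)) ⊆ (F_j(a) + x)/x` for all `j`. -/
def tangentSchubertSet (n : ℕ) (a : Option ℂ) (x : Submodule ℂ ℂ[X]) :
    Set (↥x →ₗ[ℂ] (ℂ[X] ⧸ x)) :=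
  {φ | ∀ j ≤ 2*n+1, ∀ v : x, (v : ℂ[X]) ∈ flag n a j →
      φ v ∈ (flag n a j ⊔ x).map x.mkQ}

/-- The tangent space at an isotropic `x` to the orthogonal Grassmannian `Y`,
inside `Hom(x, ℂ[z]/x)`: the maps `φ` with `⟨φ v, w⟩ + ⟨v, φ w⟩ = 0`. -/
def tangentYSet (n : ℕ) (x : Submodule ℂ ℂ[X]) : Set (↥x →ₗ[ℂ] (ℂ[X] ⧸ x)) :=
  {φ | ∀ v w : x, ∀ pv pw : ℂ[X],
      x.mkQ pv = φ v → x.mkQ pw = φ w →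
      form n pv (w : ℂ[X]) + form n (v : ℂ[X]) pw = 0}

/-- Divisibility of `h` by `(z+a)^k`, where for `a = ∞` this means
`deg h ≤ n(n+1) - k`. -/
def rootMultCond (n : ℕ) (a : Option ℂ) (k : ℕ) (h : ℂ[X]) : Prop :=
  match a with
  | Option.some a0 => (X + C a0)^k ∣ h
  | Option.none => h.natDegree + k ≤ n*(n+1)

/-- The characterizing properties (i)-(v) of the correspondence
`(T, a) ↦ x_T(a)` of Theorem 2.3:
(i) `x_T(a)` lies in the fibre `X(a)`;
(ii) `T ↦ x_T(a)` is surjective onto `X(a)`, and injective when `a` is a set;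
(iii) `a ↦ x_T(a)` is continuous on every `⪯`-zone;
(iv) if `a_i = … = a_j` in the `⪯`-sorted order then `x_T(a) ∈ X_λ(a_i)` where `λ`
is the rectification shape of `T_{[i,j]}`;
(v) under the hypotheses of (iv), if `T_{<i} = T'_{<i}` and `T_{>j} = T'_{>j}` then
`x_T(a) = x_{T'}(a)` iff `T_{[i,j]}` and `T'_{[i,j]}` are dual equivalent. -/
structure CorrProps (n : ℕ)
    (xmap : Filling → Multiset (OnePoint ℝ) → Submodule ℂ ℂ[X]) : Prop where
  mem_fibre : ∀ T a, IsSYTRect n T → Multiset.card a = n*(n+1) →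
    xmap T a ∈ fibre n a
  surj : ∀ a, Multiset.card a = n*(n+1) → ∀ x ∈ fibre n a,
    ∃ T, IsSYTRect n T ∧ xmap T a = x
  inj : ∀ a, Multiset.card a = n*(n+1) → Multiset.Nodup a →
    ∀ T T', IsSYTRect n T → IsSYTRect n T' → xmap T a = xmap T' a → T = T'
  contOn : ∀ T, IsSYTRect n T → ∀ eps : ℕ → Bool,
    @ContinuousOn (ℕ → OnePoint ℝ) (Submodule ℂ ℂ[X]) _ (grassTop n)
      (fun v => xmap T (msOfN (n*(n+1)) v)) (zoneN (n*(n+1)) eps)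
  schub : ∀ v : ℕ → OnePoint ℝ, SortedOn (n*(n+1)) v →
    ∀ i j, 1 ≤ i → i ≤ j → j ≤ n*(n+1) → (∀ k, i ≤ k → k ≤ j → v k = v i) →
    ∀ T, IsSYTRect n T →
    ∀ lam : PartitionIn n, ∀ R : Filling,
      RectifiesTo (subTab T i j) (cellsOf (lowTab T i)) R →
      cellsOf R = partDiag n lam →
      xmap T (msOfN (n*(n+1)) v) ∈ SchubertX n lam (toC (v i))
  dual : ∀ v : ℕ → OnePoint ℝ, SortedOn (n*(n+1)) v →
    ∀ i j, 1 ≤ i → i ≤ j → j ≤ n*(n+1) → (∀ k, i ≤ k → k ≤ j → v k = v i) →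
    ∀ T T', IsSYTRect n T → IsSYTRect n T' →
      lowTab T i = lowTab T' i → highTab T j = highTab T' j →
      (xmap T (msOfN (n*(n+1)) v) = xmap T' (msOfN (n*(n+1)) v) ↔
        DualEquiv (cellsOf (lowTab T i)) (subTab T i j) (subTab T' i j))



end OG
end FrozenDefs

section PartGA
open Polynomial

namespace OG

section Abs

/-- Extension of a complex character along an integral extension. -/
theorem exists_extend_char {A B : Type*} [CommRing A] [CommRing B] [Algebra A B]
    [Algebra.IsIntegral A B] (hinj : Function.Injective (algebraMap A B)) (ε : A →+* ℂ) :
    ∃ χ : B →+* ℂ, χ.comp (algebraMap A B) = ε := by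
  have hp : (RingHom.ker ε).IsPrime := RingHom.ker_isPrime ε
  obtain ⟨Q, hQ, hQ'⟩ := Ideal.exists_ideal_over_prime_of_isIntegral (S := B) (RingHom.ker ε) ⊥ (by
      intro a ha
      have : algebraMap A B a = 0 := by simpa using ha
      have : a = 0 := hinj (by simpa using this)
      simp [this])
  obtain ⟨-, hQp, hQ2⟩ := (⟨hQ, hQ'⟩ : _ ∧ _)
  let p := RingHom.ker ε
  let i : A ⧸ p →+* ℂ := RingHom.kerLift ε
  have hi : Function.Injective i := RingHom.kerLift_injective ε
  let j : A ⧸ p →+* B ⧸ Q := Ideal.quotientMap Q (algebraMap A B) (le_of_eq hQ2.symm)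
  letI : Algebra (A ⧸ p) ℂ := i.toAlgebra
  letI : Algebra (A ⧸ p) (B ⧸ Q) := j.toAlgebra
  have hj : Function.Injective j := Ideal.quotientMap_injective' (le_of_eq hQ2)
  have hInt : Algebra.IsIntegral (A ⧸ p) (B ⧸ Q) := by
    constructor
    intro x
    obtain ⟨b, rfl⟩ := Ideal.Quotient.mk_surjective x
    have := Algebra.IsIntegral.isIntegral (R := A) b
    obtain ⟨q, hq, hq2⟩ := this
    refine ⟨q.map (Ideal.Quotient.mk p), hq.map _, ?_⟩
    rw [eval₂_map]
    have e : (algebraMap (A ⧸ p) (B ⧸ Q)).comp (Ideal.Quotient.mk p)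
        = (Ideal.Quotient.mk Q).comp (algebraMap A B) := by
      ext a; rfl
    rw [e, ← hom_eval₂, hq2, map_zero]
  haveI : IsDomain (A ⧸ p) := Ideal.Quotient.isDomain p
  haveI : IsDomain (B ⧸ Q) := Ideal.Quotient.isDomain Q
  haveI : Module.IsTorsionFree (A ⧸ p) (B ⧸ Q) := by
    exact Module.isTorsionFree_iff_algebraMap_injective.2 hj
  haveI : Module.IsTorsionFree (A ⧸ p) ℂ := by
    exact Module.isTorsionFree_iff_algebraMap_injective.2 hi
  haveI : Algebra.IsAlgebraic (A ⧸ p) (B ⧸ Q) := Algebra.IsIntegral.isAlgebraic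
  let L : B ⧸ Q →ₐ[A ⧸ p] ℂ := IsAlgClosed.lift
  refine ⟨L.toRingHom.comp (Ideal.Quotient.mk Q), ?_⟩
  ext a
  have := L.commutes (Ideal.Quotient.mk p a)
  exact this

variable {A B : Type*} [CommRing A] [IsDomain A] [IsIntegrallyClosed A] [Algebra ℝ A]
  [CommRing B] [IsDomain B] [IsIntegrallyClosed B] [Algebra ℝ B] [Algebra A B]
  [IsScalarTower ℝ A B] [Module.Finite A B] [Module.IsTorsionFree A B]

/-- The fibre over a real point. -/
def fib (B : Type*) [CommRing B] [Algebra ℝ B] [Algebra A B] (ε : A →ₐ[ℝ] ℝ) :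
    Set (B →ₐ[ℝ] ℂ) := {χ | ∀ a, χ (algebraMap A B a) = (ε a : ℂ)}

noncomputable def epsC (ε : A →ₐ[ℝ] ℝ) : A →+* ℂ := (algebraMap ℝ ℂ).comp ε.toRingHom

theorem epsC_apply (ε : A →ₐ[ℝ] ℝ) (a : A) : epsC ε a = (ε a : ℂ) := rfl

theorem root_minpoly_iff (ε : A →ₐ[ℝ] ℝ) (s : B) (z : ℂ) :
    ((minpoly A s).map (epsC ε)).IsRoot z ↔ ∃ χ ∈ fib B ε, χ s = z := by
  have hs : IsIntegral A s := Algebra.IsIntegral.isIntegral s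
  constructor
  · intro hz
    let g : AdjoinRoot (minpoly A s) →+* ℂ := AdjoinRoot.lift (epsC ε) z (by
      rw [← eval_map]; exact hz)
    let e := minpoly.equivAdjoin hs
    let g' : Algebra.adjoin A ({s} : Set B) →+* ℂ := g.comp e.symm.toAlgHom.toRingHom
    haveI : Algebra.IsIntegral (Algebra.adjoin A ({s} : Set B)) B :=
      Algebra.IsIntegral.tower_top A
    obtain ⟨χ, hχ⟩ := exists_extend_char (A := Algebra.adjoin A ({s} : Set B)) (B := B)
      Subtype.val_injective g'
    have h1 : ∀ a : A, χ (algebraMap A B a) = (ε a : ℂ) := by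
      intro a
      have := congrArg (fun h => h (algebraMap A _ a)) hχ
      simp only [RingHom.comp_apply] at this
      rw [← IsScalarTower.algebraMap_apply] at this
      rw [this]
      show g (e.symm (algebraMap A _ a)) = _
      rw [AlgEquiv.commutes]
      exact AdjoinRoot.lift_of (f := minpoly A s) (i := epsC ε) (a := z) _
    refine ⟨{ χ with commutes' := ?_ }, ?_, ?_⟩
    · intro r
      show χ (algebraMap ℝ B r) = _
      rw [IsScalarTower.algebraMap_apply ℝ A B, h1]
      simp
    · intro a; exact h1 a
    · show χ s = z
      have := congrArg (fun h => h ⟨s, Algebra.self_mem_adjoin_singleton A s⟩) hχ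
      simp only [RingHom.comp_apply] at this
      have h2 : algebraMap (Algebra.adjoin A ({s} : Set B)) B
        ⟨s, Algebra.self_mem_adjoin_singleton A s⟩ = s := rfl
      rw [h2] at this
      rw [this]
      show g (e.symm ⟨s, _⟩) = _
      have h3 : e.symm ⟨s, Algebra.self_mem_adjoin_singleton A s⟩ = AdjoinRoot.root _ := by
        rw [AlgEquiv.symm_apply_eq]
        apply Subtype.ext
        have : (e (AdjoinRoot.root (minpoly A s))) = AdjoinRoot.Minpoly.toAdjoin A s (AdjoinRoot.root _) := by
          rw [← minpoly.equivAdjoin_toAlgHom hs]; rfl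
        rw [this]
        simp [AdjoinRoot.Minpoly.toAdjoin]
      rw [h3]
      exact AdjoinRoot.lift_root _
  · rintro ⟨χ, hχ, rfl⟩
    rw [IsRoot, eval_map]
    have h := congrArg χ (minpoly.aeval A s)
    rw [map_zero, aeval_def] at h
    have h2 := hom_eval₂ (minpoly A s) (algebraMap A B) χ.toRingHom s
    have e : χ.toRingHom.comp (algebraMap A B) = epsC ε := by
      ext a; exact hχ a
    rw [e] at h2
    rw [← h]
    exact h2.symm

theorem trace_eq_roots (ε : A →ₐ[ℝ] ℝ) (s : B) :
    ∃ k : ℕ, 0 < k ∧ (ε (Algebra.intTrace A B s) : ℂ) =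
      k * ((minpoly A s).map (epsC ε)).roots.sum := by
  have hs : IsIntegral A s := Algebra.IsIntegral.isIntegral s
  let K := FractionRing A
  let L := FractionRing B
  letI : Algebra K L := FractionRing.liftAlgebra A L
  haveI : IsScalarTower A K L := FractionRing.isScalarTower_liftAlgebra A L
  haveI : FiniteDimensional K L := Module.Finite.of_isLocalization A B (nonZeroDivisors A)
  have h1 := Algebra.algebraMap_intTrace (A := A) (K := K) (L := L) (B := B) s
  rw [trace_eq_finrank_mul_minpoly_nextCoeff, minpoly.isIntegrallyClosed_eq_field_fractions K L hs,
    nextCoeff_map (IsFractionRing.injective A K)] at h1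
  set k := Module.finrank (IntermediateField.adjoin K {algebraMap B L s}) L
  refine ⟨k, Module.finrank_pos, ?_⟩
  have h2 : Algebra.intTrace A B s = k * -(minpoly A s).nextCoeff := by
    apply IsFractionRing.injective A K
    rw [h1, map_mul, map_neg, map_natCast]
  rw [h2]
  have hm : ((minpoly A s).map (epsC ε)).Monic := (minpoly.monic hs).map _
  have h3 := (IsAlgClosed.splits ((minpoly A s).map (epsC ε))).nextCoeff_eq_neg_sum_roots_of_monic hm
  have h4 : ((minpoly A s).map (epsC ε)).nextCoeff = epsC ε ((minpoly A s).nextCoeff) := by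
    have hd : ((minpoly A s).map (epsC ε)).natDegree = (minpoly A s).natDegree :=
      (minpoly.monic hs).natDegree_map _
    simp only [nextCoeff, hd, coeff_map]
    split_ifs <;> simp
  rw [h4] at h3
  have h5 : ((minpoly A s).map (epsC ε)).roots.sum = - epsC ε ((minpoly A s).nextCoeff) := by
    rw [h3]; simp
  rw [h5, epsC_apply]
  simp

theorem mem_roots_minpoly (ε : A →ₐ[ℝ] ℝ) (s : B) (z : ℂ) :
    z ∈ ((minpoly A s).map (epsC ε)).roots ↔ ∃ χ ∈ fib B ε, χ s = z := by
  have hs : IsIntegral A s := Algebra.IsIntegral.isIntegral s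
  rw [mem_roots ((minpoly.monic hs).map _).ne_zero, root_minpoly_iff]

theorem fib_nonempty (ε : A →ₐ[ℝ] ℝ) : (fib B ε).Nonempty := by
  have hs : IsIntegral A (0 : B) := Algebra.IsIntegral.isIntegral 0
  have hm : ((minpoly A (0:B)).map (epsC ε)).Monic := (minpoly.monic hs).map _
  have : ((minpoly A (0:B)).map (epsC ε)).degree ≠ 0 := by
    rw [(minpoly.monic hs).degree_map]
    exact (minpoly.degree_pos hs).ne'
  obtain ⟨z, hz⟩ := IsAlgClosed.exists_root _ this
  obtain ⟨χ, h, -⟩ := (root_minpoly_iff ε 0 z).1 hz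
  exact ⟨χ, h⟩

theorem trace_nonneg (ε : A →ₐ[ℝ] ℝ) (s : B)
    (h : ∀ χ ∈ fib B ε, ∃ r : ℝ, 0 ≤ r ∧ χ s = r) : 0 ≤ ε (Algebra.intTrace A B s) := by
  obtain ⟨k, hk, e⟩ := trace_eq_roots ε s
  have : ∀ m : Multiset ℂ, (∀ z ∈ m, ∃ r : ℝ, 0 ≤ r ∧ z = r) → ∃ r : ℝ, 0 ≤ r ∧ m.sum = r := by
    intro m
    induction m using Multiset.induction with
    | empty => intro _; exact ⟨0, le_rfl, by simp⟩
    | cons a m ih =>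
      intro h
      obtain ⟨r, hr, e⟩ := ih (fun z hz => h z (Multiset.mem_cons_of_mem hz))
      obtain ⟨r', hr', e'⟩ := h a (Multiset.mem_cons_self _ _)
      exact ⟨r' + r, by positivity, by rw [Multiset.sum_cons, e, e']; simp⟩
  obtain ⟨r, hr, e2⟩ := this _ (fun z hz => by
    obtain ⟨χ, hχ, rfl⟩ := (mem_roots_minpoly ε s z).1 hz
    exact h χ hχ)
  rw [e2] at e
  have : ε (Algebra.intTrace A B s) = k * r := by exact_mod_cast e
  rw [this]; positivity

theorem trace_pos (ε : A →ₐ[ℝ] ℝ) (s : B)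
    (h : ∀ χ ∈ fib B ε, ∃ r : ℝ, 0 ≤ r ∧ χ s = r) (h' : ∃ χ ∈ fib B ε, χ s ≠ 0) :
    0 < ε (Algebra.intTrace A B s) := by
  obtain ⟨k, hk, e⟩ := trace_eq_roots ε s
  have : ∀ m : Multiset ℂ, (∀ z ∈ m, ∃ r : ℝ, 0 ≤ r ∧ z = r) → ∃ r : ℝ, 0 ≤ r ∧ m.sum = r ∧
      ((∃ z ∈ m, z ≠ 0) → 0 < r) := by
    intro m
    induction m using Multiset.induction with
    | empty => intro _; exact ⟨0, le_rfl, by simp⟩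
    | cons a m ih =>
      intro h
      obtain ⟨r, hr, e, e2⟩ := ih (fun z hz => h z (Multiset.mem_cons_of_mem hz))
      obtain ⟨r', hr', e'⟩ := h a (Multiset.mem_cons_self _ _)
      refine ⟨r' + r, by positivity, by rw [Multiset.sum_cons, e, e']; simp, ?_⟩
      rintro ⟨z, hz, hz0⟩
      rcases Multiset.mem_cons.1 hz with rfl | hz
      · have : r' ≠ 0 := by rintro rfl; exact hz0 (by simpa using e')
        have : 0 < r' := lt_of_le_of_ne hr' this.symm
        linarith
      · have := e2 ⟨z, hz, hz0⟩
        linarith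
  obtain ⟨r, hr, e2, e3⟩ := this _ (fun z hz => by
    obtain ⟨χ, hχ, rfl⟩ := (mem_roots_minpoly ε s z).1 hz
    exact h χ hχ)
  rw [e2] at e
  have e4 : ε (Algebra.intTrace A B s) = k * r := by exact_mod_cast e
  obtain ⟨χ, hχ, hne⟩ := h'
  have := e3 ⟨χ s, (mem_roots_minpoly ε s _).2 ⟨χ, hχ, rfl⟩, hne⟩
  rw [e4]; positivity

theorem trace_zero (ε : A →ₐ[ℝ] ℝ) (s : B)
    (h : ∀ χ ∈ fib B ε, χ s = 0) : ε (Algebra.intTrace A B s) = 0 := by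
  apply le_antisymm
  · have := trace_nonneg ε (-s) (fun χ hχ => ⟨0, le_rfl, by simp [h χ hχ]⟩)
    simp at this; exact this
  · exact trace_nonneg ε s (fun χ hχ => ⟨0, le_rfl, by simp [h χ hχ]⟩)

end Abs
end OG
end PartGA

section PartGB
open Polynomial

namespace OG

section AbsB

variable {A B : Type*} [CommRing A] [IsDomain A] [IsIntegrallyClosed A] [Algebra ℝ A]
  [CommRing B] [IsDomain B] [IsIntegrallyClosed B] [Algebra ℝ B] [Algebra A B]
  [IsScalarTower ℝ A B] [Module.Finite A B] [Module.IsTorsionFree A B]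

/-- Complex conjugate of a character. -/
noncomputable def conjChar {B : Type*} [CommRing B] [Algebra ℝ B] (χ : B →ₐ[ℝ] ℂ) : B →ₐ[ℝ] ℂ :=
  (Complex.conjAe : ℂ →ₐ[ℝ] ℂ).comp χ

theorem conjChar_apply {B : Type*} [CommRing B] [Algebra ℝ B] (χ : B →ₐ[ℝ] ℂ) (s : B) :
    conjChar χ s = (starRingEnd ℂ) (χ s) := rfl

theorem conjChar_conjChar {B : Type*} [CommRing B] [Algebra ℝ B] (χ : B →ₐ[ℝ] ℂ) :
    conjChar (conjChar χ) = χ := by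
  ext s; simp [conjChar_apply]

theorem interp_complex {B : Type*} [CommRing B] [Algebra ℝ B] (Fs : Finset (B →ₐ[ℝ] ℂ))
    (t : (B →ₐ[ℝ] ℂ) → ℂ) :
    ∃ α β : B, ∀ χ ∈ Fs, χ α + Complex.I * χ β = t χ := by
  classical
  let W : Submodule ℂ (Fs → ℂ) :=
    { carrier := {v | ∃ α β : B, ∀ χ : Fs, v χ = χ.1 α + Complex.I * χ.1 β}
      add_mem' := by
        rintro v w ⟨a, b, h⟩ ⟨a', b', h'⟩
        refine ⟨a + a', b + b', fun χ => ?_⟩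
        rw [Pi.add_apply, h, h', map_add, map_add]; ring
      zero_mem' := ⟨0, 0, fun χ => by simp⟩
      smul_mem' := by
        rintro c v ⟨a, b, h⟩
        refine ⟨c.re • a - c.im • b, c.im • a + c.re • b, fun χ => ?_⟩
        rw [Pi.smul_apply, h, map_sub, map_add, map_smul, map_smul, map_smul, map_smul]
        simp only [Complex.real_smul, smul_eq_mul]
        conv_lhs => rw [← Complex.re_add_im c]
        linear_combination (c.im * χ.1 b : ℂ) * Complex.I_sq }
  have hW : W = ⊤ := by
    by_contra hne
    obtain ⟨φ, hφ, hle⟩ := Submodule.exists_le_ker_of_lt_top W (lt_top_iff_ne_top.2 hne)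
    apply hφ
    have hli := linearIndependent_monoidHom B ℂ
    have hli2 : LinearIndependent ℂ (fun χ : Fs => (fun s : B => χ.1 s)) := by
      have := hli.comp (fun χ : Fs => ((χ.1 : B →ₐ[ℝ] ℂ) : B →* ℂ)) (by
        intro χ ψ h
        apply Subtype.ext
        ext s
        exact DFunLike.congr_fun h s)
      exact this
    rw [Fintype.linearIndependent_iff] at hli2
    have key := hli2 (fun χ => φ (Pi.single χ 1)) (by
      funext s
      have hs : (fun χ : Fs => χ.1 s) ∈ W := ⟨s, 0, fun χ => by simp⟩
      have h1 : φ (fun χ : Fs => χ.1 s) = 0 := hle hs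
      rw [LinearMap.pi_apply_eq_sum_univ φ] at h1
      simp only [Finset.sum_apply, Pi.smul_apply, smul_eq_mul, Pi.zero_apply]
      rw [← h1]
      refine Finset.sum_congr rfl fun χ _ => ?_
      rw [smul_eq_mul, mul_comm]
      congr 2
      funext ψ
      simp [Pi.single_apply, eq_comm])
    refine LinearMap.ext fun v => ?_
    rw [LinearMap.pi_apply_eq_sum_univ φ]
    simp only [LinearMap.zero_apply]
    refine Finset.sum_eq_zero fun χ _ => ?_
    have : φ (fun j => if χ = j then 1 else 0) = 0 := by
      refine Eq.trans ?_ (key χ)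
      congr 1
      funext ψ
      simp [Pi.single_apply, eq_comm]
    rw [this, smul_zero]
  have : (fun χ : Fs => t χ.1) ∈ W := by rw [hW]; trivial
  obtain ⟨α, β, h⟩ := this
  exact ⟨α, β, fun χ hχ => (h ⟨χ, hχ⟩).symm⟩

theorem interp_real {B : Type*} [CommRing B] [Algebra ℝ B] (Fs : Finset (B →ₐ[ℝ] ℂ))
    (t : (B →ₐ[ℝ] ℂ) → ℂ)
    (h : ∀ χ ∈ Fs, conjChar χ ∈ Fs ∧ t (conjChar χ) = (starRingEnd ℂ) (t χ)) :
    ∃ α : B, ∀ χ ∈ Fs, χ α = t χ := by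
  obtain ⟨α, β, hab⟩ := interp_complex Fs t
  refine ⟨α, fun χ hχ => ?_⟩
  have h1 := hab χ hχ
  have h2 := hab _ (h χ hχ).1
  rw [(h χ hχ).2] at h2
  have h3 := congrArg (starRingEnd ℂ) h2
  simp only [conjChar_apply, map_add, map_mul, Complex.conj_conj, Complex.conj_I] at h3
  linear_combination (h1 + h3) / 2

theorem conj_mem_fib {ε : A →ₐ[ℝ] ℝ} {χ : B →ₐ[ℝ] ℂ} (h : χ ∈ fib B ε) : conjChar χ ∈ fib B ε := by
  intro a
  rw [conjChar_apply, h a, Complex.conj_ofReal]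

theorem card_le_finrank (ε : A →ₐ[ℝ] ℝ) (Fs : Finset (B →ₐ[ℝ] ℂ)) (hF : ↑Fs ⊆ fib B ε) :
    Fs.card ≤ Module.finrank A B := by
  classical
  let ι := {p : Fs × Fs // p.1 ≠ p.2}
  let W : ι → Submodule ℝ B := fun p => LinearMap.ker (p.1.1.1.toLinearMap - p.1.2.1.toLinearMap)
  have hs : ∃ s : B, ∀ χ ∈ Fs, ∀ ψ ∈ Fs, χ s = ψ s → χ = ψ := by
    by_contra hcon
    push Not at hcon
    have : ⋃ i, (W i : Set B) = Set.univ := by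
      rw [Set.eq_univ_iff_forall]
      intro s
      obtain ⟨χ, hχ, ψ, hψ, h1, h2⟩ := hcon s
      rw [Set.mem_iUnion]
      refine ⟨⟨(⟨χ, hχ⟩, ⟨ψ, hψ⟩), fun h => h2 (congrArg Subtype.val h)⟩, ?_⟩
      simp [W, h1]
    obtain ⟨⟨⟨χ, ψ⟩, hi⟩, hi2⟩ := Subspace.exists_eq_top_of_iUnion_eq_univ this
    apply hi
    apply Subtype.ext
    ext s
    have : s ∈ W ⟨⟨χ, ψ⟩, hi⟩ := by rw [hi2]; trivial
    simp only [W, LinearMap.mem_ker, LinearMap.sub_apply, sub_eq_zero] at this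
    exact this
  obtain ⟨s, hs⟩ := hs
  have hInt : IsIntegral A s := Algebra.IsIntegral.isIntegral s
  have h1 : Fs.card ≤ (minpoly A s).natDegree := by
    have h2 : (Fs.image fun χ => χ s).card = Fs.card :=
      Finset.card_image_of_injOn (fun χ hχ ψ hψ h => hs χ hχ ψ hψ h)
    rw [← h2, ← (minpoly.monic hInt).natDegree_map (epsC ε)]
    refine le_trans (Finset.card_le_card (t := ((minpoly A s).map (epsC ε)).roots.toFinset) ?_)
      (le_trans (Multiset.toFinset_card_le _) (card_roots' _))
    intro z hz
    obtain ⟨χ, hχ, rfl⟩ := Finset.mem_image.1 hz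
    rw [Multiset.mem_toFinset, mem_roots_minpoly]
    exact ⟨χ, hF hχ, rfl⟩
  refine h1.trans ?_
  have h3 := (Algebra.adjoin.powerBasis' hInt).finrank
  rw [Algebra.adjoin.powerBasis'_dim] at h3
  rw [← h3]
  exact Submodule.finrank_le (Subalgebra.toSubmodule (Algebra.adjoin A {s}))

theorem fib_finite (ε : A →ₐ[ℝ] ℝ) : (fib B ε).Finite := by
  by_contra h
  obtain ⟨t, ht, hc⟩ := Set.Infinite.exists_subset_card_eq h (Module.finrank A B + 1)
  have := card_le_finrank ε t ht
  omega

theorem fib_ncard_le (ε : A →ₐ[ℝ] ℝ) : (fib B ε).ncard ≤ Module.finrank A B := by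
  rw [Set.ncard_eq_toFinset_card _ (fib_finite ε)]
  exact card_le_finrank ε _ (by simp)

/-- The fibre is totally real. -/
def RealFib (B : Type*) [CommRing B] [Algebra ℝ B] [Algebra A B] (ε : A →ₐ[ℝ] ℝ) : Prop :=
  ∀ χ ∈ fib B ε, ∀ s, (χ s).im = 0

theorem RealFib.re {ε : A →ₐ[ℝ] ℝ} (h : RealFib B ε) {χ : B →ₐ[ℝ] ℂ} (hχ : χ ∈ fib B ε) (s : B) :
    χ s = ((χ s).re : ℂ) := by
  apply Complex.ext <;> simp [h χ hχ s]

theorem RealFib.trace_sq {ε : A →ₐ[ℝ] ℝ} (h : RealFib B ε) (s : B) :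
    0 ≤ ε (Algebra.intTrace A B (s ^ 2)) := by
  apply trace_nonneg
  intro χ hχ
  refine ⟨(χ s).re ^ 2, sq_nonneg _, ?_⟩
  rw [map_pow, h.re hχ s]; simp

theorem RealFib.conj {ε : A →ₐ[ℝ] ℝ} (h : RealFib B ε) {χ : B →ₐ[ℝ] ℂ} (hχ : χ ∈ fib B ε) :
    conjChar χ = χ := by
  ext s
  rw [conjChar_apply, h.re hχ s, Complex.conj_ofReal]

theorem realFib_closure {T : Type*} [TopologicalSpace T] (ε : T → A →ₐ[ℝ] ℝ)
    (hc : ∀ a, Continuous fun t => ε t a) (T0 : Set T) (t0 : T) (ht0 : t0 ∈ closure T0)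
    (h : ∀ t ∈ T0, RealFib B (ε t)) : RealFib B (ε t0) := by
  classical
  intro χ0 hχ0 s
  by_contra hs
  have hne : conjChar χ0 ≠ χ0 := by
    intro h1
    have := DFunLike.congr_fun h1 s
    rw [conjChar_apply, Complex.conj_eq_iff_im] at this
    exact hs this
  have hinj : ∀ χ, conjChar χ = conjChar χ0 → χ = χ0 := by
    intro χ h
    rw [← conjChar_conjChar χ, h, conjChar_conjChar]
  obtain ⟨α, hα⟩ := interp_real (fib_finite (B := B) (ε t0)).toFinset
    (fun χ => if χ = χ0 then Complex.I else if χ = conjChar χ0 then -Complex.I else 0) (by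
      intro χ hχ
      rw [Set.Finite.mem_toFinset] at hχ
      refine ⟨by rw [Set.Finite.mem_toFinset]; exact conj_mem_fib hχ, ?_⟩
      by_cases h1 : χ = χ0
      · subst h1; simp [hne]
      by_cases h2 : χ = conjChar χ0
      · subst h2; simp [hne, conjChar_conjChar]
      · have h3 : conjChar χ ≠ χ0 := by
          intro h4; apply h2; rw [← h4, conjChar_conjChar]
        have h4 : conjChar χ ≠ conjChar χ0 := fun h4 => h1 (hinj _ h4)
        simp [h1, h2, h3, h4])
  have h1 : 0 < ε t0 (Algebra.intTrace A B (-α ^ 2)) := by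
    apply trace_pos
    · intro χ hχ
      have := hα χ (by simpa using hχ)
      rw [map_neg, map_pow, this]
      split_ifs
      · exact ⟨1, by norm_num, by simp⟩
      · exact ⟨1, by norm_num, by simp⟩
      · exact ⟨0, by norm_num, by simp⟩
    · refine ⟨χ0, hχ0, ?_⟩
      have := hα χ0 (by simpa using hχ0)
      rw [map_neg, map_pow, this]
      simp
  have h2 : t0 ∈ {t | 0 ≤ ε t (Algebra.intTrace A B (α ^ 2))} := by
    have hcl : IsClosed {t | 0 ≤ ε t (Algebra.intTrace A B (α ^ 2))} :=
      isClosed_le continuous_const (hc _)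
    exact closure_minimal (fun t ht => (h t ht).trace_sq α) hcl ht0
  simp only [Set.mem_setOf_eq] at h2
  rw [map_neg, map_neg] at h1
  linarith

theorem RealFib.interp {ε : A →ₐ[ℝ] ℝ} (h : RealFib B ε) (χ0 : B →ₐ[ℝ] ℂ) :
    ∃ u : B, ∀ χ ∈ fib B ε, (χ = χ0 → χ u = 1) ∧ (χ ≠ χ0 → χ u = 0) := by
  classical
  obtain ⟨α, hα⟩ := interp_real (fib_finite (B := B) ε).toFinset
    (fun χ => if χ = χ0 then 1 else 0) (by
      intro χ hχ
      rw [Set.Finite.mem_toFinset] at hχ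
      rw [h.conj hχ]
      refine ⟨by simpa using hχ, by split_ifs <;> simp⟩)
  refine ⟨α, fun χ hχ => ?_⟩
  rw [hα χ (by simpa using hχ)]
  constructor <;> intro h <;> simp [h]

theorem deriv_zero_of_sq (ε : ℝ → A →ₐ[ℝ] ℝ) (hd : ∀ a, DifferentiableAt ℝ (fun s => ε s a) 0)
    (hr : ∀ s, RealFib B (ε s)) (χ0 : B →ₐ[ℝ] ℂ) (hχ0 : χ0 ∈ fib B (ε 0)) (F : A)
    (hF : algebraMap A B F ∈ (RingHom.ker χ0) ^ 2) :
    deriv (fun s => ε s F) 0 = 0 := by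
  obtain ⟨u, hu⟩ := (hr 0).interp χ0
  have key : ∀ b ∈ (RingHom.ker χ0) ^ 2, ∃ G : A,
      (∀ s, |ε s (Algebra.intTrace A B (u ^ 2 * b))| ≤ ε s G) ∧ ε 0 G = 0 := by
    intro b hb
    rw [pow_two] at hb
    refine Submodule.mul_induction_on hb ?_ ?_
    · intro x hx y hy
      refine ⟨(1/2 : ℝ) • (Algebra.intTrace A B ((u * x) ^ 2) + Algebra.intTrace A B ((u * y) ^ 2)),
        ?_, ?_⟩
      · intro s
        have h1 := (hr s).trace_sq (u * x + u * y)
        have h2 := (hr s).trace_sq (u * x - u * y)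
        have e1 : (u * x + u * y) ^ 2 = (u * x) ^ 2 + (u * y) ^ 2 + (u ^ 2 * (x * y) + u ^ 2 * (x * y)) := by ring
        have e2 : (u * x - u * y) ^ 2 = (u * x) ^ 2 + (u * y) ^ 2 - (u ^ 2 * (x * y) + u ^ 2 * (x * y)) := by ring
        rw [e1, map_add, map_add, map_add, map_add, map_add, map_add] at h1
        rw [e2, map_sub, map_add, map_add, map_sub, map_add, map_add] at h2
        rw [map_smul, map_add, smul_eq_mul, abs_le]
        constructor <;> linarith
      · have hz : ∀ x ∈ RingHom.ker χ0, ε 0 (Algebra.intTrace A B ((u * x) ^ 2)) = 0 := by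
          intro x hx
          apply trace_zero
          intro χ hχ
          by_cases h : χ = χ0
          · subst h
            have : χ x = 0 := hx
            simp [this]
          · simp [(hu χ hχ).2 h]
        rw [map_smul, map_add, hz x hx, hz y hy]; simp
    · rintro x y ⟨G, h1, h2⟩ ⟨G', h1', h2'⟩
      refine ⟨G + G', fun s => ?_, by rw [map_add, h2, h2', add_zero]⟩
      rw [mul_add, map_add, map_add, map_add]
      exact (abs_add_le _ _).trans (add_le_add (h1 s) (h1' s))
  obtain ⟨G, hG, hG0⟩ := key _ hF
  have htr : Algebra.intTrace A B (u ^ 2 * algebraMap A B F) = F * Algebra.intTrace A B (u ^ 2) := by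
    rw [mul_comm, ← Algebra.smul_def, map_smul, smul_eq_mul]
  rw [htr] at hG
  have hF0 : ε 0 F = 0 := by
    have h1 : algebraMap A B F ∈ RingHom.ker χ0 := Ideal.pow_le_self two_ne_zero hF
    have h2 : χ0 (algebraMap A B F) = 0 := h1
    rw [hχ0 F] at h2
    exact_mod_cast h2
  have hpos : 0 < ε 0 (Algebra.intTrace A B (u ^ 2)) := by
    apply trace_pos
    · intro χ hχ
      refine ⟨(χ u).re ^ 2, sq_nonneg _, ?_⟩
      rw [map_pow, (hr 0).re hχ u]; simp
    · exact ⟨χ0, hχ0, by rw [map_pow, (hu χ0 hχ0).1 rfl]; simp⟩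
  set h := fun s => ε s F
  set τ := fun s => ε s (Algebra.intTrace A B (u ^ 2))
  have dG : deriv (fun s => ε s G) 0 = 0 := by
    apply IsLocalMin.deriv_eq_zero
    refine Filter.Eventually.of_forall fun s => ?_
    show ε 0 G ≤ ε s G
    rw [hG0]
    exact (abs_nonneg _).trans (hG s)
  have dD : deriv (fun s => ε s G - h s * τ s) 0 = 0 := by
    apply IsLocalMin.deriv_eq_zero
    refine Filter.Eventually.of_forall fun s => ?_
    show ε 0 G - h 0 * τ 0 ≤ ε s G - h s * τ s
    have e0 : h 0 = 0 := hF0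
    rw [hG0, e0]
    have := (le_abs_self _).trans (hG s)
    rw [map_mul] at this
    show _ ≤ ε s G - ε s F * ε s (Algebra.intTrace A B (u ^ 2))
    linarith
  have hh : DifferentiableAt ℝ h 0 := hd F
  have hτ : DifferentiableAt ℝ τ 0 := hd _
  have e1 : deriv (fun s => ε s G - h s * τ s) 0
      = deriv (fun s => ε s G) 0 - (deriv h 0 * τ 0 + h 0 * deriv τ 0) := by
    rw [← deriv_fun_mul hh hτ]
    exact deriv_fun_sub (hd G) (hh.mul hτ)
  rw [dD, dG] at e1
  have e0 : h 0 = 0 := hF0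
  rw [e0] at e1
  have : deriv h 0 * τ 0 = 0 := by linarith
  rcases mul_eq_zero.1 this with h | h
  · exact h
  · exact absurd h hpos.ne'

end AbsB
end OG
end PartGB

section PartGC
open Polynomial

namespace OG

section AbsC

variable {A B : Type*} [CommRing A] [IsDomain A] [IsIntegrallyClosed A] [Algebra ℝ A]
  [CommRing B] [IsDomain B] [IsIntegrallyClosed B] [Algebra ℝ B] [Algebra A B]
  [IsScalarTower ℝ A B] [Module.Finite A B] [Module.IsTorsionFree A B]

theorem pow_mem_of_vanish (ε : A →ₐ[ℝ] ℝ) (f : B) (h : ∀ χ ∈ fib B ε, χ f = 0) :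
    f ∈ ((RingHom.ker ε).map (algebraMap A B)).radical := by
  have hInt : IsIntegral A f := Algebra.IsIntegral.isIntegral f
  set p := minpoly A f with hp
  have hm : p.Monic := minpoly.monic hInt
  have hm' : (p.map (epsC ε)).Monic := hm.map _
  have hr : ∀ z ∈ (p.map (epsC ε)).roots, z = 0 := by
    intro z hz
    obtain ⟨χ, hχ, rfl⟩ := (mem_roots_minpoly ε f z).1 hz
    exact h χ hχ
  have hsp := (IsAlgClosed.splits (p.map (epsC ε))).eq_prod_roots_of_monic hm'
  have hX : p.map (epsC ε) = X ^ p.natDegree := by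
    rw [Multiset.eq_replicate_card.2 hr] at hsp
    simp only [Multiset.map_replicate, Multiset.prod_replicate, map_zero, sub_zero] at hsp
    have := congrArg natDegree hsp
    rw [natDegree_X_pow, hm.natDegree_map] at this
    rw [hsp, ← this]
  refine ⟨p.natDegree, ?_⟩
  have hz : aeval f p = 0 := minpoly.aeval A f
  have h0 : f ^ p.natDegree = - aeval f (p - X ^ p.natDegree) := by
    rw [map_sub, hz]; simp
  rw [h0, neg_mem_iff, aeval_eq_sum_range]
  refine Ideal.sum_mem _ fun i _ => ?_
  rw [Algebra.smul_def]
  refine Ideal.mul_mem_right _ _ (Ideal.mem_map_of_mem _ ?_)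
  show ε _ = 0
  have h1 := congrArg (fun q => coeff q i) hX
  simp only [coeff_map, epsC_apply] at h1
  rw [coeff_sub, map_sub, sub_eq_zero]
  apply Complex.ofReal_injective
  rw [h1, coeff_X_pow, coeff_X_pow]
  split_ifs <;> simp

theorem ideal_le_of_sq {B : Type*} [CommRing B] (I J : Ideal B) (hJ2 : J ≤ I ⊔ J ^ 2) (N : ℕ)
    (hN : J ^ N ≤ I) : J ≤ I := by
  have hJn : ∀ k, J ≤ I ⊔ J ^ (k + 1) := by
    intro k
    induction k with
    | zero => rw [zero_add, pow_one]; exact le_sup_right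
    | succ k ih =>
      refine hJ2.trans (sup_le le_sup_left ?_)
      have h1 : J ^ 2 ≤ J * (I ⊔ J ^ (k + 1)) := by
        rw [pow_two]; exact mul_le_mul_right ih J
      refine h1.trans ?_
      rw [Ideal.mul_sup]
      have h2 : J * I ≤ I := Ideal.mul_le_right
      have h3 : J * J ^ (k + 1) = J ^ (k + 1 + 1) := (pow_succ' J (k + 1)).symm
      rw [h3]
      exact sup_le_sup h2 (le_refl _)
  refine (hJn N).trans (sup_le le_rfl ?_)
  have h4 : J ^ (N + 1) ≤ J ^ N := Ideal.pow_le_pow_right (Nat.le_succ N)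
  exact h4.trans hN

theorem finrank_le_fib [IsNoetherianRing B] (ε : A →ₐ[ℝ] ℝ) (hr : RealFib B ε)
    (h : ∀ χ ∈ fib B ε, RingHom.ker χ ≤ (RingHom.ker ε).map (algebraMap A B) ⊔ (RingHom.ker χ) ^ 2) :
    Module.finrank A B ≤ (fib B ε).ncard := by
  classical
  set I := (RingHom.ker ε).map (algebraMap A B) with hI
  choose u hu using fun χ0 : B →ₐ[ℝ] ℂ => hr.interp χ0
  set Fs := (fib_finite (B := B) ε).toFinset with hFs
  have hmem : ∀ χ, χ ∈ Fs ↔ χ ∈ fib B ε := fun χ => by simp [hFs]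
  let J : Ideal B := ⨅ χ ∈ Fs, RingHom.ker χ
  have hJ : ∀ f, f ∈ J ↔ ∀ χ ∈ fib B ε, χ f = 0 := by
    intro f
    simp only [J, Submodule.mem_iInf, RingHom.mem_ker, hmem]
  have hIJ : I ≤ J := by
    rw [hI, Ideal.map_le_iff_le_comap]
    intro a ha
    rw [Ideal.mem_comap, hJ]
    intro χ hχ
    rw [hχ a]
    have : ε a = 0 := ha
    simp [this]
  have huv : ∀ χ ∈ fib B ε, ∀ c : (B →ₐ[ℝ] ℂ) → B, χ (∑ ψ ∈ Fs, c ψ * u ψ) = χ (c χ) := by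
    intro χ hχ c
    rw [map_sum, Finset.sum_eq_single χ]
    · rw [map_mul, (hu χ χ hχ).1 rfl, mul_one]
    · intro ψ hψ hne
      rw [map_mul, (hu ψ χ hχ).2 (Ne.symm hne), mul_zero]
    · intro hn; exact absurd ((hmem χ).2 hχ) hn
  have hJ2 : J ≤ I ⊔ J ^ 2 := by
    intro f hf
    have e : f = (∑ χ ∈ Fs, (u χ) ^ 2 * f) + (1 - ∑ χ ∈ Fs, (u χ) * (u χ)) * f := by
      rw [sub_mul, Finset.sum_mul, one_mul]
      simp only [pow_two]
      ring
    rw [e]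
    refine add_mem (Ideal.sum_mem _ fun χ hχ => ?_) ?_
    · have hfχ : f ∈ RingHom.ker χ := (hJ f).1 hf χ ((hmem χ).1 hχ)
      obtain ⟨i, hi, q, hq, rfl⟩ := Submodule.mem_sup.1 (h χ ((hmem χ).1 hχ) hfχ)
      rw [mul_add]
      refine add_mem (Ideal.mul_mem_left _ _ (Ideal.mem_sup_left hi)) (Ideal.mem_sup_right ?_)
      rw [pow_two] at hq
      have hux : ∀ x ∈ RingHom.ker χ, u χ * x ∈ J := by
        intro x hx
        rw [hJ]
        intro ψ hψ
        by_cases hc : ψ = χ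
        · subst hc
          have : ψ x = 0 := hx
          rw [map_mul, this, mul_zero]
        · rw [map_mul, (hu χ ψ hψ).2 hc, zero_mul]
      refine Submodule.mul_induction_on hq ?_ ?_
      · intro x hx y hy
        have : u χ ^ 2 * (x * y) = (u χ * x) * (u χ * y) := by ring
        rw [this, pow_two]
        exact Ideal.mul_mem_mul (hux x hx) (hux y hy)
      · intro x y hx hy
        rw [mul_add]
        exact add_mem hx hy
    · refine Ideal.mem_sup_right ?_
      rw [pow_two]
      refine Ideal.mul_mem_mul ?_ hf
      rw [hJ]
      intro χ hχ
      rw [map_sub, huv χ hχ, (hu χ χ hχ).1 rfl]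
      simp
  have hrad : J ≤ I.radical := fun f hf => pow_mem_of_vanish ε f ((hJ f).1 hf)
  obtain ⟨N, hN⟩ := Ideal.exists_pow_le_of_le_radical_of_fg hrad (IsNoetherian.noetherian J)
  have hJI : J ≤ I := ideal_le_of_sq I J hJ2 N hN
  let M : Submodule A B := Submodule.span A (Fs.image u : Set B)
  have hsum : ∀ b : B, ∃ m ∈ M, b - m ∈ I := by
    intro b
    refine ⟨∑ χ ∈ Fs, (algebraMap ℝ B (χ b).re) * u χ, ?_, ?_⟩
    · refine Submodule.sum_mem _ fun χ hχ => ?_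
      rw [IsScalarTower.algebraMap_apply ℝ A B, ← Algebra.smul_def]
      exact Submodule.smul_mem _ _ (Submodule.subset_span (by
        simpa using ⟨χ, hχ, rfl⟩))
    · apply hJI
      rw [hJ]
      intro χ hχ
      rw [map_sub, huv χ hχ (fun χ => algebraMap ℝ B (χ b).re), AlgHom.commutes, sub_eq_zero]
      exact hr.re hχ b
  have hI' : ∀ b ∈ I, b ∈ (RingHom.ker ε : Ideal A) • (⊤ : Submodule A B) := by
    intro b hb
    rw [Ideal.smul_top_eq_map]
    exact hb
  have hfg : (⊤ : Submodule A (B ⧸ M)).FG := Module.Finite.fg_top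
  obtain ⟨r, hr1, hr2⟩ := Submodule.exists_sub_one_mem_and_smul_eq_zero_of_fg_of_le_smul
    (RingHom.ker ε : Ideal A) (⊤ : Submodule A (B ⧸ M)) hfg (by
      intro x _
      obtain ⟨b, rfl⟩ := Submodule.mkQ_surjective M x
      obtain ⟨m, hm, hb⟩ := hsum b
      have e : M.mkQ b = M.mkQ (b - m) := by
        rw [map_sub, (Submodule.Quotient.mk_eq_zero M).2 hm |> fun h => (h : M.mkQ m = 0), sub_zero]
      rw [e]
      have h1 := Submodule.mem_map_of_mem (f := M.mkQ) (hI' _ hb)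
      rw [Submodule.map_smul''] at h1
      exact Submodule.smul_mono le_rfl le_top h1)
  have hr0 : r ≠ 0 := by
    rintro rfl
    have : ε (0 - 1) = 0 := hr1
    simp at this
  have hrM : ∀ b : B, r • b ∈ M := by
    intro b
    have := hr2 (M.mkQ b) trivial
    rw [← map_smul] at this
    exact (Submodule.Quotient.mk_eq_zero M).1 this
  let L : B →ₗ[A] M := LinearMap.codRestrict M (LinearMap.lsmul A B r) hrM
  have hL : Function.Injective L := by
    intro x y hxy
    have : r • x = r • y := congrArg Subtype.val hxy
    exact smul_right_injective B hr0 this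
  haveI : Module.Finite A M := Module.Finite.span_of_finite A (Finset.finite_toSet _)
  have h1 := LinearMap.finrank_le_finrank_of_injective hL
  refine h1.trans ?_
  refine (finrank_span_finset_le_card (R := A) (Fs.image u)).trans ?_
  rw [Set.ncard_eq_toFinset_card _ (fib_finite ε)]
  exact Finset.card_image_le

end AbsC
end OG
end PartGC

section PartGD
namespace OG

section Count

variable {σ : Type*} [Fintype σ]

def hset (w : σ → ℕ) (D : ℕ) : Set (σ → ℕ) := {α | ∑ i, w i * α i ≤ D}

theorem hset_subset (w : σ → ℕ) (hw : ∀ i, 0 < w i) (D : ℕ) :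
    hset w D ⊆ Set.pi Set.univ (fun _ => Set.Iic D) := by
  intro α hα i _
  have h1 : w i * α i ≤ ∑ i, w i * α i :=
    Finset.single_le_sum (f := fun i => w i * α i) (fun _ _ => Nat.zero_le _) (Finset.mem_univ i)
  have h2 : α i ≤ w i * α i := Nat.le_mul_of_pos_left _ (hw i)
  exact h2.trans (h1.trans hα)

theorem hset_finite (w : σ → ℕ) (hw : ∀ i, 0 < w i) (D : ℕ) : (hset w D).Finite :=
  (Set.Finite.pi' (fun _ : σ => Set.finite_Iic D)).subset (fun α hα i => hset_subset w hw D hα i trivial)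

theorem hset_ncard_le (w : σ → ℕ) (hw : ∀ i, 0 < w i) (D : ℕ) :
    (hset w D).ncard ≤ (D + 1) ^ Fintype.card σ := by
  classical
  have h1 : hset w D ⊆ ((Fintype.piFinset fun _ : σ => Finset.range (D + 1) : Finset (σ → ℕ)) : Set (σ → ℕ)) := by
    intro α hα
    simp only [Finset.mem_coe, Fintype.mem_piFinset, Finset.mem_range]
    intro i
    exact Nat.lt_succ_of_le (hset_subset w hw D hα i trivial)
  refine (Set.ncard_le_ncard h1 (Finset.finite_toSet _)).trans ?_
  rw [Set.ncard_coe_finset, Fintype.card_piFinset]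
  simp

theorem hset_pos (w : σ → ℕ) (hw : ∀ i, 0 < w i) (D : ℕ) : 0 < (hset w D).ncard := by
  rw [Set.ncard_pos (hset_finite w hw D)]
  exact ⟨0, by simp [hset]⟩

theorem one_le_prod (w : σ → ℕ) (D : ℕ) (hw : ∀ i, 0 < w i) :
    (hset (fun _ : σ => 1) D).ncard ≤ (∏ i, w i) * (hset w D).ncard := by
  classical
  let t : Finset ((σ → ℕ) × (σ → ℕ)) :=
    (Fintype.piFinset fun i : σ => Finset.range (w i)) ×ˢ (hset_finite w hw D).toFinset
  have ht : t.card = (∏ i, w i) * (hset w D).ncard := by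
    rw [Finset.card_product, Fintype.card_piFinset, Set.ncard_eq_toFinset_card _ (hset_finite w hw D)]
    simp
  rw [← ht, ← Set.ncard_coe_finset]
  refine Set.ncard_le_ncard_of_injOn (fun β => (fun i => β i % w i, fun i => β i / w i)) ?_ ?_ (Finset.finite_toSet _)
  · intro β hβ
    simp only [t, Finset.coe_product, Set.mem_prod, Finset.mem_coe, Fintype.mem_piFinset,
      Finset.mem_range, Set.Finite.mem_toFinset]
    refine ⟨fun i => Nat.mod_lt _ (hw i), ?_⟩
    have hβ' : ∑ i, 1 * β i ≤ D := hβ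
    show ∑ i, w i * (β i / w i) ≤ D
    refine le_trans (Finset.sum_le_sum fun i _ => ?_) hβ'
    rw [one_mul]; exact Nat.mul_div_le _ _
  · intro β _ β' _ h
    simp only [Prod.mk.injEq] at h
    funext i
    rw [← Nat.mod_add_div (β i) (w i), ← Nat.mod_add_div (β' i) (w i), congrFun h.1 i, congrFun h.2 i]

theorem prod_le_one (w : σ → ℕ) (D : ℕ) (hw : ∀ i, 0 < w i) :
    (∏ i, w i) * (hset w D).ncard ≤ (hset (fun _ : σ => 1) (D + ∑ i, w i)).ncard := by
  classical
  let t : Finset ((σ → ℕ) × (σ → ℕ)) :=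
    (Fintype.piFinset fun i : σ => Finset.range (w i)) ×ˢ (hset_finite w hw D).toFinset
  have ht : t.card = (∏ i, w i) * (hset w D).ncard := by
    rw [Finset.card_product, Fintype.card_piFinset, Set.ncard_eq_toFinset_card _ (hset_finite w hw D)]
    simp
  rw [← ht, ← Set.ncard_coe_finset]
  refine Set.ncard_le_ncard_of_injOn (fun p => fun i => p.1 i + w i * p.2 i) ?_ ?_
    (hset_finite _ (fun _ => one_pos) _)
  · rintro ⟨ρ, α⟩ h
    simp only [t, Finset.coe_product, Set.mem_prod, Finset.mem_coe, Fintype.mem_piFinset,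
      Finset.mem_range, Set.Finite.mem_toFinset] at h
    show ∑ i, 1 * (ρ i + w i * α i) ≤ _
    simp only [one_mul]
    rw [Finset.sum_add_distrib, add_comm]
    exact add_le_add h.2 (Finset.sum_le_sum fun i _ => (h.1 i).le)
  · rintro ⟨ρ, α⟩ h ⟨ρ', α'⟩ h' e
    simp only [t, Finset.coe_product, Set.mem_prod, Finset.mem_coe, Fintype.mem_piFinset,
      Finset.mem_range, Set.Finite.mem_toFinset] at h h'
    have e' : ∀ i, ρ i + w i * α i = ρ' i + w i * α' i := fun i => congrFun e i
    ext i
    · have := congrArg (· % w i) (e' i)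
      simpa [Nat.add_mul_mod_self_left, Nat.mod_eq_of_lt (h.1 i), Nat.mod_eq_of_lt (h'.1 i)] using this
    · have := congrArg (· / w i) (e' i)
      simpa [Nat.add_mul_div_left _ _ (hw i), Nat.div_eq_of_lt (h.1 i), Nat.div_eq_of_lt (h'.1 i)] using this

theorem count_limit (a b e : ℕ)
    (h : ∀ D, a * (hset (fun _ : σ => 1) D).ncard ≤ b * (hset (fun _ : σ => 1) (D + e)).ncard) :
    a ≤ b := by
  by_contra hab
  push Not at hab
  set s : ℕ → ℝ := fun D => ((hset (fun _ : σ => 1) D).ncard : ℝ) with hs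
  have hs1 : ∀ D, 1 ≤ s D := fun D => by
    have := hset_pos (fun _ : σ => 1) (fun _ => one_pos) D
    simp only [hs]; exact_mod_cast this
  have hb : 0 < b := by
    rcases Nat.eq_zero_or_pos b with rfl | hb
    · have := h 0
      have := hset_pos (fun _ : σ => 1) (fun _ => one_pos) 0
      nlinarith
    · exact hb
  set q : ℝ := (a : ℝ) / b with hq
  have hq1 : 1 < q := by
    rw [hq, one_lt_div (by exact_mod_cast hb)]; exact_mod_cast hab
  have hstep : ∀ D, q * s D ≤ s (D + e) := by
    intro D
    rw [hq, div_mul_eq_mul_div, div_le_iff₀ (by exact_mod_cast hb)]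
    have := h D
    simp only [hs]
    rw [mul_comm _ (b : ℝ)]
    exact_mod_cast this
  have hk : ∀ k : ℕ, q ^ k ≤ s (k * e) := by
    intro k
    induction k with
    | zero => simpa using hs1 0
    | succ k ih =>
      rw [pow_succ', Nat.succ_mul]
      exact (mul_le_mul_of_nonneg_left ih (by linarith)).trans (hstep _)
  have hk2 : ∀ k : ℕ, q ^ k ≤ ((k : ℝ) * e + 1) ^ Fintype.card σ := by
    intro k
    refine (hk k).trans ?_
    have := hset_ncard_le (fun _ : σ => 1) (fun _ => one_pos) (k * e)
    simp only [hs]; exact_mod_cast this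
  set m := Fintype.card σ
  have hk3 : ∀ k : ℕ, 1 ≤ k → q ^ k ≤ ((e : ℝ) + 1) ^ m * (k : ℝ) ^ m := by
    intro k hk
    refine (hk2 k).trans ?_
    rw [← mul_pow]
    have : (1 : ℝ) ≤ k := by exact_mod_cast hk
    apply pow_le_pow_left₀ (by positivity)
    nlinarith
  have hlim := tendsto_pow_const_div_const_pow_of_one_lt m hq1
  have hc : (0 : ℝ) < 1 / (((e : ℝ) + 1) ^ m) := by positivity
  have hev := (hlim.eventually (gt_mem_nhds hc)).and (Filter.eventually_ge_atTop 1)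
  obtain ⟨k, hk4, hk5⟩ := hev.exists
  rw [div_lt_div_iff₀ (by positivity) (by positivity), one_mul] at hk4
  have := hk3 k hk5
  linarith [mul_comm ((k : ℝ) ^ m) (((e : ℝ) + 1) ^ m)]

theorem hset_one_congr {τ : Type*} [Fintype τ] (hc : Fintype.card σ = Fintype.card τ) (D : ℕ) :
    (hset (fun _ : σ => 1) D).ncard = (hset (fun _ : τ => 1) D).ncard := by
  let e := Fintype.equivOfCardEq hc
  have : hset (fun _ : σ => 1) D = (fun α : τ → ℕ => α ∘ e) '' (hset (fun _ : τ => 1) D) := by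
    ext α
    constructor
    · intro h
      refine ⟨α ∘ e.symm, ?_, by ext; simp⟩
      show ∑ i, 1 * α (e.symm i) ≤ D
      rw [e.symm.sum_comp (fun i => 1 * α i)]
      exact h
    · rintro ⟨β, h, rfl⟩
      show ∑ i, 1 * β (e i) ≤ D
      rw [e.sum_comp (fun i => 1 * β i)]
      exact h
  rw [this, Set.ncard_image_of_injective]
  intro α β h
  funext i
  have := congrFun h (e.symm i)
  simpa using this

theorem rank_of_counts {τ : Type*} [Fintype τ] (hc : Fintype.card σ = Fintype.card τ)
    (w : σ → ℕ) (d : τ → ℕ) (hw : ∀ i, 0 < w i) (hd : ∀ i, 0 < d i) (r a a' : ℕ)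
    (h1 : ∀ D, r * (hset d D).ncard ≤ (hset w (D + a)).ncard)
    (h2 : ∀ D, (hset w D).ncard ≤ r * (hset d (D + a')).ncard) :
    r * ∏ i, w i = ∏ i, d i := by
  apply le_antisymm
  · apply count_limit (σ := σ) _ _ (a + ∑ i, w i)
    intro D
    have e1 := one_le_prod d D hd
    have e2 := prod_le_one w (D + a) hw
    rw [hset_one_congr hc D, ← add_assoc]
    calc _ ≤ r * (∏ i, w i) * ((∏ i, d i) * (hset d D).ncard) := Nat.mul_le_mul_left _ e1
      _ = (∏ i, d i) * (∏ i, w i) * (r * (hset d D).ncard) := by ring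
      _ ≤ (∏ i, d i) * (∏ i, w i) * (hset w (D + a)).ncard := Nat.mul_le_mul_left _ (h1 D)
      _ ≤ _ := by rw [mul_assoc]; exact Nat.mul_le_mul_left _ e2
  · apply count_limit (σ := σ) _ _ (a' + ∑ i, d i)
    intro D
    have e1 := one_le_prod w D hw
    have e2 := prod_le_one d (D + a') hd
    rw [← hset_one_congr hc] at e2
    rw [← add_assoc]
    calc _ ≤ (∏ i, d i) * ((∏ i, w i) * (hset w D).ncard) := Nat.mul_le_mul_left _ e1
      _ ≤ (∏ i, d i) * ((∏ i, w i) * (r * (hset d (D + a')).ncard)) :=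
          Nat.mul_le_mul_left _ (Nat.mul_le_mul_left _ (h2 D))
      _ = r * (∏ i, w i) * ((∏ i, d i) * (hset d (D + a')).ncard) := by ring
      _ ≤ _ := Nat.mul_le_mul_left _ e2

end Count
end OG
end PartGD

section PartGE
open MvPolynomial

namespace OG

section Poly

variable {σ τ : Type} [Fintype σ] [Fintype τ]

/-- Filtration of the polynomial ring by weighted degree. -/
noncomputable def Sle (w : σ → ℕ) (D : ℕ) : Submodule ℝ (MvPolynomial σ ℝ) :=
  restrictSupport ℝ {α | Finsupp.weight w α ≤ D}

theorem mem_Sle {w : σ → ℕ} {D : ℕ} {p : MvPolynomial σ ℝ} :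
    p ∈ Sle w D ↔ ∀ α ∈ p.support, Finsupp.weight w α ≤ D := by
  rw [Sle, mem_restrictSupport_iff]; rfl

theorem Sle_mono (w : σ → ℕ) {D E : ℕ} (h : D ≤ E) : Sle w D ≤ Sle w E :=
  fun _ hp => mem_Sle.2 fun α hα => (mem_Sle.1 hp α hα).trans h

theorem Sle_mul {w : σ → ℕ} {D E : ℕ} {p q : MvPolynomial σ ℝ} (hp : p ∈ Sle w D)
    (hq : q ∈ Sle w E) : p * q ∈ Sle w (D + E) := by
  classical
  rw [mem_Sle] at *
  intro α hα
  obtain ⟨β, hβ, γ, hγ, rfl⟩ := Finset.mem_add.1 (support_mul p q hα)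
  rw [map_add]
  exact add_le_add (hp β hβ) (hq γ hγ)

theorem Sle_one (w : σ → ℕ) (D : ℕ) : (1 : MvPolynomial σ ℝ) ∈ Sle w D := by
  classical
  rw [mem_Sle]
  intro α hα
  have : α = 0 := by
    by_contra h
    rw [mem_support_iff, coeff_one, if_neg (Ne.symm h)] at hα
    exact hα rfl
  rw [this]; simp

theorem Sle_hom {w : σ → ℕ} {D : ℕ} {p : MvPolynomial σ ℝ} (hp : IsWeightedHomogeneous w p D) :
    p ∈ Sle w D := mem_Sle.2 fun α hα => (hp (mem_support_iff.1 hα)).le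

theorem exists_Sle (w : σ → ℕ) (p : MvPolynomial σ ℝ) : ∃ D, p ∈ Sle w D :=
  ⟨_, mem_Sle.2 fun _ hα => le_weightedTotalDegree w hα⟩

theorem exists_Sle_family {ι : Type*} [Finite ι] (w : σ → ℕ) (p : ι → MvPolynomial σ ℝ) :
    ∃ D, ∀ i, p i ∈ Sle w D := by
  cases nonempty_fintype ι
  choose D hD using fun i => exists_Sle w (p i)
  exact ⟨∑ i, D i, fun i => Sle_mono w (Finset.single_le_sum (fun _ _ => Nat.zero_le _)
    (Finset.mem_univ i)) (hD i)⟩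

theorem weight_eq (w : σ → ℕ) (α : σ →₀ ℕ) : Finsupp.weight w α = ∑ i, w i * α i := by
  rw [Finsupp.weight_apply, Finsupp.sum_fintype _ _ (by simp)]
  simp [mul_comm]

theorem finrank_Sle (w : σ → ℕ) (D : ℕ) : Module.finrank ℝ (Sle w D) = (hset w D).ncard := by
  have h1 := Module.finrank_eq_nat_card_basis (basisRestrictSupport ℝ {α | Finsupp.weight w α ≤ D})
  refine h1.trans ?_
  rw [Nat.card_coe_set_eq]
  have : hset w D = Finsupp.equivFunOnFinite '' {α | Finsupp.weight w α ≤ D} := by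
    ext α
    constructor
    · intro h
      refine ⟨Finsupp.equivFunOnFinite.symm α, ?_, by simp⟩
      show Finsupp.weight w _ ≤ D
      rw [weight_eq]
      exact h
    · rintro ⟨β, h, rfl⟩
      have : Finsupp.weight w β ≤ D := h
      rw [weight_eq] at this
      exact this
  rw [this, Set.ncard_image_of_injective _ Finsupp.equivFunOnFinite.injective]

theorem finite_Sle (w : σ → ℕ) (hw : ∀ i, 0 < w i) (D : ℕ) : Module.Finite ℝ (Sle w D) := by
  apply Module.finite_of_finrank_pos
  rw [finrank_Sle]
  exact hset_pos w hw D

/-- A weighted homogeneous polynomial map with finite zero fibre. -/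
structure PMap (σ τ : Type) [Fintype σ] [Fintype τ] where
  f : τ → MvPolynomial σ ℝ
  w : σ → ℕ
  d : τ → ℕ
  hw : ∀ i, 0 < w i
  hd : ∀ i, 0 < d i
  hom : ∀ t, IsWeightedHomogeneous w (f t) (d t)
  zero : ∀ x : σ → ℂ, (∀ t, aeval x (f t) = 0) → x = 0
  card : Fintype.card σ = Fintype.card τ

variable (F : PMap σ τ)

theorem PMap.aeval_mem {D : ℕ} {c : MvPolynomial τ ℝ} (hc : c ∈ Sle F.d D) :
    aeval F.f c ∈ Sle F.w D := by
  rw [c.as_sum, map_sum]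
  refine Submodule.sum_mem _ fun α hα => ?_
  have h1 := mem_Sle.1 hc α hα
  rw [aeval_monomial, Finsupp.prod_fintype _ _ (by simp), ← Algebra.smul_def]
  refine Submodule.smul_mem _ _ (Sle_mono _ h1 (Sle_hom ?_))
  rw [weight_eq]
  apply IsWeightedHomogeneous.prod
  intro t _
  have := (F.hom t).pow (α t)
  rwa [smul_eq_mul, mul_comm] at this

theorem comp_mul (w : σ → ℕ) (f : MvPolynomial σ ℝ) (d : ℕ) (hf : IsWeightedHomogeneous w f d)
    (g : MvPolynomial σ ℝ) (n : ℕ) :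
    weightedHomogeneousComponent w n (g * f) =
      if d ≤ n then weightedHomogeneousComponent w (n - d) g * f else 0 := by
  induction g using MvPolynomial.induction_on' with
  | monomial β c =>
    have h1 := isWeightedHomogeneous_monomial w β c rfl
    have h2 := h1.mul hf
    rw [weightedHomogeneousComponent_of_mem ((mem_weightedHomogeneousSubmodule _ _ _ _).2 h2),
      weightedHomogeneousComponent_of_mem ((mem_weightedHomogeneousSubmodule _ _ _ _).2 h1)]
    by_cases h : d ≤ n
    · rw [if_pos h]
      by_cases h3 : n = Finsupp.weight w β + d
      · rw [if_pos h3, if_pos (by omega)]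
      · rw [if_neg h3, if_neg (by omega), zero_mul]
    · rw [if_neg h, if_neg (by omega)]
  | add p q hp hq =>
    rw [add_mul, map_add, hp, hq, map_add]
    split_ifs
    · rw [add_mul]
    · rw [add_zero]

theorem PMap.exists_N : ∃ N, ∀ i : σ, (X i : MvPolynomial σ ℝ) ^ N ∈ Ideal.span (Set.range F.f) := by
  have h : ∀ i : σ, (X i : MvPolynomial σ ℝ) ∈ (Ideal.span (Set.range F.f)).radical := by
    intro i
    rw [← MvPolynomial.vanishingIdeal_zeroLocus_eq_radical (K := ℂ)]
    intro x hx
    have : x = 0 := F.zero x fun t => hx _ (Ideal.subset_span ⟨t, rfl⟩)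
    simp [this]
  choose N hN using h
  refine ⟨∑ i, N i, fun i => ?_⟩
  exact Ideal.pow_mem_of_pow_mem _ (hN i) (Finset.single_le_sum (f := N) (fun _ _ => Nat.zero_le _)
    (Finset.mem_univ i))

end Poly
end OG
end PartGE

section PartGF
open MvPolynomial

namespace OG

section Poly

variable {σ τ : Type} [Fintype σ] [Fintype τ] (F : PMap σ τ)

theorem PMap.exists_g {N : ℕ} (i : σ) (h : (X i : MvPolynomial σ ℝ) ^ N ∈ Ideal.span (Set.range F.f)) :
    ∃ g : τ → MvPolynomial σ ℝ, (X i : MvPolynomial σ ℝ) ^ N = ∑ t, g t * F.f t ∧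
      ∀ t, (g t = 0 ∨ F.d t ≤ N * F.w i) ∧ g t ∈ Sle F.w (N * F.w i - F.d t) := by
  obtain ⟨g, hg⟩ := (Ideal.mem_span_range_iff_exists_fun).1 h
  have hX : IsWeightedHomogeneous F.w ((X i : MvPolynomial σ ℝ) ^ N) (N * F.w i) := by
    have := (isWeightedHomogeneous_X ℝ F.w i).pow N
    simpa using this
  refine ⟨fun t => if F.d t ≤ N * F.w i then
    weightedHomogeneousComponent F.w (N * F.w i - F.d t) (g t) else 0, ?_, ?_⟩
  · have h1 := congrArg (weightedHomogeneousComponent F.w (N * F.w i)) hg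
    rw [weightedHomogeneousComponent_of_mem ((mem_weightedHomogeneousSubmodule _ _ _ _).2 hX),
      if_pos rfl, map_sum] at h1
    rw [← h1]
    refine Finset.sum_congr rfl fun t _ => ?_
    rw [comp_mul _ _ _ (F.hom t)]
    split_ifs with h2 <;> simp [h2]
  · intro t
    dsimp only
    split_ifs with h
    · exact ⟨Or.inr h, Sle_hom (weightedHomogeneousComponent_isWeightedHomogeneous _ _)⟩
    · exact ⟨Or.inl rfl, zero_mem _⟩

/-- The finite generating family. -/
noncomputable def mon (N : ℕ) (β : σ → Fin N) : MvPolynomial σ ℝ :=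
  monomial (Finsupp.equivFunOnFinite.symm fun i => (β i : ℕ)) 1

theorem PMap.gen [DecidableEq σ] {N : ℕ} (hN : ∀ i : σ, (X i : MvPolynomial σ ℝ) ^ N ∈ Ideal.span (Set.range F.f)) :
    ∀ D : ℕ, ∀ p ∈ Sle F.w D, ∃ c : (σ → Fin N) → MvPolynomial τ ℝ, (∀ β, c β ∈ Sle F.d D) ∧
      p = ∑ β, aeval F.f (c β) * mon N β := by
  intro D
  induction D using Nat.strong_induction_on with
  | _ D ih =>
  -- the set of good p
  have hadd : ∀ p q : MvPolynomial σ ℝ,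
      (∃ c : (σ → Fin N) → MvPolynomial τ ℝ, (∀ β, c β ∈ Sle F.d D) ∧
      p = ∑ β, aeval F.f (c β) * mon N β) →
      (∃ c : (σ → Fin N) → MvPolynomial τ ℝ, (∀ β, c β ∈ Sle F.d D) ∧
      q = ∑ β, aeval F.f (c β) * mon N β) →
      (∃ c : (σ → Fin N) → MvPolynomial τ ℝ, (∀ β, c β ∈ Sle F.d D) ∧
      p + q = ∑ β, aeval F.f (c β) * mon N β) := by
    rintro p q ⟨c, hc, rfl⟩ ⟨c', hc', rfl⟩
    refine ⟨fun β => c β + c' β, fun β => add_mem (hc β) (hc' β), ?_⟩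
    rw [← Finset.sum_add_distrib]
    refine Finset.sum_congr rfl fun β _ => ?_
    rw [map_add, add_mul]
  have hzero : ∃ c : (σ → Fin N) → MvPolynomial τ ℝ, (∀ β, c β ∈ Sle F.d D) ∧
      (0 : MvPolynomial σ ℝ) = ∑ β, aeval F.f (c β) * mon N β :=
    ⟨fun _ => 0, fun _ => zero_mem _, by simp⟩
  have hsum : ∀ {ι : Type} (s : Finset ι) (P : ι → MvPolynomial σ ℝ), (∀ i ∈ s,
      (∃ c : (σ → Fin N) → MvPolynomial τ ℝ, (∀ β, c β ∈ Sle F.d D) ∧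
      P i = ∑ β, aeval F.f (c β) * mon N β)) →
      (∃ c : (σ → Fin N) → MvPolynomial τ ℝ, (∀ β, c β ∈ Sle F.d D) ∧
      ∑ i ∈ s, P i = ∑ β, aeval F.f (c β) * mon N β) := by
    intro ι s P h
    classical
    induction s using Finset.induction_on with
    | empty => simpa using hzero
    | insert a s ha ih' =>
      rw [Finset.sum_insert ha]
      exact hadd _ _ (h a (Finset.mem_insert_self _ _))
        (ih' fun i hi => h i (Finset.mem_insert_of_mem hi))
  intro p hp
  rw [p.as_sum]
  refine hsum _ _ fun α hα => ?_
  have hαD := mem_Sle.1 hp α hα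
  by_cases hsmall : ∀ i, α i < N
  · refine ⟨fun β => if β = (fun i => ⟨α i, hsmall i⟩) then C (coeff α p) else 0, ?_, ?_⟩
    · intro β
      dsimp only
      split_ifs
      · rw [C_eq_smul_one]; exact Submodule.smul_mem _ _ (Sle_one _ _)
      · exact zero_mem _
    · rw [Finset.sum_eq_single (fun i => ⟨α i, hsmall i⟩)]
      · dsimp only
        rw [if_pos rfl, mon]
        have : (Finsupp.equivFunOnFinite.symm fun i => α i) = α := by ext; simp
        simp only [this]
        rw [aeval_C, algebraMap_eq, C_mul_monomial, mul_one]
      · intro β _ hβ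
        dsimp only
        rw [if_neg hβ]; simp
      · simp
  · push Not at hsmall
    obtain ⟨i, hi⟩ := hsmall
    obtain ⟨g, hg, hg2⟩ := F.exists_g i (hN i)
    have hα' : α = (α - Finsupp.single i N) + Finsupp.single i N :=
      (tsub_add_cancel_of_le (by rwa [Finsupp.single_le_iff])).symm
    set α' := α - Finsupp.single i N with hα'def
    have hw : Finsupp.weight F.w α = Finsupp.weight F.w α' + N * F.w i := by
      conv_lhs => rw [hα', map_add]
      rw [Finsupp.weight_single, smul_eq_mul]
    have hm : monomial α (coeff α p) = ∑ t, monomial α' (coeff α p) * g t * F.f t := by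
      have : monomial α (coeff α p) = monomial α' (coeff α p) * X i ^ N := by
        rw [X_pow_eq_monomial, monomial_mul, mul_one, ← hα']
      rw [this, hg, Finset.mul_sum]
      exact Finset.sum_congr rfl fun t _ => (mul_assoc _ _ _).symm
    rw [hm]
    refine hsum _ _ fun t _ => ?_
    obtain ⟨h1, h2⟩ := hg2 t
    rcases h1 with h1 | h1
    · rw [h1]; simpa using hzero
    · have hq : monomial α' (coeff α p) * g t ∈ Sle F.w (D - F.d t) := by
        refine Sle_mono F.w (?_ : Finsupp.weight F.w α' + (N * F.w i - F.d t) ≤ _) (Sle_mul (mem_Sle.2 ?_) h2)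
        · omega
        · intro γ hγ
          have := support_monomial_subset hγ
          rw [Finset.mem_singleton.1 this]
      have hd := F.hd t
      obtain ⟨c, hc, hc2⟩ := ih (D - F.d t) (by omega) _ hq
      refine ⟨fun β => c β * X t, fun β => ?_, ?_⟩
      · refine Sle_mono F.d (?_ : (D - F.d t) + F.d t ≤ D) (Sle_mul (hc β) (Sle_hom (isWeightedHomogeneous_X ℝ F.d t)))
        omega
      · rw [hc2, Finset.sum_mul]
        refine Finset.sum_congr rfl fun β _ => ?_
        rw [map_mul, aeval_X]; ring

end Poly
end OG
end PartGF

section PartGG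
open MvPolynomial

namespace OG

section Poly

variable {σ τ : Type} [Fintype σ] [Fintype τ] (F : PMap σ τ)

/-- The source ring, as an algebra over the target ring. -/
def PMap.B (_ : PMap σ τ) : Type := MvPolynomial σ ℝ

noncomputable instance : CommRing F.B := inferInstanceAs (CommRing (MvPolynomial σ ℝ))
instance : IsDomain F.B := inferInstanceAs (IsDomain (MvPolynomial σ ℝ))
noncomputable instance : Algebra ℝ F.B := inferInstanceAs (Algebra ℝ (MvPolynomial σ ℝ))
instance : IsNoetherianRing F.B := inferInstanceAs (IsNoetherianRing (MvPolynomial σ ℝ))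
instance : IsIntegrallyClosed F.B := inferInstanceAs (IsIntegrallyClosed (MvPolynomial σ ℝ))
noncomputable instance : Algebra (MvPolynomial τ ℝ) F.B :=
  RingHom.toAlgebra (aeval F.f : MvPolynomial τ ℝ →ₐ[ℝ] MvPolynomial σ ℝ).toRingHom

theorem PMap.algebraMap_eq (c : MvPolynomial τ ℝ) :
    algebraMap (MvPolynomial τ ℝ) F.B c = (aeval F.f c : MvPolynomial σ ℝ) := rfl

instance : IsScalarTower ℝ (MvPolynomial τ ℝ) F.B :=
  IsScalarTower.of_algebraMap_eq fun r => by
    rw [MvPolynomial.algebraMap_eq, PMap.algebraMap_eq, aeval_C]; rfl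

theorem PMap.exists_gen : ∃ (k : ℕ) (m : Fin k → MvPolynomial σ ℝ), ∀ D : ℕ, ∀ p ∈ Sle F.w D,
    ∃ c : Fin k → MvPolynomial τ ℝ, (∀ β, c β ∈ Sle F.d D) ∧
      p = ∑ β, aeval F.f (c β) * m β := by
  classical
  obtain ⟨N, hN⟩ := F.exists_N
  let e := Fintype.equivFin (σ → Fin N)
  refine ⟨_, fun j => mon N (e.symm j), fun D p hp => ?_⟩
  obtain ⟨c, hc, h⟩ := F.gen hN D p hp
  refine ⟨fun j => c (e.symm j), fun j => hc _, h.trans ?_⟩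
  exact (Equiv.sum_comp e.symm (fun β => aeval F.f (c β) * mon N β)).symm

instance : Module.Finite (MvPolynomial τ ℝ) F.B := by
  classical
  obtain ⟨k, m, hm⟩ := F.exists_gen
  refine Module.Finite.of_surjective
    (Fintype.linearCombination (MvPolynomial τ ℝ) (M := F.B) m) ?_
  intro p
  obtain ⟨D, hD⟩ := exists_Sle F.w (p : MvPolynomial σ ℝ)
  obtain ⟨c, _, h⟩ := hm D p hD
  exact ⟨c, (Fintype.linearCombination_apply _ _ _).trans h.symm⟩

theorem PMap.injective : Function.Injective (aeval F.f : MvPolynomial τ ℝ →ₐ[ℝ] MvPolynomial σ ℝ) := by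
  classical
  have fin : Module.Finite (Algebra.adjoin ℝ (Set.range F.f)) (MvPolynomial σ ℝ) := by
    obtain ⟨k, m, hm⟩ := F.exists_gen
    refine Module.Finite.of_surjective
      (Fintype.linearCombination (Algebra.adjoin ℝ (Set.range F.f)) m) ?_
    intro p
    obtain ⟨D, hD⟩ := exists_Sle F.w (p : MvPolynomial σ ℝ)
    obtain ⟨c, _, h⟩ := hm D p hD
    refine ⟨fun j => ⟨aeval F.f (c j), ?_⟩, ?_⟩
    · rw [Algebra.adjoin_range_eq_range_aeval]
      exact ⟨_, rfl⟩
    · rw [Fintype.linearCombination_apply]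
      exact h.symm
  have alg : Algebra.IsAlgebraic (Algebra.adjoin ℝ (Set.range F.f)) (MvPolynomial σ ℝ) :=
    inferInstance
  have := Algebra.IsAlgebraic.isTranscendenceBasis_of_le_trdeg_of_finite ℝ F.f (by
    rw [MvPolynomial.trdeg_of_isDomain]
    simp [F.card])
  exact this.1

instance : Module.IsTorsionFree (MvPolynomial τ ℝ) F.B := by
  have : FaithfulSMul (MvPolynomial τ ℝ) F.B :=
    (faithfulSMul_iff_algebraMap_injective _ _).2 F.injective
  infer_instance

theorem PMap.rank_eq : Module.finrank (MvPolynomial τ ℝ) F.B * ∏ i, F.w i = ∏ t, F.d t := by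
  classical
  set r := Module.finrank (MvPolynomial τ ℝ) F.B with hr
  obtain ⟨v, hv⟩ := exists_linearIndependent_of_le_finrank (R := MvPolynomial τ ℝ) (M := F.B)
    (n := r) le_rfl
  have hvB := hv
  rw [Fintype.linearIndependent_iff] at hv
  let v' : Fin r → MvPolynomial σ ℝ := v
  obtain ⟨a, ha⟩ := exists_Sle_family F.w (fun i => v' i)
  let L : (Fin r → MvPolynomial τ ℝ) →ₗ[ℝ] MvPolynomial σ ℝ :=
    { toFun := fun c => ∑ i, aeval F.f (c i) * v' i
      map_add' := fun c c' => by
        simp only [Pi.add_apply, map_add, add_mul, Finset.sum_add_distrib]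
      map_smul' := fun s c => by
        simp only [Pi.smul_apply, map_smul, Finset.smul_sum, smul_mul_assoc, RingHom.id_apply] }
  have hL : Function.Injective L := by
    rw [← LinearMap.ker_eq_bot, LinearMap.ker_eq_bot']
    intro c hc
    ext1 i
    exact hv c hc i
  have hfin : ∀ D, Module.finrank ℝ (Fin r → Sle F.d D) = r * (hset F.d D).ncard := by
    intro D
    have := finite_Sle F.d F.hd D
    rw [Module.finrank_pi_fintype, Finset.sum_const, finrank_Sle]
    simp
  let ι' : ∀ D, (Fin r → Sle F.d D) →ₗ[ℝ] (Fin r → MvPolynomial τ ℝ) := fun D =>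
    LinearMap.pi fun i => (Sle F.d D).subtype ∘ₗ LinearMap.proj i
  have hι : ∀ D, Function.Injective (ι' D) := by
    intro D c c' h
    ext1 i
    exact Subtype.ext (congrFun h i)
  have key : ∃ e, ∀ D, (hset F.w D).ncard ≤ r * (hset F.d (D + e)).ncard := by
      obtain ⟨k, m, hm⟩ := F.exists_gen
      let mB : Fin k → F.B := m
      set S := Submodule.span (MvPolynomial τ ℝ) (Set.range v)
      have h0 : Module.finrank (MvPolynomial τ ℝ) (F.B ⧸ S) = 0 := by
        have h1 := S.finrank_quotient_add_finrank
        rw [finrank_span_eq_card hvB, Fintype.card_fin] at h1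
        omega
      rw [Module.finrank_eq_zero_iff] at h0
      have h2 : ∀ j, ∃ ρ : MvPolynomial τ ℝ, ρ ≠ 0 ∧ ρ • mB j ∈ S := by
        intro j
        obtain ⟨ρ, h, h'⟩ := h0 (S.mkQ (mB j))
        refine ⟨ρ, h, ?_⟩
        rw [← map_smul] at h'
        exact (Submodule.Quotient.mk_eq_zero S).1 h'
      choose ρ hρ hρS using h2
      set R := ∏ j, ρ j with hR
      have hR0 : R ≠ 0 := Finset.prod_ne_zero_iff.2 fun j _ => hρ j
      have h3 : ∀ j, ∃ u : Fin r → MvPolynomial τ ℝ, aeval F.f R * m j = L u := by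
        intro j
        have : R • mB j ∈ S := by
          rw [hR, ← Finset.prod_erase_mul _ _ (Finset.mem_univ j), mul_smul]
          exact S.smul_mem _ (hρS j)
        obtain ⟨u, hu⟩ := (Submodule.mem_span_range_iff_exists_fun _).1 this
        exact ⟨u, hu.symm⟩
      choose u hu using h3
      obtain ⟨e, he⟩ := exists_Sle_family F.d (fun ji : Fin k × Fin r => u ji.1 ji.2)
      refine ⟨e, fun D => ?_⟩
      have hRf : (aeval F.f R : MvPolynomial σ ℝ) ≠ 0 := by
        rw [Ne, map_eq_zero_iff _ F.injective]; exact hR0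
      have fS := finite_Sle F.d F.hd (D + e)
      rw [← hfin, ← finrank_Sle]
      let M := L ∘ₗ ι' (D + e)
      let mulR : MvPolynomial σ ℝ →ₗ[ℝ] MvPolynomial σ ℝ := LinearMap.mulLeft ℝ (aeval F.f R)
      have hinj : Function.Injective mulR := fun p q h => mul_left_cancel₀ hRf h
      have hle : (Sle F.w D).map mulR ≤ LinearMap.range M := by
        rintro _ ⟨p, hp, rfl⟩
        obtain ⟨c, hc, rfl⟩ := hm D p hp
        refine ⟨fun i => ⟨∑ j, c j * u j i, ?_⟩, ?_⟩
        · exact Submodule.sum_mem _ fun j _ => Sle_mul (hc j) (he (j, i))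
        · show ∑ i, aeval F.f (∑ j, c j * u j i) * v' i = aeval F.f R * _
          simp only [map_sum, map_mul, Finset.sum_mul, Finset.mul_sum]
          rw [Finset.sum_comm]
          refine Finset.sum_congr rfl fun j _ => ?_
          rw [mul_left_comm, hu j]
          show _ = aeval F.f (c j) * ∑ i, aeval F.f (u j i) * v' i
          rw [Finset.mul_sum]
          exact Finset.sum_congr rfl fun i _ => mul_assoc _ _ _
      calc Module.finrank ℝ (Sle F.w D) = Module.finrank ℝ ((Sle F.w D).map mulR) :=
            (LinearEquiv.finrank_eq (Submodule.equivMapOfInjective mulR hinj _))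
        _ ≤ Module.finrank ℝ (LinearMap.range M) := Submodule.finrank_mono hle
        _ ≤ _ := LinearMap.finrank_range_le M
  obtain ⟨e, he⟩ := key
  refine rank_of_counts F.card F.w F.d F.hw F.hd r a e ?_ he
  · intro D
    rw [← hfin, ← finrank_Sle]
    have := finite_Sle F.w F.hw (D + a)
    let M : (Fin r → Sle F.d D) →ₗ[ℝ] Sle F.w (D + a) := (L ∘ₗ ι' D).codRestrict _ (fun c => by
      exact Submodule.sum_mem _ fun i _ => Sle_mul (F.aeval_mem (c i).2) (ha i))
    refine LinearMap.finrank_le_finrank_of_injective (f := M) ?_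
    intro c c' h
    exact hι D (hL (congrArg Subtype.val h))

end Poly
end OG
end PartGG

section PartGH
open MvPolynomial

namespace OG

section Poly

variable {σ τ : Type} [Fintype σ] [Fintype τ] (F : PMap σ τ)

/-- The complex fibre over a real point. -/
def PMap.fiber (c : τ → ℝ) : Set (σ → ℂ) := {x | ∀ t, aeval x (F.f t) = (c t : ℂ)}

/-- Evaluation character. -/
noncomputable def PMap.ev (x : σ → ℂ) : F.B →ₐ[ℝ] ℂ := (aeval x : MvPolynomial σ ℝ →ₐ[ℝ] ℂ)

theorem PMap.ev_apply (x : σ → ℂ) (p : MvPolynomial σ ℝ) : F.ev x p = aeval x p := rfl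

noncomputable def epsOf (c : τ → ℝ) : MvPolynomial τ ℝ →ₐ[ℝ] ℝ := aeval c

theorem epsOf_apply (c : τ → ℝ) (a : MvPolynomial τ ℝ) : epsOf c a = eval c a := by
  rw [epsOf, MvPolynomial.aeval_def, MvPolynomial.eval]; rfl

theorem PMap.ev_injective : Function.Injective F.ev := by
  intro x y h
  ext i
  have : aeval x (X i : MvPolynomial σ ℝ) = aeval y (X i : MvPolynomial σ ℝ) :=
    DFunLike.congr_fun h (X i : MvPolynomial σ ℝ)
  rwa [aeval_X, aeval_X] at this

theorem PMap.fib_eq (c : τ → ℝ) : fib F.B (epsOf c) = F.ev '' F.fiber c := by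
  ext χ
  constructor
  · intro h
    let χ' : MvPolynomial σ ℝ →ₐ[ℝ] ℂ := χ
    have h0 : χ' = aeval (fun i => χ' (X i)) := by
      apply MvPolynomial.algHom_ext; intro i; rw [aeval_X]
    refine ⟨fun i => χ' (X i), fun t => ?_, h0.symm⟩
    have h1 := h (X t)
    rw [PMap.algebraMap_eq, aeval_X, epsOf, aeval_X] at h1
    rw [← h0]
    exact h1
  · rintro ⟨x, hx, rfl⟩ a
    rw [PMap.algebraMap_eq, PMap.ev_apply]
    induction a using MvPolynomial.induction_on with
    | C r => rw [aeval_C, epsOf, aeval_C, MvPolynomial.algebraMap_eq, aeval_C]; rfl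
    | add p q hp hq => rw [map_add, map_add, map_add, hp, hq]; push_cast; rfl
    | mul_X p t hp =>
      rw [map_mul, map_mul, map_mul, hp, aeval_X, hx t, epsOf, aeval_X]; push_cast; rfl

/-- Theorem A. -/
theorem PMap.fiber_finite (c : τ → ℝ) : (F.fiber c).Finite := by
  have := fib_finite (B := F.B) (epsOf c)
  rw [F.fib_eq] at this
  exact this.of_finite_image F.ev_injective.injOn

theorem PMap.fiber_ncard_le (c : τ → ℝ) : (F.fiber c).ncard * ∏ i, F.w i ≤ ∏ t, F.d t := by
  rw [← F.rank_eq]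
  have := fib_ncard_le (B := F.B) (epsOf c)
  rw [F.fib_eq, Set.ncard_image_of_injective _ F.ev_injective] at this
  exact Nat.mul_le_mul_right _ this

/-- All points of the fibre are real. -/
def PMap.RealAt (c : τ → ℝ) : Prop := ∀ x ∈ F.fiber c, ∀ i, (x i).im = 0

theorem aeval_ofReal (y : σ → ℝ) (p : MvPolynomial σ ℝ) :
    aeval (fun i => ((y i : ℝ) : ℂ)) p = ((eval y p : ℝ) : ℂ) := by
  induction p using MvPolynomial.induction_on with
  | C r => simp
  | add p q hp hq => simp [hp, hq]
  | mul_X p t hp => simp [hp]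

theorem PMap.realAt_iff (c : τ → ℝ) : F.RealAt c ↔ RealFib F.B (epsOf c) := by
  constructor
  · intro h χ hχ s
    rw [F.fib_eq] at hχ
    obtain ⟨x, hx, rfl⟩ := hχ
    have : x = fun i => (((x i).re : ℝ) : ℂ) := by
      ext i; apply Complex.ext <;> simp [h x hx i]
    rw [this]
    have h2 := aeval_ofReal (fun i => (x i).re) s
    show (aeval _ (s : MvPolynomial σ ℝ) : ℂ).im = 0
    rw [h2, Complex.ofReal_im]
  · intro h x hx i
    have := h (F.ev x) (by rw [F.fib_eq]; exact ⟨x, hx, rfl⟩) (X i : MvPolynomial σ ℝ)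
    rwa [PMap.ev_apply, aeval_X] at this

/-- Theorem B. -/
theorem PMap.real_closure {T : Type*} [TopologicalSpace T] (Ψ : T → τ → ℝ)
    (hΨ : ∀ t, Continuous fun s => Ψ s t) (T0 : Set T) (t0 : T) (ht0 : t0 ∈ closure T0)
    (h : ∀ t ∈ T0, F.RealAt (Ψ t)) : F.RealAt (Ψ t0) := by
  rw [F.realAt_iff]
  refine realFib_closure (B := F.B) (fun t => epsOf (Ψ t)) ?_ T0 t0 ht0
    (fun t ht => (F.realAt_iff _).1 (h t ht))
  intro a
  have : (fun t => epsOf (Ψ t) a) = fun t => eval (Ψ t) a := by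
    ext t; rw [epsOf_apply]
  rw [this]
  exact (MvPolynomial.continuous_eval a).comp (continuous_pi hΨ)

theorem taylor_mem (y : σ → ℝ) (J : Ideal (MvPolynomial σ ℝ)) (hJ : ∀ p, eval y p = 0 → p ∈ J)
    (p : MvPolynomial σ ℝ) :
    p - C (eval y p) - ∑ i, C (eval y (pderiv i p)) * (X i - C (y i)) ∈ J ^ 2 := by
  classical
  induction p using MvPolynomial.induction_on with
  | C r => simp
  | add p q hp hq =>
    convert add_mem hp hq using 1
    simp only [map_add, add_mul, Finset.sum_add_distrib]; ring
  | mul_X p j hp =>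
    have h1 := Ideal.mul_mem_right (C (y j)) _ hp
    have h2 : (p - C (eval y p)) * (X j - C (y j)) ∈ J ^ 2 := by
      rw [pow_two]
      exact Ideal.mul_mem_mul (hJ _ (by simp)) (hJ _ (by simp))
    convert add_mem h1 h2 using 1
    have h3 : ∑ i, C (eval y (pderiv i (p * X j))) * (X i - C (y i)) =
        (∑ i, C (eval y (pderiv i p)) * (X i - C (y i))) * C (y j) + C (eval y p) * (X j - C (y j)) := by
      have : C (eval y p) * (X j - C (y j)) = ∑ i, if i = j then C (eval y p) * (X i - C (y i)) else 0 := by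
        simp
      rw [this, Finset.sum_mul, ← Finset.sum_add_distrib]
      refine Finset.sum_congr rfl fun i _ => ?_
      rw [pderiv_mul, pderiv_X, map_add, map_mul, map_mul, eval_X, map_add, map_mul]
      split_ifs with h
      · subst h; simp; ring
      · rw [Pi.single_eq_of_ne (fun h' => h h'.symm)]; simp; ring
    rw [h3]; simp; ring

theorem PMap.aeval_lin (ξ c : τ → ℝ) : aeval F.f (∑ t, C (ξ t) * (X t - C (c t))) =
    ∑ t, C (ξ t) * (F.f t - C (c t)) := by
  rw [map_sum]
  refine Finset.sum_congr rfl fun t _ => ?_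
  rw [map_mul, map_sub, aeval_X, aeval_C, aeval_C, MvPolynomial.algebraMap_eq]

/-- Theorem C. -/
theorem PMap.count {ι : Type} [Fintype ι] (Ψ : (ι → ℝ) → τ → ℝ)
    (hr : ∀ b, F.RealAt (Ψ b)) (b0 : ι → ℝ)
    (hdiff : ∀ β t, DifferentiableAt ℝ (fun s : ℝ => Ψ (b0 + s • β) t) 0)
    (hnd : ∀ ξ : τ → ℝ, ξ ≠ 0 → ∃ β, deriv (fun s : ℝ => ∑ t, ξ t * Ψ (b0 + s • β) t) 0 ≠ 0) :
    (F.fiber (Ψ b0)).ncard * ∏ i, F.w i = ∏ t, F.d t := by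
  classical
  refine le_antisymm (F.fiber_ncard_le _) ?_
  rw [← F.rank_eq]
  refine Nat.mul_le_mul_right _ ?_
  rw [← Set.ncard_image_of_injective _ F.ev_injective, ← F.fib_eq]
  refine finrank_le_fib (B := F.B) (epsOf (Ψ b0)) ((F.realAt_iff _).1 (hr b0)) ?_
  intro χ hχ
  have hχ' := hχ
  rw [F.fib_eq] at hχ'
  obtain ⟨x, hx, rfl⟩ := hχ'
  obtain ⟨y, rfl⟩ : ∃ y : σ → ℝ, x = fun i => ((y i : ℝ) : ℂ) :=
    ⟨fun i => (x i).re, by ext i; apply Complex.ext <;> simp [hr b0 x hx i]⟩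
  set J : Ideal (MvPolynomial σ ℝ) := RingHom.ker (F.ev fun i => ((y i : ℝ) : ℂ)) with hJdef
  have hJmem : ∀ p : MvPolynomial σ ℝ, p ∈ J ↔ eval y p = 0 := by
    intro p
    have : p ∈ J ↔ aeval (fun i => ((y i : ℝ) : ℂ)) p = 0 := Iff.rfl
    rw [this, aeval_ofReal, Complex.ofReal_eq_zero]
  have hTay := taylor_mem y J (fun p hp => (hJmem p).2 hp)
  have hsq : ∀ p, eval y p = 0 → (∀ i, eval y (pderiv i p) = 0) → p ∈ J ^ 2 := by
    intro p h1 h2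
    have := hTay p
    simpa [h1, h2] using this
  have hfy : ∀ t, eval y (F.f t) = Ψ b0 t := by
    intro t
    have := hx t
    rw [aeval_ofReal] at this
    exact_mod_cast this
  -- independence of differentials
  let v : τ → (σ → ℝ) := fun t i => eval y (pderiv i (F.f t))
  have hpd : ∀ (ξ : τ → ℝ) (i : σ), eval y (pderiv i (∑ t, C (ξ t) * (F.f t - C (Ψ b0 t)))) =
      ∑ t, ξ t * v t i := by
    intro ξ i
    simp [v]
  have hval : ∀ (ξ : τ → ℝ), eval y (∑ t, C (ξ t) * (F.f t - C (Ψ b0 t))) = 0 := by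
    intro ξ
    simp [hfy]
  have hli : LinearIndependent ℝ v := by
    rw [Fintype.linearIndependent_iff]
    intro ξ hξ
    by_contra hne
    have hξ0 : ξ ≠ 0 := fun h => hne fun i => by rw [h]; rfl
    obtain ⟨β, hβ⟩ := hnd ξ hξ0
    apply hβ
    have hmem : (∑ t, C (ξ t) * (F.f t - C (Ψ b0 t))) ∈ J ^ 2 := by
      apply hsq _ (hval ξ)
      intro i
      rw [hpd]
      have := congrFun hξ i
      simpa using this
    have hc1 := deriv_zero_of_sq (B := F.B) (fun s : ℝ => epsOf (Ψ (b0 + s • β))) ?_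
      (fun s => (F.realAt_iff _).1 (hr _)) (F.ev fun i => ((y i : ℝ) : ℂ)) ?_
      (∑ t, C (ξ t) * (X t - C (Ψ b0 t))) ?_
    · have he : (fun s : ℝ => epsOf (Ψ (b0 + s • β)) (∑ t, C (ξ t) * (X t - C (Ψ b0 t)))) =
          fun s => (∑ t, ξ t * Ψ (b0 + s • β) t) - ∑ t, ξ t * Ψ b0 t := by
        ext s
        rw [epsOf, map_sum, ← Finset.sum_sub_distrib]
        refine Finset.sum_congr rfl fun t _ => ?_
        simp; ring
      rw [he, deriv_sub_const] at hc1
      exact hc1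
    · intro a
      simp only [epsOf_apply]
      induction a using MvPolynomial.induction_on with
      | C r => simp
      | add p q hp hq =>
        simp only [map_add]
        exact hp.add hq
      | mul_X p t hp =>
        simp only [map_mul, eval_X]
        exact hp.mul (hdiff β t)
    · simpa using hχ
    · have : algebraMap (MvPolynomial τ ℝ) F.B (∑ t, C (ξ t) * (X t - C (Ψ b0 t))) =
          (∑ t, C (ξ t) * (F.f t - C (Ψ b0 t)) : MvPolynomial σ ℝ) := by
        exact F.aeval_lin ξ _
      rw [this]
      exact hmem
  have hspan : Submodule.span ℝ (Set.range v) = ⊤ :=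
    hli.span_eq_top_of_card_eq_finrank' (by rw [Module.finrank_fintype_fun_eq_card, F.card])
  intro (p : MvPolynomial σ ℝ) hp
  have hp0 : eval y p = 0 := (hJmem p).1 hp
  obtain ⟨ξ, hξ⟩ := (Submodule.mem_span_range_iff_exists_fun ℝ).1
    (show (fun i => eval y (pderiv i p)) ∈ Submodule.span ℝ (Set.range v) by rw [hspan]; trivial)
  set q : MvPolynomial σ ℝ := ∑ t, C (ξ t) * (F.f t - C (Ψ b0 t)) with hq
  have h1 : (p : MvPolynomial σ ℝ) - q ∈ J ^ 2 := by
    apply hsq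
    · rw [map_sub, hp0, hval, sub_zero]
    · intro i
      rw [map_sub, map_sub, hpd]
      have := congrFun hξ i
      simp only [Finset.sum_apply, Pi.smul_apply, smul_eq_mul] at this
      rw [this, sub_self]
  have h2 : algebraMap (MvPolynomial τ ℝ) F.B (∑ t, C (ξ t) * (X t - C (Ψ b0 t))) = q := by
    exact F.aeval_lin ξ _
  have h3 : (q : F.B) ∈ (RingHom.ker (epsOf (Ψ b0))).map (algebraMap (MvPolynomial τ ℝ) F.B) := by
    rw [← h2]
    apply Ideal.mem_map_of_mem
    rw [RingHom.mem_ker, epsOf, map_sum]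
    refine Finset.sum_eq_zero fun t _ => ?_
    simp
  have h4 : q + (p - q) = p := by ring
  let qB : F.B := q
  let dB : F.B := (p - q : MvPolynomial σ ℝ)
  have h5 : qB + dB ∈ (RingHom.ker (epsOf (Ψ b0))).map (algebraMap (MvPolynomial τ ℝ) F.B) ⊔
      (RingHom.ker (F.ev fun i => ((y i : ℝ) : ℂ))) ^ 2 :=
    Submodule.add_mem_sup (M := F.B) h3 h1
  have h6 : qB + dB = (p : MvPolynomial σ ℝ) := h4
  exact h6 ▸ h5

end Poly
end OG
end PartGH

section PartCA
namespace OG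

section JointEig

open Module.End

theorem joint_eig {E : Type*} [NormedAddCommGroup E] [InnerProductSpace ℝ E] [FiniteDimensional ℝ E]
    {ι : Type*} (T : ι → E →ₗ[ℝ] E) (hT : ∀ i, (T i).IsSymmetric)
    (hc : ∀ i j, T i ∘ₗ T j = T j ∘ₗ T i) (u : E)
    (hu : ∀ S : Submodule ℝ E, u ∈ S → (∀ i, ∀ x ∈ S, T i x ∈ S) → S = ⊤) :
    ∃ P : Finset (ι → ℝ), Module.finrank ℝ E ≤ P.card ∧
      ∀ p ∈ P, ∃ v : E, (∀ i, T i v = p i • v) ∧ inner ℝ u v ≠ 0 := by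
  classical
  have htop := LinearMap.IsSymmetric.iSup_iInf_eq_top_of_commute hT
    (fun i j _ => (hc i j : Commute (T i) (T j)))
  have hmem : u ∈ ⨆ χ : ι → ℝ, ⨅ i, eigenspace (T i) (χ i) := by rw [htop]; trivial
  rw [Submodule.mem_iSup_iff_exists_finsupp] at hmem
  obtain ⟨f, hf, hsum⟩ := hmem
  have hfe : ∀ p i, T i (f p) = p i • f p := fun p i =>
    mem_eigenspace_iff.1 ((Submodule.mem_iInf _).1 (hf p) i)
  refine ⟨f.support, ?_, fun p hp => ⟨f p, hfe p, ?_⟩⟩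
  · have hS := hu (Submodule.span ℝ (Set.range fun p : f.support => f p)) ?_ ?_
    · have h1 := finrank_range_le_card (R := ℝ) (b := fun p : f.support => f p)
      rw [Set.finrank, hS, finrank_top] at h1
      simpa using h1
    · rw [← hsum]
      exact Submodule.sum_mem _ fun p hp => Submodule.subset_span ⟨⟨p, hp⟩, rfl⟩
    · intro i x hx
      induction hx using Submodule.span_induction with
      | mem x hx =>
        obtain ⟨p, rfl⟩ := hx
        dsimp only
        rw [hfe]
        exact Submodule.smul_mem _ _ (Submodule.subset_span ⟨p, rfl⟩)
      | zero => simp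
      | add x y _ _ hx hy => rw [map_add]; exact add_mem hx hy
      | smul c x _ hx => rw [map_smul]; exact Submodule.smul_mem _ _ hx
  · have horth : ∀ p' ∈ f.support, p' ≠ p → inner ℝ (f p') (f p) = 0 := by
      intro p' _ hne
      obtain ⟨i, hi⟩ := Function.ne_iff.1 hne
      have := hT i (f p') (f p)
      rw [hfe, hfe, inner_smul_left, inner_smul_right] at this
      have h2 : (p' i - p i) * inner ℝ (f p') (f p) = 0 := by
        rw [RCLike.conj_to_real] at this; linarith
      exact (mul_eq_zero.1 h2).resolve_left (sub_ne_zero.2 hi)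
    rw [← hsum, Finsupp.sum, sum_inner, Finset.sum_eq_single_of_mem p hp horth]
    exact inner_self_ne_zero.2 (Finsupp.mem_support_iff.1 hp)

end JointEig

section CM

open Equiv

variable {N : ℕ}

/-- The coefficients `1/(a_i-a_j)`; zero on the diagonal. -/
noncomputable def cc (a : Fin N → ℝ) (i j : Fin N) : ℝ := 1 / (a i - a j)

theorem cc_self (a : Fin N → ℝ) (i : Fin N) : cc a i i = 0 := by simp [cc]
theorem cc_anti (a : Fin N → ℝ) (i j : Fin N) : cc a i j = - cc a j i := by
  rw [cc, cc, ← neg_sub (a j) (a i), div_neg]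

theorem cc_arnold (a : Fin N → ℝ) (ha : Function.Injective a) {i k m : Fin N} (h1 : i ≠ k)
    (h2 : k ≠ m) (h3 : i ≠ m) :
    cc a i k * cc a k m + cc a i m * cc a k i - cc a i m * cc a k m = 0 := by
  have e1 : a i - a k ≠ 0 := sub_ne_zero.2 (ha.ne h1)
  have e1' : a k - a i ≠ 0 := sub_ne_zero.2 (ha.ne h1.symm)
  have e2 : a k - a m ≠ 0 := sub_ne_zero.2 (ha.ne h2)
  have e3 : a i - a m ≠ 0 := sub_ne_zero.2 (ha.ne h3)
  rw [cc_anti a k i]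
  simp only [cc]
  field_simp
  ring

/-- The commuting operators. -/
noncomputable def Hop (a q : Fin N → ℝ) (h : ℝ) (i : Fin N) :
    (Perm (Fin N) → ℝ) →ₗ[ℝ] (Perm (Fin N) → ℝ) where
  toFun v w := q (w i) * v w + h * ∑ j, cc a i j * v (w * swap i j)
  map_add' u v := by
    ext w; simp only [Pi.add_apply, mul_add, Finset.sum_add_distrib]; ring
  map_smul' c v := by
    ext w; simp only [Pi.smul_apply, smul_eq_mul, RingHom.id_apply, mul_add, Finset.mul_sum]
    congr 1
    · ring
    · refine Finset.sum_congr rfl fun j _ => ?_; ring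

theorem Hop_apply (a q : Fin N → ℝ) (h : ℝ) (i : Fin N) (v : Perm (Fin N) → ℝ) (w : Perm (Fin N)) :
    Hop a q h i v w = q (w i) * v w + h * ∑ j, cc a i j * v (w * swap i j) := rfl

theorem theta_comm (a : Fin N → ℝ) (ha : Function.Injective a) {i k : Fin N} (hik : i ≠ k)
    (φ : Perm (Fin N) → ℝ) :
    ∑ j, ∑ l, cc a i j * cc a k l * (φ (swap i j * swap k l) - φ (swap k l * swap i j)) = 0 := by
  set G : Fin N → Fin N → ℝ := fun j l =>
    cc a i j * cc a k l * (φ (swap i j * swap k l) - φ (swap k l * swap i j)) with hG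
  have hG0 : ∀ l, G i l = 0 := fun l => by simp [hG, cc_self]
  have hG1 : ∀ j, G j k = 0 := fun j => by simp [hG, cc_self]
  have hG2 : G k i = 0 := by simp [hG, swap_comm i k]
  have hG3 : ∀ j l, j ≠ k → l ≠ i → j ≠ l → G j l = 0 := by
    intro j l h1 h2 h3
    by_cases hji : j = i
    · rw [hji]; exact hG0 l
    by_cases hlk : l = k
    · rw [hlk]; exact hG1 j
    have hd : Equiv.Perm.Disjoint (swap i j) (swap k l) := by
      intro x
      by_cases hx : x = i ∨ x = j
      · right
        rcases hx with rfl | rfl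
        · exact swap_apply_of_ne_of_ne hik (Ne.symm h2)
        · exact swap_apply_of_ne_of_ne h1 h3
      · push Not at hx
        left; exact swap_apply_of_ne_of_ne hx.1 hx.2
    simp only [hG]
    rw [hd.commute.eq, sub_self, mul_zero]
  have key : ∀ j l, G j l = (if j = k then G k l else 0) + (if l = i then G j i else 0) +
      (if j = l then G j j else 0) := by
    intro j l
    by_cases h1 : j = k <;> by_cases h2 : l = i <;> by_cases h3 : j = l
    · exact absurd (h2.symm.trans (h3.symm.trans h1)) hik
    · rw [if_pos h1, if_pos h2, if_neg h3, h1, h2, hG2]; simp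
    · rw [if_pos h1, if_neg h2, if_pos h3, ← h3, h1, hG1]; simp
    · rw [if_pos h1, if_neg h2, if_neg h3, h1]; simp
    · rw [if_neg h1, if_pos h2, if_pos h3, h3, h2, hG0]; simp
    · rw [if_neg h1, if_pos h2, if_neg h3, h2]; simp
    · rw [if_neg h1, if_neg h2, if_pos h3, h3]; simp
    · rw [if_neg h1, if_neg h2, if_neg h3, hG3 j l h1 h2 h3]; simp
  have : ∑ j, ∑ l, G j l = ∑ m, (G k m + G m i + G m m) := by
    rw [Finset.sum_congr rfl fun j _ => Finset.sum_congr rfl fun l _ => key j l]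
    simp only [Finset.sum_add_distrib]
    congr 1
    · congr 1
      · rw [Finset.sum_comm]; simp
      · simp
    · simp
  refine this.trans (Finset.sum_eq_zero fun m _ => ?_)
  by_cases hmi : m = i
  · subst hmi; rw [hG2, hG0]; simp
  by_cases hmk : m = k
  · subst hmk; rw [hG1, hG2]; simp
  have hmi' : i ≠ m := Ne.symm hmi
  have hmk' : k ≠ m := Ne.symm hmk
  have r1 : swap i k * swap k m = swap i m * swap i k := by
    rw [mul_swap_eq_swap_mul, swap_apply_right, swap_apply_of_ne_of_ne hmi hmk]
  have r2 : swap i k * swap k m = swap k m * swap i m := by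
    rw [mul_swap_eq_swap_mul (swap k m), swap_apply_right, swap_apply_of_ne_of_ne hik hmi']
  have r1' : swap k m * swap i k = swap i k * swap i m := by
    have := congrArg (fun g => g⁻¹) r1
    simpa using this
  have r2' : swap k m * swap i k = swap i m * swap k m := by
    have := congrArg (fun g => g⁻¹) r2
    simpa using this
  simp only [hG]
  rw [swap_comm k i, ← r2', ← r2, ← r1, ← r1']
  linear_combination (φ (swap i k * swap k m) - φ (swap k m * swap i k)) *
    cc_arnold a ha hik hmk' hmi'

theorem Hop_comm (a q : Fin N → ℝ) (ha : Function.Injective a) (h : ℝ) (i k : Fin N) :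
    Hop a q h i ∘ₗ Hop a q h k = Hop a q h k ∘ₗ Hop a q h i := by
  by_cases hik : i = k
  · rw [hik]
  refine LinearMap.ext fun v => funext fun w => ?_
  rw [LinearMap.comp_apply, LinearMap.comp_apply]
  have ex : ∀ i k, Hop a q h i (Hop a q h k v) w = q (w i) * (q (w k) * v w) +
      h * (∑ j, cc a k j * q (w i) * v (w * swap k j)) +
      h * (∑ j, cc a i j * q ((w * swap i j) k) * v (w * swap i j)) +
      h * h * ∑ j, ∑ l, cc a i j * cc a k l * v (w * (swap i j * swap k l)) := by
    intro i k
    rw [Hop_apply, Hop_apply]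
    simp only [Hop_apply, mul_add, Finset.sum_add_distrib, Finset.mul_sum]
    rw [add_assoc, add_assoc, add_assoc]
    congr 1
    congr 1
    · exact Finset.sum_congr rfl fun j _ => by ring
    congr 1
    · exact Finset.sum_congr rfl fun j _ => by ring
    · refine Finset.sum_congr rfl fun j _ => Finset.sum_congr rfl fun l _ => ?_
      rw [mul_assoc w]; ring
  rw [ex i k, ex k i]
  have hth := theta_comm a ha hik (fun g => v (w * g))
  have e3 : ∑ j, ∑ l, cc a k j * cc a i l * v (w * (swap k j * swap i l)) =
      ∑ j, ∑ l, cc a i j * cc a k l * v (w * (swap k l * swap i j)) := by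
    rw [Finset.sum_comm]
    exact Finset.sum_congr rfl fun j _ => Finset.sum_congr rfl fun l _ => by ring
  have e4 : ∑ j, ∑ l, cc a i j * cc a k l * v (w * (swap i j * swap k l)) -
      ∑ j, ∑ l, cc a i j * cc a k l * v (w * (swap k l * swap i j)) = 0 := by
    rw [← hth, ← Finset.sum_sub_distrib]
    refine Finset.sum_congr rfl fun j _ => ?_
    rw [← Finset.sum_sub_distrib]
    exact Finset.sum_congr rfl fun l _ => by ring
  have e1 : ∀ i k, i ≠ k → ∑ j, cc a k j * q (w i) * v (w * swap k j) -
      ∑ j, cc a k j * q ((w * swap k j) i) * v (w * swap k j) =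
      cc a k i * (q (w i) - q (w k)) * v (w * swap k i) := by
    intro i k hik
    rw [← Finset.sum_sub_distrib, Finset.sum_eq_single i]
    · rw [Perm.mul_apply, swap_apply_right]; ring
    · intro j _ hj
      rw [Perm.mul_apply, swap_apply_of_ne_of_ne hik (Ne.symm hj)]; ring
    · simp
  have f1 := e1 i k hik
  have f2 := e1 k i (Ne.symm hik)
  rw [cc_anti a i k, swap_comm i k] at f2
  rw [e3]
  linear_combination h * f1 - h * f2 + h * h * e4

end CM
end OG
end PartCA

section PartCB
namespace OG

section NilCrit
open Polynomial

variable {N : ℕ}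

theorem trace_aeval_eq_zero (Z : Matrix (Fin N) (Fin N) ℂ) (M : ℕ)
    (h : ∀ k, M ≤ k → (Z ^ k).trace = 0) (u : ℂ[X]) : (aeval Z (u * X ^ M)).trace = 0 := by
  induction u using Polynomial.induction_on' with
  | add p q hp hq => rw [add_mul, map_add, Matrix.trace_add, hp, hq, add_zero]
  | monomial k c =>
    rw [monomial_mul_X_pow, aeval_monomial, ← Algebra.smul_def, Matrix.trace_smul, h _ (by omega),
      smul_zero]

theorem nilpotent_of_trace (Z : Matrix (Fin N) (Fin N) ℂ) (n : ℕ)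
    (h : ∀ k, n ≤ k → (Z ^ k).trace = 0) : IsNilpotent Z := by
  obtain ⟨q, hq1, hq2⟩ := Polynomial.exists_eq_pow_rootMultiplicity_mul_and_not_dvd Z.charpoly
    Z.charpoly_monic.ne_zero 0
  rw [C_0, sub_zero] at hq1 hq2
  set K := Polynomial.rootMultiplicity 0 Z.charpoly
  set M := max K n
  have hcop : IsCoprime (X ^ M) q := by
    refine IsCoprime.pow_left ?_
    exact (Polynomial.irreducible_X.coprime_iff_not_dvd).2 hq2
  obtain ⟨u, v, huv⟩ := hcop
  have hzero : aeval Z (X ^ M * q) = 0 := by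
    have : X ^ M * q = X ^ (M - K) * Z.charpoly := by
      rw [hq1, ← mul_assoc, ← pow_add, Nat.sub_add_cancel (le_max_left _ _)]
    rw [this, map_mul, Matrix.aeval_self_charpoly, mul_zero]
  set E := aeval Z (u * X ^ M) with hE
  have hE1 : E * E = E := by
    rw [hE, ← map_mul]
    have : u * X ^ M * (u * X ^ M) = u * X ^ M - u * v * (X ^ M * q) := by
      linear_combination (u * X ^ M) * huv
    rw [this, map_sub, map_mul _ (u * v), hzero, mul_zero, sub_zero]
  have hE2 : E.trace = 0 := trace_aeval_eq_zero Z M (fun k hk => h k ((le_max_right _ _).trans hk)) u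
  have hE3 : E = 0 := by
    have h1 : IsIdempotentElem (Matrix.toLin' E) := by
      show Matrix.toLin' E * Matrix.toLin' E = _
      rw [Module.End.mul_eq_comp, ← Matrix.toLin'_mul, hE1]
    have h2 := LinearMap.IsIdempotentElem.eq_zero_of_trace_eq_zero h1
      (by rw [Matrix.trace_toLin'_eq]; exact hE2)
    exact Matrix.toLin'.injective (h2.trans (map_zero _).symm)
  refine ⟨M, ?_⟩
  have : aeval Z ((X : ℂ[X]) ^ M) = (0 : Matrix (Fin N) (Fin N) ℂ) := by
    have e : (X : ℂ[X]) ^ M = X ^ M * (u * X ^ M) + v * (X ^ M * q) := by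
      linear_combination - X ^ M * huv
    rw [e, map_add, map_mul, ← hE, hE3, map_mul, hzero, mul_zero, mul_zero, add_zero]
  simpa using this

theorem nilpotent_of_trace' (Z : Matrix (Fin N) (Fin N) ℂ)
    (h : ∀ k : Fin N, (Z ^ ((k : ℕ) + 1)).trace = 0) : IsNilpotent Z := by
  refine nilpotent_of_trace Z 1 fun k hk => ?_
  induction k using Nat.strong_induction_on with
  | _ k ih =>
  by_cases hkN : k ≤ N
  · have := h ⟨k - 1, by omega⟩
    simpa [Nat.sub_add_cancel hk] using this
  have h1 := Matrix.aeval_self_charpoly Z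
  rw [Polynomial.aeval_eq_sum_range, Matrix.charpoly_natDegree_eq_dim, Fintype.card_fin,
    Finset.sum_range_succ] at h1
  have hlead : Z.charpoly.coeff N = 1 := by
    have := Z.charpoly_monic.coeff_natDegree
    rwa [Matrix.charpoly_natDegree_eq_dim, Fintype.card_fin] at this
  rw [hlead, one_smul] at h1
  have h2 := congrArg (fun A => (A * Z ^ (k - N)).trace) h1
  simp only [add_mul, Finset.sum_mul, Matrix.trace_add, Matrix.trace_sum, zero_mul,
    Matrix.trace_zero, smul_mul_assoc, Matrix.trace_smul, ← pow_add] at h2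
  rw [Finset.sum_eq_zero, zero_add, Nat.add_sub_cancel' (by omega)] at h2
  · exact h2
  · intro i hi
    rw [Finset.mem_range] at hi
    rw [ih _ (by omega) (by omega), smul_zero]

end NilCrit

section Scale
open MvPolynomial
variable {σ : Type} [Fintype σ]

theorem hom_of_scale (w : σ → ℕ) (d : ℕ) (f : MvPolynomial σ ℝ)
    (h : ∀ x : σ → ℝ, eval (fun i => 2 ^ w i * x i) f = 2 ^ d * eval x f) :
    IsWeightedHomogeneous w f d := by
  classical
  intro m hm
  set g : MvPolynomial σ ℝ :=
    ∑ m ∈ f.support, monomial m (((2:ℝ) ^ (Finsupp.weight w m) - 2 ^ d) * coeff m f) with hg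
  have hg0 : g = 0 := by
    refine MvPolynomial.funext fun x => ?_
    have h1 := h x
    rw [eval_eq', eval_eq'] at h1
    rw [hg, map_sum, map_zero, ← sub_eq_zero.2 h1, Finset.mul_sum, ← Finset.sum_sub_distrib]
    refine Finset.sum_congr rfl fun m _ => ?_
    rw [eval_monomial, Finsupp.prod_fintype _ _ (fun i => pow_zero _)]
    have : (2:ℝ) ^ (Finsupp.weight w m) = ∏ i, (2 ^ w i) ^ m i := by
      rw [Finsupp.weight_apply, Finsupp.sum_fintype _ _ (fun i => by simp), ← Finset.prod_pow_eq_pow_sum]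
      refine Finset.prod_congr rfl fun i _ => ?_
      rw [smul_eq_mul, ← pow_mul, mul_comm]
    simp only [mul_pow, Finset.prod_mul_distrib]
    rw [this]; ring
  have h2 : coeff m g = ((2:ℝ) ^ (Finsupp.weight w m) - 2 ^ d) * coeff m f := by
    rw [hg, coeff_sum, Finset.sum_eq_single m]
    · rw [coeff_monomial, if_pos rfl]
    · intro b _ hb; rw [coeff_monomial, if_neg hb]
    · intro hm'; exact absurd (mem_support_iff.2 hm) hm'
  rw [hg0, coeff_zero] at h2
  have h3 := (mul_eq_zero.1 h2.symm).resolve_right hm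
  exact Nat.pow_right_injective le_rfl (by exact_mod_cast sub_eq_zero.1 h3)

end Scale
end OG
end PartCB

section PartCC
namespace OG

section CMa
open Equiv

variable {N : ℕ}

theorem joint_eig' {κ : Type} [Fintype κ] [DecidableEq κ]
    {ι : Type} (T : ι → (κ → ℝ) →ₗ[ℝ] (κ → ℝ)) (hT : ∀ i x y, ∑ w, T i x w * y w = ∑ w, x w * T i y w)
    (hc : ∀ i j, T i ∘ₗ T j = T j ∘ₗ T i) (u : κ → ℝ)
    (hu : ∀ S : Submodule ℝ (κ → ℝ), u ∈ S → (∀ i, ∀ x ∈ S, T i x ∈ S) → S = ⊤) :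
    ∃ P : Finset (ι → ℝ), Fintype.card κ ≤ P.card ∧
      ∀ p ∈ P, ∃ v : κ → ℝ, (∀ i, T i v = p i • v) ∧ ∑ w, u w * v w ≠ 0 := by
  let e : EuclideanSpace ℝ κ ≃ₗ[ℝ] (κ → ℝ) := WithLp.linearEquiv 2 ℝ (κ → ℝ)
  have hin : ∀ x y : EuclideanSpace ℝ κ, inner ℝ x y = ∑ w, e x w * e y w := by
    intro x y
    rw [PiLp.inner_apply]
    refine Finset.sum_congr rfl fun w _ => ?_
    show y w * x w = x w * y w
    ring
  let T' : ι → EuclideanSpace ℝ κ →ₗ[ℝ] EuclideanSpace ℝ κ :=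
    fun i => e.symm.toLinearMap ∘ₗ T i ∘ₗ e.toLinearMap
  have hT' : ∀ i x, T' i x = e.symm (T i (e x)) := fun i x => rfl
  have k1 : ∀ i, (T' i).IsSymmetric := by
    intro i x y
    rw [hin, hin, hT', hT']
    simpa using hT i (e x) (e y)
  have k2 : ∀ i j, T' i ∘ₗ T' j = T' j ∘ₗ T' i := by
    intro i j
    refine LinearMap.ext fun x => ?_
    have := LinearMap.congr_fun (hc i j) (e x)
    simp only [LinearMap.comp_apply] at this
    simp [hT', this]
  have k3 : ∀ S : Submodule ℝ (EuclideanSpace ℝ κ), e.symm u ∈ S → (∀ i, ∀ x ∈ S, T' i x ∈ S) → S = ⊤ := by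
    intro S hS1 hS2
    have := hu (S.map e.toLinearMap) ⟨_, hS1, by simp⟩ ?_
    · rw [Submodule.eq_top_iff']
      intro x
      have hx : e x ∈ S.map e.toLinearMap := by rw [this]; trivial
      obtain ⟨y, hy, hxy⟩ := hx
      have : y = x := e.injective hxy
      exact this ▸ hy
    · rintro i _ ⟨y, hy, rfl⟩
      exact ⟨_, hS2 i y hy, by simp [hT']⟩
  obtain ⟨P, hP1, hP2⟩ := joint_eig T' k1 k2 (e.symm u) k3
  refine ⟨P, by simpa using hP1, fun p hp => ?_⟩
  obtain ⟨v, hv1, hv2⟩ := hP2 p hp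
  refine ⟨e v, fun i => ?_, ?_⟩
  · have := congrArg e (hv1 i)
    simpa [hT'] using this
  · rw [hin] at hv2; simpa using hv2
theorem Hop_symm (a q : Fin N → ℝ) (h : ℝ) (i : Fin N) (x y : Perm (Fin N) → ℝ) :
    ∑ w, Hop a q h i x w * y w = ∑ w, x w * Hop a q h i y w := by
  simp only [Hop_apply, add_mul, mul_add, Finset.sum_add_distrib, Finset.mul_sum, Finset.sum_mul]
  congr 1
  · exact Finset.sum_congr rfl fun w _ => by ring
  · rw [Finset.sum_comm, Finset.sum_comm (s := Finset.univ (α := Perm (Fin N)))]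
    refine Finset.sum_congr rfl fun j _ => ?_
    refine Fintype.sum_equiv (Equiv.mulRight (swap i j)) _ _ fun w => ?_
    simp only [Equiv.coe_mulRight, mul_assoc, swap_mul_self, mul_one]
    ring

/-- iterated shifted operators applied to the constant vector. -/
noncomputable def gvec (a q : Fin N → ℝ) (h : ℝ) (L : List (Fin N × Fin N)) : Perm (Fin N) → ℝ :=
  L.foldr (fun ik v => Hop a q h ik.1 v - q ik.2 • v) (fun _ => 1)

theorem gvec_poly (a q : Fin N → ℝ) (L : List (Fin N × Fin N)) :
    ∃ P : Perm (Fin N) → Polynomial ℝ, ∀ h w, gvec a q h L w = (P w).eval h := by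
  induction L with
  | nil => exact ⟨fun _ => 1, fun h w => by simp [gvec]⟩
  | cons ik L ih =>
    obtain ⟨P, hP⟩ := ih
    refine ⟨fun w => Polynomial.C (q (w ik.1)) * P w + Polynomial.X *
      ∑ j, Polynomial.C (cc a ik.1 j) * P (w * swap ik.1 j) - Polynomial.C (q ik.2) * P w, fun h w => ?_⟩
    show Hop a q h ik.1 (gvec a q h L) w - q ik.2 * gvec a q h L w = _
    rw [Hop_apply]
    simp [hP, Polynomial.eval_finset_sum]

theorem gvec_zero (a q : Fin N → ℝ) (L : List (Fin N × Fin N)) (w : Perm (Fin N)) :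
    gvec a q 0 L w = (L.map fun ik => q (w ik.1) - q ik.2).prod := by
  induction L with
  | nil => simp [gvec]
  | cons ik L ih =>
    show Hop a q 0 ik.1 (gvec a q 0 L) w - q ik.2 * gvec a q 0 L w = _
    rw [Hop_apply, ih, List.map_cons, List.prod_cons]; ring

theorem gvec_mem (a q : Fin N → ℝ) (h : ℝ) (L : List (Fin N × Fin N)) (S : Submodule ℝ (Perm (Fin N) → ℝ))
    (h1 : (fun _ => 1) ∈ S) (h2 : ∀ i, ∀ x ∈ S, Hop a q h i x ∈ S) : gvec a q h L ∈ S := by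
  induction L with
  | nil => exact h1
  | cons ik L ih => exact S.sub_mem (h2 _ _ ih) (S.smul_mem _ ih)

theorem cyc_exists (a q : Fin N → ℝ) (hq : Function.Injective q) :
    ∃ P : Polynomial ℝ, P ≠ 0 ∧ ∀ h, P.eval h ≠ 0 → ∀ S : Submodule ℝ (Perm (Fin N) → ℝ),
      (fun _ => 1) ∈ S → (∀ i, ∀ x ∈ S, Hop a q h i x ∈ S) → S = ⊤ := by
  classical
  let L : Perm (Fin N) → List (Fin N × Fin N) := fun w0 =>
    (Finset.univ.filter fun ik : Fin N × Fin N => ik.2 ≠ w0 ik.1).toList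
  choose P hP using fun w0 => gvec_poly a q (L w0)
  let M : Matrix (Perm (Fin N)) (Perm (Fin N)) (Polynomial ℝ) := Matrix.of P
  have hM : ∀ h, M.det.eval h = (Matrix.of fun w0 w => gvec a q h (L w0) w).det := by
    intro h
    rw [← Polynomial.coe_evalRingHom, RingHom.map_det]
    congr 1
    ext w0 w
    simp [M, hP]
  refine ⟨M.det, ?_, ?_⟩
  · intro h0
    have h1 := hM 0
    rw [h0, Polynomial.eval_zero] at h1
    have h2 : (Matrix.of fun w0 w => gvec a q 0 (L w0) w) =
        Matrix.diagonal fun w0 => gvec a q 0 (L w0) w0 := by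
      ext w0 w
      by_cases hw : w0 = w
      · subst hw; simp
      · rw [Matrix.diagonal_apply_ne _ hw, Matrix.of_apply, gvec_zero]
        have : ∃ i, w i ≠ w0 i := by
          by_contra hcon; push Not at hcon; exact hw (Equiv.ext fun i => (hcon i).symm)
        obtain ⟨i, hi⟩ := this
        refine List.prod_eq_zero (List.mem_map.2 ⟨(i, w i), ?_, sub_self _⟩)
        simp [L, hi]
    rw [h2, Matrix.det_diagonal] at h1
    refine Finset.prod_ne_zero_iff.2 (fun w0 _ => ?_) h1.symm
    rw [gvec_zero]
    refine List.prod_ne_zero fun hz => ?_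
    obtain ⟨ik, hik, hz⟩ := List.mem_map.1 hz
    simp only [L, Finset.mem_toList, Finset.mem_filter, Finset.mem_univ, true_and] at hik
    exact hik (hq (sub_eq_zero.1 hz)).symm
  · intro h hh S h1 h2
    rw [hM] at hh
    have hli := Matrix.linearIndependent_rows_iff_isUnit.2
      ((Matrix.isUnit_iff_isUnit_det _).2 (isUnit_iff_ne_zero.2 hh))
    have hsp := hli.span_eq_top_of_card_eq_finrank' (by simp)
    rw [← top_le_iff, ← hsp, Submodule.span_le]
    rintro _ ⟨w0, rfl⟩
    exact gvec_mem a q h (L w0) S h1 h2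

/-- The Calogero-Moser matrix. -/
noncomputable def Zm {R : Type*} [CommRing R] [Algebra ℝ R] (a : Fin N → ℝ) (p : Fin N → R) (h : R) :
    Matrix (Fin N) (Fin N) R :=
  Matrix.diagonal p - Matrix.of fun i j => h * algebraMap ℝ R (cc a i j)

theorem Zm_trace_map {R S : Type*} [CommRing R] [Algebra ℝ R] [CommRing S] [Algebra ℝ S]
    (φ : R →ₐ[ℝ] S) (a : Fin N → ℝ) (p : Fin N → R) (h : R) (k : ℕ) :
    φ ((Zm a p h) ^ k).trace = ((Zm a (fun i => φ (p i)) (φ h)) ^ k).trace := by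
  have h1 : Zm a (fun i => φ (p i)) (φ h) = (φ : R →+* S).mapMatrix (Zm a p h) := by
    ext i j
    by_cases hij : i = j
    · subst hij; simp [Zm]
    · simp [Zm, hij]
  rw [h1, ← map_pow]
  exact AddMonoidHom.map_trace (φ : R →+* S) _

theorem trace_of_joint (a q p : Fin N → ℝ) (hq : Function.Injective q) (h : ℝ)
    (v : Perm (Fin N) → ℝ) (hv : ∀ i, Hop a q h i v = p i • v) (hs : ∑ w, v w ≠ 0) (m : ℕ) :
    ((Zm a p h) ^ m).trace = ∑ i, q i ^ m := by
  classical
  let U : Matrix (Fin N) (Fin N) ℝ := Matrix.of fun i k => ∑ w, if w i = k then v w else 0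
  have hZU : Zm a p h * U = U * Matrix.diagonal q := by
    ext i k
    rw [Matrix.mul_diagonal, Zm, Matrix.sub_mul, Matrix.sub_apply, Matrix.diagonal_mul, Matrix.mul_apply]
    have h1 : p i * U i k = q k * U i k + h * ∑ j, cc a i j * U j k := by
      simp only [U, Matrix.of_apply]
      have : ∀ w, p i * v w = q (w i) * v w + h * ∑ j, cc a i j * v (w * swap i j) := fun w => by
        rw [← Hop_apply, hv]; simp
      have e1 : ∀ j, (∑ w : Perm (Fin N), if w j = k then v w else 0) =
          ∑ w : Perm (Fin N), if w i = k then v (w * swap i j) else 0 := by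
        intro j
        refine (Fintype.sum_equiv (Equiv.mulRight (swap i j)) _ _ fun w => ?_).symm
        simp [Equiv.Perm.mul_apply]
      have e2 : ∑ j, cc a i j * (∑ w : Perm (Fin N), if w j = k then v w else 0) =
          ∑ w : Perm (Fin N), ∑ j, cc a i j * if w i = k then v (w * swap i j) else 0 := by
        rw [Finset.sum_comm]
        refine Finset.sum_congr rfl fun j _ => ?_
        rw [e1 j, Finset.mul_sum]
      rw [e2, Finset.mul_sum, Finset.mul_sum, Finset.mul_sum, ← Finset.sum_add_distrib]
      refine Finset.sum_congr rfl fun w _ => ?_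
      split_ifs with hw
      · rw [this, hw]
      · simp
    simp only [Matrix.of_apply, Algebra.algebraMap_self, RingHom.id_apply]
    rw [h1, Finset.mul_sum]
    simp only [mul_assoc]
    ring
  have hU : IsUnit U := by
    rw [← Matrix.linearIndependent_cols_iff_isUnit]
    refine Module.End.eigenvectors_linearIndependent' (Matrix.toLin' (Zm a p h)) q hq _ fun k => ?_
    refine ⟨Module.End.mem_eigenspace_iff.2 ?_, ?_⟩
    · rw [Matrix.toLin'_apply]
      ext i
      have := congrFun (congrFun hZU i) k
      rw [Matrix.mul_diagonal] at this
      rw [Pi.smul_apply, smul_eq_mul, mul_comm]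
      exact this
    · intro h0
      apply hs
      have : ∑ i, U i k = ∑ w, v w := by
        simp only [U, Matrix.of_apply]
        rw [Finset.sum_comm]
        refine Finset.sum_congr rfl fun w _ => ?_
        rw [Finset.sum_eq_single (w.symm k)]
        · simp
        · intro i _ hi
          rw [if_neg]; rintro rfl; simp at hi
        · simp
      rw [← this]
      exact Finset.sum_eq_zero fun i _ => congrFun h0 i
  obtain ⟨u, hu⟩ := hU
  have hpow : Zm a p h ^ m * U = U * Matrix.diagonal q ^ m := by
    induction m with
    | zero => simp
    | succ m ih => rw [pow_succ, mul_assoc, hZU, ← mul_assoc, ih, mul_assoc, ← pow_succ]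
  have : Zm a p h ^ m = U * Matrix.diagonal q ^ m * (↑u⁻¹ : Matrix (Fin N) (Fin N) ℝ) := by
    rw [← hpow, ← hu, mul_assoc, Units.mul_inv, mul_one]
  rw [this, Matrix.trace_mul_comm, ← mul_assoc, ← hu, Units.inv_mul, one_mul, Matrix.diagonal_pow,
    Matrix.trace_diagonal]
  simp

end CMa
end OG
end PartCC

section PartCD
namespace OG

section CMb
open Equiv MvPolynomial

variable {N : ℕ}

theorem Zm_smul {R : Type*} [CommRing R] [Algebra ℝ R] (a : Fin N → ℝ) (p : Fin N → R) (h c : R) :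
    Zm a (fun i => c * p i) (c * h) = c • Zm a p h := by
  ext i j
  by_cases hij : i = j
  · subst hij; simp [Zm, mul_sub, mul_assoc]
  · simp [Zm, hij, mul_assoc]

/-- The weighted homogeneous map of Calogero-Moser type. -/
noncomputable def CMmap (a : Fin N → ℝ) : PMap (Option (Fin N)) (Option (Fin N)) where
  f t := t.elim (X none) fun k => ((Zm a (fun i => X (some i)) (X none)) ^ ((k : ℕ) + 1)).trace
  w _ := 1
  d t := t.elim 1 fun k => (k : ℕ) + 1
  hw _ := Nat.one_pos
  hd t := by cases t <;> simp
  hom t := by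
    refine hom_of_scale _ _ _ fun x => ?_
    cases t with
    | none => simp
    | some k =>
      simp only [Option.elim_some]
      rw [← coe_aeval_eq_eval, ← coe_aeval_eq_eval]
      simp only [RingHom.coe_coe]
      rw [Zm_trace_map, Zm_trace_map]
      simp only [aeval_X, pow_one]
      rw [Zm_smul, smul_pow, Matrix.trace_smul, smul_eq_mul]
  zero x hx := by
    have h0 : x none = 0 := by simpa using hx none
    have hZ : Zm a (fun i => x (some i)) (x none) = Matrix.diagonal fun i => x (some i) := by
      rw [h0]; ext i j; simp [Zm]
    have hn : IsNilpotent (Zm a (fun i => x (some i)) (x none)) := by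
      refine nilpotent_of_trace' _ fun k => ?_
      have := hx (some k)
      simp only [Option.elim_some] at this
      rw [Zm_trace_map] at this
      simpa only [aeval_X] using this
    obtain ⟨m, hm⟩ := hn
    rw [hZ, Matrix.diagonal_pow] at hm
    funext t
    cases t with
    | none => exact h0
    | some i =>
      have := congrFun (congrFun hm i) i
      rw [Matrix.diagonal_apply_eq, Pi.pow_apply, Matrix.zero_apply] at this
      exact eq_zero_of_pow_eq_zero this
  card := rfl

/-- Target parameters. -/
noncomputable def cmPar (q : Fin N → ℝ) (h : ℝ) (t : Option (Fin N)) : ℝ :=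
  t.elim h fun k => ∑ i, q i ^ ((k : ℕ) + 1)

theorem mem_CMfiber (a : Fin N → ℝ) (c : Option (Fin N) → ℝ) (x : Option (Fin N) → ℂ) :
    x ∈ (CMmap a).fiber c ↔ x none = c none ∧
      ∀ k : Fin N, ((Zm a (fun i => x (some i)) (x none)) ^ ((k : ℕ) + 1)).trace = c (some k) := by
  constructor
  · intro hx
    refine ⟨by simpa [CMmap] using hx none, fun k => ?_⟩
    have := hx (some k)
    simp only [CMmap, Option.elim_some] at this
    rw [Zm_trace_map] at this
    simpa only [aeval_X] using this
  · rintro ⟨h1, h2⟩ t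
    cases t with
    | none => simpa [CMmap] using h1
    | some k =>
      simp only [CMmap, Option.elim_some]
      rw [Zm_trace_map]
      simpa only [aeval_X] using h2 k

theorem CM_real_good (a : Fin N → ℝ) (ha : Function.Injective a) (q : Fin N → ℝ)
    (hq : Function.Injective q) (h : ℝ) (hcyc : ∀ S : Submodule ℝ (Perm (Fin N) → ℝ),
      (fun _ => 1) ∈ S → (∀ i, ∀ x ∈ S, Hop a q h i x ∈ S) → S = ⊤) :
    (CMmap a).RealAt (cmPar q h) := by
  classical
  obtain ⟨P, hP1, hP2⟩ := joint_eig' (Hop a q h) (Hop_symm a q h) (Hop_comm a q ha h) (fun _ => 1) hcyc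
  let emb : (Fin N → ℝ) → Option (Fin N) → ℂ := fun p t => t.elim (h : ℂ) fun i => ((p i : ℝ) : ℂ)
  have hemb : Function.Injective emb := by
    intro p p' hp
    funext i
    have := congrFun hp (some i)
    simpa [emb] using this
  have hsub : emb '' (P : Set (Fin N → ℝ)) ⊆ (CMmap a).fiber (cmPar q h) := by
    rintro _ ⟨p, hp, rfl⟩
    rw [mem_CMfiber]
    refine ⟨rfl, fun k => ?_⟩
    obtain ⟨v, hv1, hv2⟩ := hP2 p hp
    have := trace_of_joint a q p hq h v hv1 (by simpa using hv2) ((k : ℕ) + 1)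
    have h2 := Zm_trace_map (Algebra.ofId ℝ ℂ) a p h ((k : ℕ) + 1)
    rw [this] at h2
    exact h2.symm
  have hle := (CMmap a).fiber_ncard_le (cmPar q h)
  have e1 : ∏ i, (CMmap a).w i = 1 := by simp [CMmap]
  have e2 : ∏ t, (CMmap a).d t = N.factorial := by
    rw [Fintype.prod_option]
    simp only [CMmap, Option.elim_none, Option.elim_some, one_mul]
    rw [Fin.prod_univ_eq_prod_range (fun i => i + 1), Finset.prod_range_add_one_eq_factorial]
  rw [e1, e2, mul_one] at hle
  have hcard : (emb '' (P : Set (Fin N → ℝ))).ncard = P.card := by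
    rw [Set.ncard_image_of_injective _ hemb, Set.ncard_coe_finset]
  rw [Fintype.card_perm, Fintype.card_fin] at hP1
  have heq := Set.eq_of_subset_of_ncard_le hsub (by rw [hcard]; omega) ((CMmap a).fiber_finite _)
  intro x hx i
  rw [← heq] at hx
  obtain ⟨p, _, rfl⟩ := hx
  cases i <;> simp [emb]

theorem CM_real_h (a : Fin N → ℝ) (ha : Function.Injective a) (q : Fin N → ℝ)
    (hq : Function.Injective q) (h : ℝ) : (CMmap a).RealAt (cmPar q h) := by
  obtain ⟨P, hP0, hP⟩ := cyc_exists a q hq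
  refine (CMmap a).real_closure (fun h => cmPar q h) ?_ {h | P.eval h ≠ 0} h ?_
    fun t ht => CM_real_good a ha q hq t (hP t ht)
  · intro t
    cases t with
    | none => exact continuous_id
    | some k => exact continuous_const
  · have hfin : {h | P.eval h = 0}.Finite := by
      refine (P.roots.toFinset.finite_toSet).subset fun x hx => ?_
      simpa [hP0] using hx
    have : {h | P.eval h ≠ 0} = {h | P.eval h = 0}ᶜ := rfl
    rw [this]
    exact (hfin.countable.dense_compl ℝ) h

theorem CM_real (a : Fin N → ℝ) (ha : Function.Injective a) (p : Fin N → ℂ)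
    (hp : ∀ k : Fin N, ((Zm a p 1) ^ ((k : ℕ) + 1)).trace = 0) (i : Fin N) : (p i).im = 0 := by
  have key : (CMmap a).RealAt (cmPar (fun i : Fin N => (0:ℝ) * (i : ℝ)) 1) := by
    refine (CMmap a).real_closure (fun s : ℝ => cmPar (fun i : Fin N => s * (i : ℝ)) 1) ?_ {0}ᶜ 0 ?_
      fun t ht => CM_real_h a ha _ ?_ 1
    · intro t
      cases t with
      | none => exact continuous_const
      | some k =>
        show Continuous fun s : ℝ => ∑ i : Fin N, (s * (i : ℝ)) ^ ((k : ℕ) + 1)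
        fun_prop
    · exact dense_compl_singleton (0 : ℝ) 0
    · intro i j hij
      have ht' : t ≠ 0 := ht
      have := mul_left_cancel₀ ht' hij
      exact Fin.ext (by exact_mod_cast this)
  have := key (fun t => t.elim 1 p) ?_ (some i)
  · exact this
  · rw [mem_CMfiber]
    refine ⟨by simp [cmPar], fun k => ?_⟩
    have h1 := hp k
    simp only [Option.elim_some, Option.elim_none, h1]
    simp [cmPar]

end CMb
end OG
end PartCD

section PartWA
namespace OG

section WA
open Polynomial

variable {R : Type*} [CommRing R] {n : ℕ}

/-- The Wronskian over a general ring. -/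
noncomputable def wr (f : Fin n → R[X]) : R[X] :=
  (Matrix.of fun i j : Fin n => (fun p : R[X] => derivative p)^[(i : ℕ)] (f j)).det

theorem wr_map {S : Type*} [CommRing S] (φ : R →+* S) (f : Fin n → R[X]) :
    (wr f).map φ = wr fun j => (f j).map φ := by
  rw [wr, wr, ← coe_mapRingHom, RingHom.map_det]
  congr 1
  ext1 i j
  simp only [RingHom.mapMatrix_apply, Matrix.map_apply, Matrix.of_apply, coe_mapRingHom]
  exact (iterate_derivative_map (f j) φ (i : ℕ)).symm

theorem iter_sum_C {ι : Type*} (s : Finset ι) (c : ι → R) (f : ι → R[X]) (k : ℕ) :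
    derivative^[k] (∑ i ∈ s, C (c i) * f i) = ∑ i ∈ s, C (c i) * derivative^[k] (f i) := by
  rw [iterate_derivative_sum]
  exact Finset.sum_congr rfl fun i _ => iterate_derivative_C_mul _ _ _

theorem wr_mul (f : Fin n → R[X]) (P : Matrix (Fin n) (Fin n) R) :
    wr (fun j => ∑ k, C (P k j) * f k) = C P.det * wr f := by
  rw [wr, wr, mul_comm, RingHom.map_det, ← Matrix.det_mul]
  congr 1
  ext1 i j
  rw [Matrix.mul_apply]
  simp only [Matrix.of_apply, RingHom.mapMatrix_apply, Matrix.map_apply]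
  refine (iter_sum_C _ _ _ _).trans (Finset.sum_congr rfl fun k _ => mul_comm _ _)

theorem coeff_prod_le {ι : Type*} (s : Finset ι) (f : ι → R[X]) (d : ι → ℕ)
    (h : ∀ i ∈ s, (f i).natDegree ≤ d i) :
    (∏ i ∈ s, f i).natDegree ≤ ∑ i ∈ s, d i ∧
      (∏ i ∈ s, f i).coeff (∑ i ∈ s, d i) = ∏ i ∈ s, (f i).coeff (d i) := by
  classical
  induction s using Finset.induction_on with
  | empty => simp
  | insert a s ha ih =>
    obtain ⟨h1, h2⟩ := ih fun i hi => h i (Finset.mem_insert_of_mem hi)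
    have h3 := h a (Finset.mem_insert_self _ _)
    rw [Finset.prod_insert ha, Finset.prod_insert ha, Finset.sum_insert ha]
    exact ⟨natDegree_mul_le.trans (add_le_add h3 h1), by rw [coeff_mul_add_eq_of_natDegree_le h3 h1, h2]⟩

theorem det_top (M : Matrix (Fin n) (Fin n) R[X]) (d : Fin n → ℕ)
    (h : ∀ i j, (M i j).natDegree ≤ d j) :
    M.det.natDegree ≤ ∑ j, d j ∧
      M.det.coeff (∑ j, d j) = (Matrix.of fun i j => (M i j).coeff (d j)).det := by
  have key := fun σ : Equiv.Perm (Fin n) => coeff_prod_le Finset.univ (fun j => M (σ j) j) d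
    fun j _ => h (σ j) j
  rw [Matrix.det_apply, Matrix.det_apply]
  constructor
  · refine natDegree_sum_le_of_forall_le _ _ fun σ _ => ?_
    refine le_trans ?_ (key σ).1
    rw [Units.smul_def]
    exact natDegree_smul_le _ _
  · rw [finset_sum_coeff]
    refine Finset.sum_congr rfl fun σ _ => ?_
    rw [Units.smul_def, Units.smul_def, coeff_smul, (key σ).2]
    rfl

theorem det_low (M : Matrix (Fin n) (Fin n) R[X]) (e : Fin n → ℕ)
    (h : ∀ i j, X ^ e j ∣ M i j) :
    X ^ (∑ j, e j) ∣ M.det ∧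
      M.det.coeff (∑ j, e j) = (Matrix.of fun i j => (M i j).coeff (e j)).det := by
  choose g hg using h
  have hM : M.det = X ^ (∑ j, e j) * (Matrix.of g).det := by
    have : M = Matrix.of fun i j => X ^ e j * Matrix.of g i j := by
      ext1 i j; rw [Matrix.of_apply, Matrix.of_apply, ← hg]
    rw [this, Matrix.det_mul_row, Finset.prod_pow_eq_pow_sum]
  refine ⟨⟨_, hM⟩, ?_⟩
  rw [hM, coeff_X_pow_mul', if_pos le_rfl, Nat.sub_self, coeff_zero_eq_eval_zero,
    ← coe_evalRingHom, RingHom.map_det]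
  congr 1
  ext1 i j
  simp only [RingHom.mapMatrix_apply, Matrix.map_apply, Matrix.of_apply, hg]
  rw [coeff_X_pow_mul', if_pos le_rfl, Nat.sub_self, coeff_zero_eq_eval_zero]
  rfl

theorem coeff_euler (f : R[X]) (i k : ℕ) :
    (X ^ i * derivative^[i] f).coeff k = (k.descFactorial i : R) * f.coeff k := by
  rw [coeff_X_pow_mul']
  split_ifs with h
  · rw [coeff_iterate_derivative, Nat.sub_add_cancel h, nsmul_eq_mul]
  · rw [Nat.descFactorial_of_lt (by omega)]; simp

theorem natDegree_euler (f : R[X]) (i d : ℕ) (h : f.natDegree ≤ d) :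
    (X ^ i * derivative^[i] f).natDegree ≤ d := by
  rw [natDegree_le_iff_coeff_eq_zero] at h ⊢
  intro N hN
  rw [coeff_euler, h N hN, mul_zero]

theorem dvd_euler (f : R[X]) (i e : ℕ) (h : X ^ e ∣ f) : X ^ e ∣ X ^ i * derivative^[i] f := by
  rw [X_pow_dvd_iff] at h ⊢
  intro N hN
  rw [coeff_euler, h N hN, mul_zero]

theorem wr_euler (f : Fin n → R[X]) :
    X ^ (∑ i : Fin n, (i : ℕ)) * wr f =
      (Matrix.of fun i j : Fin n => X ^ (i : ℕ) * derivative^[(i : ℕ)] (f j)).det := by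
  rw [← Finset.prod_pow_eq_pow_sum, wr]
  exact (Matrix.det_mul_column (fun i : Fin n => (X : R[X]) ^ (i : ℕ)) _).symm

/-- the Vandermonde product -/
noncomputable def vdm (d : Fin n → ℕ) : ℤ := (Matrix.vandermonde fun i => (d i : ℤ)).det

theorem vdm_ne_zero (d : Fin n → ℕ) (hd : Function.Injective d) : vdm d ≠ 0 := by
  rw [vdm, Matrix.det_vandermonde_ne_zero_iff]
  intro i j hij
  have hij' : ((d i : ℕ) : ℤ) = d j := hij
  exact hd (by exact_mod_cast hij')

theorem vdm_eq (d : Fin n → ℕ) (R : Type*) [CommRing R] :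
    (vdm d : R) = (Matrix.of fun i j : Fin n => (((d j).descFactorial i : ℕ) : R)).det := by
  have h := Matrix.det_eval_matrixOfPolynomials_eq_det_vandermonde (fun i ↦ ((d i : ℕ) : ℤ))
      (fun i => descPochhammer ℤ i)
      (fun i => descPochhammer_natDegree ℤ i)
      (fun i => monic_descPochhammer ℤ i)
  rw [vdm, h, ← Matrix.det_transpose]
  refine (RingHom.map_det (Int.castRingHom R) _).trans ?_
  congr 1
  ext1 i j
  simp [descPochhammer_eval_eq_descFactorial]

theorem det_desc (f : Fin n → R[X]) (d : Fin n → ℕ) :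
    (Matrix.of fun i j : Fin n => (X ^ (i : ℕ) * derivative^[(i : ℕ)] (f j)).coeff (d j)).det =
      (∏ j, (f j).coeff (d j)) * (vdm d : R) := by
  rw [vdm_eq, ← Matrix.det_mul_row]
  congr 1
  ext1 i j
  simp only [Matrix.of_apply]
  rw [coeff_euler, mul_comm]

theorem wr_top (f : Fin n → R[X]) (d : Fin n → ℕ) (h : ∀ j, (f j).natDegree ≤ d j) :
    (X ^ (∑ i : Fin n, (i : ℕ)) * wr f).natDegree ≤ ∑ j, d j ∧
    (X ^ (∑ i : Fin n, (i : ℕ)) * wr f).coeff (∑ j, d j) = (∏ j, (f j).coeff (d j)) * (vdm d : R) := by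
  rw [wr_euler, ← det_desc]
  exact det_top _ d fun i j => natDegree_euler _ _ _ (h j)

theorem wr_low (f : Fin n → R[X]) (e : Fin n → ℕ) (h : ∀ j, X ^ e j ∣ f j) :
    X ^ (∑ j, e j) ∣ X ^ (∑ i : Fin n, (i : ℕ)) * wr f ∧
    (X ^ (∑ i : Fin n, (i : ℕ)) * wr f).coeff (∑ j, e j) = (∏ j, (f j).coeff (e j)) * (vdm e : R) := by
  rw [wr_euler, ← det_desc]
  exact det_low _ e fun i j => dvd_euler _ _ _ (h j)

/-- Derivative of a determinant, row version. -/
theorem derivative_det (M : Matrix (Fin n) (Fin n) R[X]) :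
    derivative M.det = ∑ i, (M.updateRow i fun j => derivative (M i j)).det := by
  have hcol : ∀ M : Matrix (Fin n) (Fin n) R[X],
      derivative M.det = ∑ i, (M.updateCol i fun j => derivative (M j i)).det := by
    intro M
    simp only [Matrix.det_apply]
    rw [derivative_sum, Finset.sum_comm]
    refine Finset.sum_congr rfl fun σ _ => ?_
    rw [← Finset.smul_sum, Units.smul_def, derivative_smul, derivative_prod_finset, Units.smul_def]
    congr 1
    refine Finset.sum_congr rfl fun i _ => ?_
    rw [← Finset.mul_prod_erase Finset.univ _ (Finset.mem_univ i), Matrix.updateCol_self, mul_comm]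
    congr 1
    refine Finset.prod_congr rfl fun j hj => ?_
    rw [Matrix.updateCol_ne (Finset.ne_of_mem_erase hj)]
  have := hcol M.transpose
  rw [Matrix.det_transpose] at this
  rw [this]
  refine Finset.sum_congr rfl fun i _ => ?_
  rw [← Matrix.det_transpose, ← Matrix.updateRow_transpose, Matrix.transpose_transpose]
  simp

end WA
end OG
end PartWA

section PartWB
namespace OG

section WB
open Polynomial

theorem echelon {K V : Type*} [Field K] [AddCommGroup V] [Module K V] (φ : ℕ → V →ₗ[K] K) (m : ℕ) :
    ∀ x : Submodule K V, FiniteDimensional K x → Module.finrank K x = m →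
      (∀ v ∈ x, (∀ k, φ k v = 0) → v = 0) →
      ∃ (f : Fin m → V) (e : Fin m → ℕ), StrictMono e ∧ Submodule.span K (Set.range f) = x ∧
        (∀ j, (∀ k < e j, φ k (f j) = 0) ∧ φ (e j) (f j) ≠ 0) ∧
        ∀ v ∈ x, v ≠ 0 → ∃ j, (∀ k < e j, φ k v = 0) ∧ φ (e j) v ≠ 0 := by
  classical
  induction m with
  | zero =>
    intro x hfd hx _
    have hx0 : x = ⊥ := Submodule.finrank_eq_zero.1 hx
    subst hx0
    refine ⟨Fin.elim0, Fin.elim0, fun i => i.elim0, ?_, fun i => i.elim0, fun v hv h => ?_⟩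
    · simp
    · exact absurd ((Submodule.mem_bot K).1 hv) h
  | succ m ih =>
    intro x hfd hx hφ
    have hex : ∃ k, ∃ v ∈ x, φ k v ≠ 0 := by
      by_contra hcon
      push Not at hcon
      have : x = ⊥ := (Submodule.eq_bot_iff _).2 fun v hv => hφ v hv fun k => hcon k v hv
      rw [this, finrank_bot] at hx
      omega
    let k := Nat.find hex
    obtain ⟨f0, hf0, hk⟩ := Nat.find_spec hex
    have hlow : ∀ k' < k, ∀ v ∈ x, φ k' v = 0 := by
      intro k' hk' v hv
      by_contra hne
      exact Nat.find_min hex hk' ⟨v, hv, hne⟩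
    change φ k f0 ≠ 0 at hk
    let y : Submodule K V := x ⊓ LinearMap.ker (φ k)
    have hyx : y ≤ x := inf_le_left
    haveI : FiniteDimensional K y := Submodule.finiteDimensional_of_le hyx
    have hy : Module.finrank K y = m := by
      have h1 := LinearMap.finrank_range_add_finrank_ker ((φ k).domRestrict x)
      have h2 : LinearMap.range ((φ k).domRestrict x) = ⊤ := by
        rw [LinearMap.range_eq_top]
        intro c
        refine ⟨(c / φ k f0) • ⟨f0, hf0⟩, ?_⟩
        simp [hk]
      have h3 : (LinearMap.ker ((φ k).domRestrict x)).map x.subtype = y := by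
        ext v
        simp only [Submodule.mem_map, LinearMap.mem_ker, Submodule.subtype_apply, y, Submodule.mem_inf]
        constructor
        · rintro ⟨w, hw, rfl⟩; exact ⟨w.2, hw⟩
        · rintro ⟨hv, hv'⟩; exact ⟨⟨v, hv⟩, hv', rfl⟩
      rw [h2, finrank_top, Module.finrank_self, hx] at h1
      rw [← h3, LinearEquiv.finrank_eq (Submodule.equivMapOfInjective _ x.injective_subtype _).symm]
      omega
    obtain ⟨f, e, he, hf, hfe, hall⟩ := ih y this hy fun v hv => hφ v (hyx hv)
    have hek : ∀ j, k < e j := by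
      intro j
      have hfj : f j ∈ y := by rw [← hf]; exact Submodule.subset_span ⟨j, rfl⟩
      by_contra hle
      rcases lt_or_eq_of_le (not_lt.1 hle) with h | h
      · exact (hfe j).2 (hlow _ h _ (hyx hfj))
      · apply (hfe j).2; rw [h]; exact hfj.2
    refine ⟨Fin.cons f0 f, Fin.cons k e, ?_, ?_, ?_, ?_⟩
    · intro i j hij
      induction i using Fin.cases with
      | zero =>
        induction j using Fin.cases with
        | zero => exact absurd hij (lt_irrefl _)
        | succ j => simpa using hek j
      | succ i =>
        induction j using Fin.cases with
        | zero => exact absurd hij (Fin.not_lt_zero _)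
        | succ j => simpa using he (Fin.succ_lt_succ_iff.1 hij)
    · rw [Fin.range_cons, Submodule.span_insert, hf]
      apply le_antisymm
      · exact sup_le ((Submodule.span_singleton_le_iff_mem _ _).2 hf0) hyx
      · intro v hv
        have : v = (φ k v / φ k f0) • f0 + (v - (φ k v / φ k f0) • f0) := by abel
        rw [this]
        refine Submodule.add_mem_sup (Submodule.smul_mem _ _ (Submodule.mem_span_singleton_self _)) ?_
        refine ⟨x.sub_mem hv (x.smul_mem _ hf0), ?_⟩
        simp [hk]
    · intro j
      induction j using Fin.cases with
      | zero => exact ⟨fun k' hk' => hlow k' hk' f0 hf0, hk⟩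
      | succ j => simpa using hfe j
    · intro v hv hv0
      by_cases h : φ k v = 0
      · obtain ⟨j, hj⟩ := hall v ⟨hv, h⟩ hv0
        exact ⟨j.succ, by simpa using hj⟩
      · exact ⟨0, fun k' hk' => hlow k' hk' v hv, h⟩

theorem strictMono_gap {m : ℕ} (e : Fin m → ℕ) (he : StrictMono e) :
    ∀ (k : ℕ) (i j : Fin m), (i : ℕ) + k = j → e i + k ≤ e j := by
  intro k
  induction k with
  | zero => intro i j h; have : i = j := Fin.ext (by simpa using h); subst this; simp
  | succ k ih =>
    intro i j h
    have hj := j.2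
    have h1 := ih i ⟨(i : ℕ) + k, by omega⟩ rfl
    have h2 : e ⟨(i : ℕ) + k, by omega⟩ < e j := he (by rw [Fin.lt_def]; simp; omega)
    omega

variable {n : ℕ}

theorem strictMono_le_idx {m : ℕ} (e : Fin m → ℕ) (he : StrictMono e) (j : Fin m) : (j : ℕ) ≤ e j := by
  have := strictMono_gap e he j ⟨0, by have := j.2; omega⟩ j (by simp)
  omega

theorem strictMono_idx_le {m D : ℕ} (e : Fin m → ℕ) (he : StrictMono e) (hD : ∀ j, e j ≤ D) (j : Fin m) :
    e j + (m - 1 - j) ≤ D := by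
  have hj := j.2
  have := strictMono_gap e he (m - 1 - j) j ⟨m - 1, by omega⟩ (by simp; omega)
  exact this.trans (hD _)

theorem wr_span {m : ℕ} (f g : Fin m → ℂ[X]) (h : Submodule.span ℂ (Set.range f) = Submodule.span ℂ (Set.range g)) :
    ∃ c : ℂ, c ≠ 0 ∧ wr g = C c * wr f := by
  have aux : ∀ f g : Fin m → ℂ[X], Submodule.span ℂ (Set.range f) = Submodule.span ℂ (Set.range g) →
      ∃ c : ℂ, wr g = C c * wr f := by
    intro f g h
    have : ∀ j, ∃ c : Fin m → ℂ, ∑ k, c k • f k = g j := by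
      intro j
      have hj : g j ∈ Submodule.span ℂ (Set.range f) := by
        rw [h]; exact Submodule.subset_span ⟨j, rfl⟩
      exact (Submodule.mem_span_range_iff_exists_fun ℂ).1 hj
    choose P hP using this
    refine ⟨(Matrix.of fun k j => P j k).det, ?_⟩
    rw [← wr_mul]
    congr 1
    funext j
    rw [← hP]
    exact Finset.sum_congr rfl fun k _ => by rw [smul_eq_C_mul]; rfl
  obtain ⟨c, hc⟩ := aux f g h
  obtain ⟨c', hc'⟩ := aux g f h.symm
  by_cases hf : wr f = 0
  · exact ⟨1, one_ne_zero, by rw [hc, hf]; simp⟩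
  · refine ⟨c, ?_, hc⟩
    rintro rfl
    apply hf
    rw [hc', hc]; simp

/-- The polynomials spanning a point in the big cell. -/
noncomputable def cellP {R : Type*} [CommRing R] (A : Fin n → Fin (n+1) → R) (i : Fin n) : R[X] :=
  X ^ (n + 1 + (i : ℕ)) + ∑ j : Fin (n+1), C (A i j) * X ^ (j : ℕ)

theorem cellP_coeff_low {R : Type*} [CommRing R] (A : Fin n → Fin (n+1) → R) (i : Fin n) (j : Fin (n+1)) :
    (cellP A i).coeff j = A i j := by
  rw [cellP, coeff_add, coeff_X_pow, if_neg (by have := j.2; omega), finset_sum_coeff, zero_add,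
    Finset.sum_eq_single j]
  · simp
  · intro k _ hk
    rw [coeff_C_mul, coeff_X_pow, if_neg (fun h => hk (Fin.ext h.symm)), mul_zero]
  · simp

theorem cellP_coeff_high {R : Type*} [CommRing R] (A : Fin n → Fin (n+1) → R) (i : Fin n) (k : ℕ)
    (hk : n < k) : (cellP A i).coeff k = if k = n + 1 + (i : ℕ) then 1 else 0 := by
  rw [cellP, coeff_add, coeff_X_pow, finset_sum_coeff, Finset.sum_eq_zero, add_zero]
  intro j _
  rw [coeff_C_mul, coeff_X_pow, if_neg (by have := j.2; omega), mul_zero]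

theorem cellP_natDegree_le {R : Type*} [CommRing R] (A : Fin n → Fin (n+1) → R) (i : Fin n) :
    (cellP A i).natDegree ≤ n + 1 + (i : ℕ) := by
  rw [natDegree_le_iff_coeff_eq_zero]
  intro k hk
  rw [cellP_coeff_high A i k (by omega), if_neg (by omega)]

/-- the standard constant -/
noncomputable def cW (n : ℕ) : ℤ := vdm fun i : Fin n => n + 1 + (i : ℕ)

theorem cW_ne_zero (n : ℕ) : cW n ≠ 0 := vdm_ne_zero _ fun i j h => Fin.ext (by simpa using h)

theorem sum_cell (n : ℕ) : ∑ i : Fin n, (n + 1 + (i : ℕ)) = ∑ i : Fin n, (i : ℕ) + n * (n + 1) := by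
  rw [Finset.sum_add_distrib]; simp; ring

theorem wr_cell {R : Type*} [CommRing R] [Nontrivial R] (A : Fin n → Fin (n+1) → R) :
    (wr (cellP A)).natDegree ≤ n * (n + 1) ∧ (wr (cellP A)).coeff (n * (n + 1)) = (cW n : R) := by
  obtain ⟨h1, h2⟩ := wr_top (cellP A) (fun i => n + 1 + (i : ℕ)) (cellP_natDegree_le A)
  rw [sum_cell] at h1 h2
  constructor
  · rw [natDegree_le_iff_coeff_eq_zero] at h1 ⊢
    intro k hk
    have := h1 (∑ i : Fin n, (i : ℕ) + k) (by omega)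
    rwa [coeff_X_pow_mul', if_pos (by omega), Nat.add_sub_cancel_left] at this
  · rw [coeff_X_pow_mul', if_pos (by omega), Nat.add_sub_cancel_left] at h2
    rw [h2, Finset.prod_eq_one, one_mul]
    · rfl
    · intro i _
      rw [cellP_coeff_high A i _ (by omega), if_pos rfl]

theorem coeff_shift_ne {p : ℂ[X]} {b s N : ℕ} {c : ℂ} (hc : c ≠ 0) (hp : p = C c * X ^ N)
    (h : (X ^ b * p).coeff s ≠ 0) : s = b + N := by
  by_contra hne
  apply h
  rw [hp, coeff_X_pow_mul']
  split_ifs with hb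
  · rw [coeff_C_mul, coeff_X_pow, if_neg (by omega), mul_zero]
  · rfl

theorem cell_zero (A : Fin n → Fin (n+1) → ℂ) (c : ℂ) (hc : c ≠ 0)
    (h : wr (cellP A) = C c * X ^ (n * (n + 1))) : A = 0 := by
  set x := Submodule.span ℂ (Set.range (cellP A)) with hx
  have hdeg : ∀ v ∈ x, v.natDegree ≤ 2 * n := by
    intro v hv
    have hle : x ≤ degreeLE ℂ (2 * n : ℕ) := by
      rw [hx, Submodule.span_le]
      rintro _ ⟨i, rfl⟩
      rw [SetLike.mem_coe, mem_degreeLE]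
      exact natDegree_le_iff_degree_le.1 ((cellP_natDegree_le A i).trans (by have := i.2; omega))
    exact natDegree_le_iff_degree_le.2 (mem_degreeLE.1 (hle hv))
  have hli : LinearIndependent ℂ (cellP A) := by
    rw [Fintype.linearIndependent_iff]
    intro g hg i
    have := congrArg (fun p => p.coeff (n + 1 + (i : ℕ))) hg
    simp only [finset_sum_coeff, coeff_smul, coeff_zero] at this
    rw [Finset.sum_eq_single i] at this
    · rw [cellP_coeff_high A i _ (by omega), if_pos rfl] at this; simpa using this
    · intro j _ hj
      rw [cellP_coeff_high A j _ (by omega), if_neg (fun h => hj (Fin.ext (by omega))), smul_zero]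
    · simp
  have hfr : Module.finrank ℂ x = n := by rw [hx, finrank_span_eq_card hli, Fintype.card_fin]
  have hfd : FiniteDimensional ℂ x := FiniteDimensional.span_of_finite ℂ (Set.finite_range _)
  obtain ⟨f, e, he, hf, hfe, hall⟩ := echelon (fun k => lcoeff ℂ k) n x hfd hfr
    (fun v _ hv => Polynomial.ext fun k => by simpa using hv k)
  simp only [lcoeff_apply] at hfe hall
  have hfx : ∀ j, f j ∈ x := fun j => by rw [← hf]; exact Submodule.subset_span ⟨j, rfl⟩
  have heD : ∀ j, e j ≤ 2 * n := fun j =>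
    (le_natDegree_of_ne_zero (hfe j).2).trans (hdeg _ (hfx j))
  obtain ⟨c', hc', hw⟩ := wr_span (cellP A) f (hx.symm.trans hf.symm)
  have hlow := (wr_low f e fun j => X_pow_dvd_iff.2 (hfe j).1).2
  have hne : (X ^ (∑ i : Fin n, (i : ℕ)) * wr f).coeff (∑ j, e j) ≠ 0 := by
    rw [hlow]
    refine mul_ne_zero (Finset.prod_ne_zero_iff.2 fun j _ => (hfe j).2) ?_
    exact_mod_cast vdm_ne_zero e he.injective
  have hsum := coeff_shift_ne (mul_ne_zero hc' hc) (by rw [hw, h, C_mul, mul_assoc]) hne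
  rw [← sum_cell] at hsum
  have hle : ∀ j ∈ Finset.univ, e j ≤ n + 1 + (j : ℕ) := by
    intro j _
    have := strictMono_idx_le e he heD j
    have := j.2
    omega
  have heq := (Finset.sum_eq_sum_iff_of_le hle).1 hsum
  funext i j
  by_cases hv : cellP A i = 0
  · have := cellP_coeff_low A i j
    rw [hv] at this; simpa using this.symm
  obtain ⟨k, hk, _⟩ := hall _ (by rw [hx]; exact Submodule.subset_span ⟨i, rfl⟩) hv
  have := hk j (by rw [heq k (Finset.mem_univ _)]; have := j.2; omega)
  rwa [cellP_coeff_low] at this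

theorem cell_exists (x : Submodule ℂ ℂ[X]) (hx : IsGrassPt n x) (g : Fin n → ℂ[X])
    (hg : Submodule.span ℂ (Set.range g) = x) (hw : (wr g).natDegree = n * (n + 1)) (hw0 : wr g ≠ 0) :
    ∃ A : Fin n → Fin (n+1) → ℂ, Submodule.span ℂ (Set.range (cellP A)) = x := by
  obtain ⟨hx1, hfr⟩ := hx
  have hfd : FiniteDimensional ℂ x := by
    rw [← hg]; exact FiniteDimensional.span_of_finite ℂ (Set.finite_range _)
  have hcoef : ∀ v ∈ x, ∀ k, 2 * n < k → v.coeff k = 0 := by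
    intro v hv k hk
    have := mem_degreeLT.1 (hx1 hv)
    exact coeff_eq_zero_of_degree_lt (this.trans_le (by exact_mod_cast hk))
  obtain ⟨f, e, he, hf, hfe, hall⟩ := echelon (fun k => lcoeff ℂ (2 * n - k)) n x hfd hfr
    (fun v hv h => Polynomial.ext fun k => by
      by_cases hk : k ≤ 2 * n
      · have := h (2 * n - k)
        simpa [Nat.sub_sub_self hk] using this
      · simpa using hcoef v hv k (by omega))
  simp only [lcoeff_apply] at hfe hall
  have hfx : ∀ j, f j ∈ x := fun j => by rw [← hf]; exact Submodule.subset_span ⟨j, rfl⟩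
  have heD : ∀ j, e j ≤ 2 * n := by
    intro j
    by_contra hlt
    have := (hfe j).1 (2 * n) (by omega)
    apply (hfe j).2
    rwa [show 2 * n - e j = 2 * n - 2 * n by omega]
  have hd : ∀ j, (f j).natDegree ≤ 2 * n - e j := by
    intro j
    rw [natDegree_le_iff_coeff_eq_zero]
    intro k hk
    by_cases hk' : k ≤ 2 * n
    · have := (hfe j).1 (2 * n - k) (by omega)
      rwa [Nat.sub_sub_self hk'] at this
    · exact hcoef _ (hfx j) k (by omega)
  obtain ⟨c', hc', hwf⟩ := wr_span g f (hg.trans hf.symm)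
  obtain ⟨t1, t2⟩ := wr_top f (fun j => 2 * n - e j) hd
  have hne : (X ^ (∑ i : Fin n, (i : ℕ)) * wr f).coeff (∑ j, (2 * n - e j)) ≠ 0 := by
    rw [t2]
    refine mul_ne_zero (Finset.prod_ne_zero_iff.2 fun j _ => (hfe j).2) ?_
    have : Function.Injective fun j => 2 * n - e j := by
      intro i j hij
      have h1 := heD i
      have h2 := heD j
      exact he.injective (by simp only at hij; omega)
    exact_mod_cast vdm_ne_zero _ this
  have hdeg : (X ^ (∑ i : Fin n, (i : ℕ)) * wr f).natDegree = ∑ i : Fin n, (i : ℕ) + n * (n + 1) := by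
    rw [natDegree_X_pow_mul]
    · rw [hwf, natDegree_C_mul hc', hw]; ring
    · rw [hwf]; exact mul_ne_zero (C_ne_zero.2 hc') hw0
  have hsum : ∑ j : Fin n, (2 * n - e j) = ∑ i : Fin n, (i : ℕ) + n * (n + 1) :=
    le_antisymm (hdeg ▸ le_natDegree_of_ne_zero hne) (hdeg ▸ t1)
  have hrev : ∑ j : Fin n, (2 * n - (j : ℕ)) = ∑ i : Fin n, (n + 1 + (i : ℕ)) := by
    refine Fintype.sum_equiv Fin.revPerm _ _ fun j => ?_
    rw [Fin.revPerm_apply, Fin.val_rev]; have := j.2; omega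
  rw [← sum_cell, ← hrev] at hsum
  have heq := (Finset.sum_eq_sum_iff_of_le (fun j _ => by
    have := strictMono_le_idx e he j; omega)).1 hsum
  have hee : ∀ j, e j = j := fun j => by
    have h1 := heq j (Finset.mem_univ _)
    have := heD j; have := j.2; omega
  let L : x →ₗ[ℂ] (Fin n → ℂ) := LinearMap.pi fun i => (lcoeff ℂ (n + 1 + (i : ℕ))).domRestrict x
  have hLapp : ∀ v i, L v i = (v : ℂ[X]).coeff (n + 1 + (i : ℕ)) := fun v i => rfl
  have hLinj : Function.Injective L := by
    rw [← LinearMap.ker_eq_bot, LinearMap.ker_eq_bot']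
    intro v hv
    by_contra hv0
    obtain ⟨j, _, hj⟩ := hall v v.2 (by simpa using hv0)
    apply hj
    rw [hee]
    have := congrFun hv (Fin.rev j)
    rw [hLapp, Fin.val_rev] at this
    rwa [show 2 * n - (j : ℕ) = n + 1 + (n - (j + 1)) by have := j.2; omega]
  have hLsurj : Function.Surjective L :=
    (LinearMap.injective_iff_surjective_of_finrank_eq_finrank (by rw [hfr]; simp)).1 hLinj
  choose G hG using fun i : Fin n => hLsurj (Pi.single i 1)
  have hGc : ∀ i i' : Fin n, (G i : ℂ[X]).coeff (n + 1 + (i' : ℕ)) = if i' = i then 1 else 0 := by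
    intro i i'
    rw [← hLapp, hG, Pi.single_apply]
  refine ⟨fun i j => (G i : ℂ[X]).coeff j, ?_⟩
  have hcell : cellP (fun i j => (G i : ℂ[X]).coeff j) = fun i : Fin n => (G i : ℂ[X]) := by
    funext i
    ext k
    rcases Nat.lt_or_ge n k with hk | hk
    · rw [cellP_coeff_high _ _ _ hk]
      by_cases hk2 : k ≤ 2 * n
      · have := hGc i ⟨k - (n + 1), by omega⟩
        rw [show n + 1 + (k - (n+1)) = k by omega] at this
        rw [this]
        congr 1
        rw [Fin.ext_iff, eq_iff_iff]
        have e0 : ((⟨k - (n + 1), by omega⟩ : Fin n) : ℕ) = k - (n + 1) := rfl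
        rw [e0]
        constructor <;> intro h <;> omega
      · rw [hcoef _ (G i).2 k (by omega), if_neg (by have := i.2; omega)]
    · exact cellP_coeff_low (fun i j => (G i : ℂ[X]).coeff j) i ⟨k, by omega⟩
  rw [hcell]
  apply le_antisymm
  · rw [Submodule.span_le]; rintro _ ⟨i, rfl⟩; exact (G i).2
  · intro v hv
    have : (⟨v, hv⟩ : x) = ∑ i : Fin n, v.coeff (n + 1 + (i : ℕ)) • G i := by
      apply hLinj
      rw [map_sum]
      funext i'
      simp only [map_smul, hG, hLapp, Finset.sum_apply, Pi.smul_apply, Pi.single_apply]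
      simp
    have h2 := congrArg (Subtype.val) this
    rw [Submodule.coe_sum] at h2
    simp only [Submodule.coe_smul] at h2
    rw [h2]
    exact Submodule.sum_mem _ fun i _ => Submodule.smul_mem _ _ (Submodule.subset_span ⟨i, rfl⟩)

end WB
end OG
end PartWB

section PartWC
namespace OG

section WC
open Polynomial

variable {R : Type*} [CommRing R] {n : ℕ}

/-- Cofactors of the Wronskian of `f_1, …, f_n, φ` along the last column. -/
noncomputable def Vc (f : Fin n → R[X]) (k : Fin (n + 1)) : R[X] :=
  (-1) ^ ((k : ℕ) + n) * (Matrix.of fun i j : Fin n => derivative^[((k.succAbove i : Fin (n+1)) : ℕ)] (f j)).det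

theorem wr_snoc (f : Fin n → R[X]) (φ : R[X]) :
    wr (Fin.snoc f φ : Fin (n+1) → R[X]) = ∑ k, Vc f k * derivative^[(k : ℕ)] φ := by
  rw [wr, Matrix.det_succ_column _ (Fin.last n)]
  refine Finset.sum_congr rfl fun k _ => ?_
  rw [Vc, Matrix.of_apply, Fin.snoc_last, Fin.val_last, mul_right_comm]
  congr 3
  ext1 i j
  rw [Matrix.submatrix_apply, Matrix.of_apply, Matrix.of_apply, Fin.succAbove_last, Fin.snoc_castSucc]

theorem Vc_last (f : Fin n → R[X]) : Vc f (Fin.last n) = wr f := by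
  rw [Vc, Fin.val_last, ← two_mul, pow_mul]
  simp only [even_two, Even.neg_pow, one_pow, one_mul, Fin.succAbove_last, Fin.val_castSucc]
  rfl

theorem Vc_ann (f : Fin n → R[X]) (j : Fin n) : ∑ k, Vc f k * derivative^[(k : ℕ)] (f j) = 0 := by
  rw [← wr_snoc, wr]
  refine Matrix.det_zero_of_column_eq (i := j.castSucc) (j := Fin.last n) (Fin.castSucc_lt_last j).ne ?_
  intro k
  simp

theorem derivative_wr {m : ℕ} (f : Fin (m+1) → R[X]) :
    derivative (wr f) = (Matrix.of fun i j : Fin (m+1) =>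
      derivative^[(((Fin.last m).castSucc.succAbove i : Fin (m+2)) : ℕ)] (f j)).det := by
  rw [wr, derivative_det, Finset.sum_eq_single (Fin.last m)]
  · congr 1
    ext1 i j
    by_cases hi : i = Fin.last m
    · subst hi
      rw [Matrix.updateRow_self, Matrix.of_apply, Matrix.of_apply]
      rw [Fin.succAbove_of_le_castSucc _ _ le_rfl, Fin.val_succ, Fin.val_last,
        Function.iterate_succ_apply']
    · rw [Matrix.updateRow_ne hi, Matrix.of_apply, Matrix.of_apply, Fin.succAbove_of_castSucc_lt]
      · rfl
      · rw [Fin.castSucc_lt_castSucc_iff]; exact Fin.lt_last_iff_ne_last.2 hi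
  · intro i _ hi
    have him : (i : ℕ) < m := by
      have : i < Fin.last m := Fin.lt_last_iff_ne_last.2 hi
      simpa [Fin.lt_def] using this
    refine Matrix.det_zero_of_row_eq (i := i) (j := ⟨i + 1, by omega⟩) ?_ ?_
    · intro h; have := congrArg Fin.val h; simp at this
    · funext j
      rw [Matrix.updateRow_self, Matrix.updateRow_ne]
      · simp only [Matrix.of_apply]
        rw [Function.iterate_succ_apply']
      · intro h; have := congrArg Fin.val h; simp at this
  · simp

theorem Vc_pen {m : ℕ} (f : Fin (m+1) → R[X]) :
    Vc f (Fin.last m).castSucc = - derivative (wr f) := by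
  rw [Vc, derivative_wr, Fin.val_castSucc, Fin.val_last, ← add_assoc, pow_succ, ← two_mul, pow_mul]
  simp

theorem Vc_natDegree (f : Fin n → R[X]) [IsDomain R] (k : Fin (n+1)) (hf : ∀ j, (f j).natDegree ≤ n + 1 + (j : ℕ))
    (h0 : Vc f k ≠ 0) : (Vc f k).natDegree + n ≤ n * (n + 1) + k := by
  obtain ⟨M, hM⟩ : ∃ M : Matrix (Fin n) (Fin n) R[X],
      M = Matrix.of fun i j : Fin n => derivative^[((k.succAbove i : Fin (n+1)) : ℕ)] (f j) := ⟨_, rfl⟩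
  have hV : Vc f k = (-1) ^ ((k : ℕ) + n) * M.det := by rw [Vc, hM]
  have hM0 : M.det ≠ 0 := fun h => h0 (by rw [hV, h, mul_zero])
  have hdeg : (Vc f k).natDegree = M.det.natDegree := by
    rw [hV]
    rcases neg_one_pow_eq_or R[X] ((k : ℕ) + n) with h | h <;> rw [h] <;> simp
  have h1 := (det_top (Matrix.of fun i j : Fin n => X ^ ((k.succAbove i : Fin (n+1)) : ℕ) * M i j)
    (fun j => n + 1 + (j : ℕ)) (fun i j => by
      rw [hM, Matrix.of_apply, Matrix.of_apply]
      exact natDegree_euler _ _ _ (hf j))).1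
  rw [Matrix.det_mul_column, Finset.prod_pow_eq_pow_sum, natDegree_X_pow_mul _ hM0, sum_cell] at h1
  have h2 := Fin.sum_univ_succAbove (fun i : Fin (n+1) => (i : ℕ)) k
  rw [Fin.sum_univ_castSucc] at h2
  simp only [Fin.val_castSucc, Fin.val_last] at h2
  rw [hdeg]
  omega

end WC

section Lag
open Polynomial
variable {N : ℕ}

/-- `W/(z-a_i)` -/
noncomputable def Wi (a : Fin N → ℂ) (c : ℂ) (j : Fin N) : ℂ[X] :=
  C c * ∏ l ∈ Finset.univ.erase j, (X - C (a l))

theorem W_eq (a : Fin N → ℂ) (c : ℂ) (j : Fin N) :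
    C c * ∏ l, (X - C (a l)) = (X - C (a j)) * Wi a c j := by
  rw [Wi, ← Finset.mul_prod_erase Finset.univ _ (Finset.mem_univ j)]; ring

theorem Wi_eval_ne (a : Fin N → ℂ) (c : ℂ) {i j : Fin N} (h : i ≠ j) : (Wi a c j).eval (a i) = 0 := by
  rw [Wi, eval_mul, eval_prod, Finset.prod_eq_zero (Finset.mem_erase.2 ⟨h, Finset.mem_univ _⟩), mul_zero]
  simp

theorem W'_eval (a : Fin N → ℂ) (c : ℂ) (W : ℂ[X]) (hW : W = C c * ∏ l, (X - C (a l))) (i : Fin N) :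
    (derivative W).eval (a i) = (Wi a c i).eval (a i) := by
  rw [hW, W_eq a c i]; simp

theorem W'_ne (a : Fin N → ℂ) (ha : Function.Injective a) (c : ℂ) (hc : c ≠ 0) (i : Fin N) :
    (Wi a c i).eval (a i) ≠ 0 := by
  rw [Wi, eval_mul, eval_prod, eval_C]
  refine mul_ne_zero hc (Finset.prod_ne_zero_iff.2 fun l hl => ?_)
  rw [eval_sub, eval_X, eval_C]
  exact sub_ne_zero.2 (ha.ne (Finset.ne_of_mem_erase hl).symm)

theorem lagrange (a : Fin N → ℂ) (ha : Function.Injective a) (c : ℂ) (hc : c ≠ 0) (P : ℂ[X])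
    (hP : P.degree < N) : P = ∑ j, C (P.eval (a j) / (Wi a c j).eval (a j)) * Wi a c j := by
  refine Polynomial.eq_of_degrees_lt_of_eval_finset_eq (Finset.univ.image a) ?_ ?_ ?_
  · rwa [Finset.card_image_of_injective _ ha, Finset.card_univ, Fintype.card_fin]
  · rw [Finset.card_image_of_injective _ ha, Finset.card_univ, Fintype.card_fin]
    refine (degree_sum_le _ _).trans_lt ?_
    rw [Finset.sup_lt_iff (by exact WithBot.bot_lt_coe N)]
    intro j _
    have hN : 0 < N := j.pos
    rw [← smul_eq_C_mul]
    refine (degree_smul_le _ _).trans_lt ?_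
    rw [Wi]
    rw [← smul_eq_C_mul]
    refine (degree_smul_le _ _).trans_lt ?_
    rw [degree_prod]
    simp only [degree_X_sub_C, Finset.sum_const, Finset.card_erase_of_mem (Finset.mem_univ j),
      Finset.card_univ, Fintype.card_fin, nsmul_eq_mul, mul_one]
    exact_mod_cast Nat.sub_lt hN one_pos
  · intro z hz
    obtain ⟨i, _, rfl⟩ := Finset.mem_image.1 hz
    rw [eval_finset_sum, Finset.sum_eq_single i]
    · rw [eval_mul, eval_C, div_mul_cancel₀ _ (W'_ne a ha c hc i)]
    · intro j _ hj
      rw [eval_mul, Wi_eval_ne a c (Ne.symm hj), mul_zero]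
    · simp

theorem lagrange_deriv (a : Fin N → ℂ) (ha : Function.Injective a) (c : ℂ) (hc : c ≠ 0) (W : ℂ[X])
    (hW : W = C c * ∏ l, (X - C (a l))) (P : ℂ[X]) (hP : P.degree < N) (i : Fin N) :
    (derivative P).eval (a i) / (derivative W).eval (a i) =
      (derivative (derivative W)).eval (a i) / (2 * (derivative W).eval (a i)) *
        (P.eval (a i) / (derivative W).eval (a i)) +
      ∑ j, 1 / (a i - a j) * (P.eval (a j) / (derivative W).eval (a j)) := by
  have hne : ∀ j, (derivative W).eval (a j) ≠ 0 := fun j => by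
    rw [W'_eval a c W hW]; exact W'_ne a ha c hc j
  have hder : ∀ j, derivative W = Wi a c j + (X - C (a j)) * derivative (Wi a c j) := by
    intro j; rw [hW, W_eq a c j, derivative_mul]; simp
  have hder2 : ∀ j, derivative (derivative W) = 2 * derivative (Wi a c j) +
      (X - C (a j)) * derivative (derivative (Wi a c j)) := by
    intro j; rw [hder j, derivative_add, derivative_mul]; simp; ring
  have e1 : ∀ j, j ≠ i → (derivative (Wi a c j)).eval (a i) = 1 / (a i - a j) * (derivative W).eval (a i) := by
    intro j hj
    have h1 : a i - a j ≠ 0 := sub_ne_zero.2 (ha.ne (Ne.symm hj))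
    rw [hder j, eval_add, Wi_eval_ne a c (Ne.symm hj)]
    simp
    field_simp
  have e2 : (derivative (Wi a c i)).eval (a i) = (derivative (derivative W)).eval (a i) / 2 := by
    rw [hder2 i]; simp
  conv_lhs => rw [lagrange a ha c hc P hP]
  rw [derivative_sum, eval_finset_sum, ← Finset.add_sum_erase _ _ (Finset.mem_univ i),
    ← Finset.add_sum_erase Finset.univ (fun j => 1 / (a i - a j) * (P.eval (a j) / (derivative W).eval (a j)))
      (Finset.mem_univ i)]
  simp only [derivative_C_mul, eval_mul, eval_C, ← W'_eval a c W hW]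
  rw [e2, add_div, sub_self, div_zero, zero_mul, zero_add]
  congr 1
  · have := hne i; field_simp
  · rw [Finset.sum_div]
    refine Finset.sum_congr rfl fun j hj => ?_
    rw [e1 j (Finset.ne_of_mem_erase hj)]
    have := hne i
    have := hne j
    field_simp

theorem left_kernel {m : ℕ} (M M' : Matrix (Fin (m+1)) (Fin (m+1)) ℂ) (hdet : M'.det ≠ 0)
    (hMM : ∀ i, i ≠ Fin.last m → M i = M' i) (v y : Fin (m+1) → ℂ) (hv : Matrix.vecMul v M = 0)
    (hy : Matrix.vecMul y M = 0) (hv0 : v (Fin.last m) ≠ 0) (k : Fin (m+1)) :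
    y k = y (Fin.last m) / v (Fin.last m) * v k := by
  set z : Fin (m+1) → ℂ := y - (y (Fin.last m) / v (Fin.last m)) • v with hz
  have hzl : z (Fin.last m) = 0 := by simp [hz, hv0]
  have hzM : Matrix.vecMul z M = 0 := by
    rw [hz, Matrix.sub_vecMul, Matrix.smul_vecMul, hv, hy]; simp
  have hzM' : Matrix.vecMul z M' = 0 := by
    rw [← hzM]
    funext j
    simp only [Matrix.vecMul, dotProduct]
    refine Finset.sum_congr rfl fun i _ => ?_
    by_cases hi : i = Fin.last m
    · rw [hi, hzl]; simp
    · rw [hMM i hi]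
  have := congrFun (Matrix.eq_zero_of_vecMul_eq_zero hdet hzM') k
  simp only [hz, Pi.sub_apply, Pi.smul_apply, smul_eq_mul, Pi.zero_apply] at this
  linear_combination this

end Lag
end OG
end PartWC

section PartWD
namespace OG

section WD
open Polynomial

/-- shift of a sequence -/
def prevS {R : Type*} [Zero R] (v : ℕ → R) : ℕ → R
  | 0 => 0
  | k + 1 => v k

theorem shift_sum (m : ℕ) (F v v' : ℕ → ℂ) (h : ∑ k ∈ Finset.range (m+2), (v' k * F k + v k * F (k+1)) = 0)
    (h1 : v (m+1) = 0) (h2 : v' (m+1) + v m = 0) :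
    ∑ k ∈ Finset.range (m+1), (v' k + prevS v k) * F k = 0 := by
  have e : ∑ k ∈ Finset.range (m+1), prevS v k * F k = ∑ k ∈ Finset.range m, v k * F (k+1) := by
    rw [Finset.sum_range_succ']
    simp [prevS]
  simp only [add_mul, Finset.sum_add_distrib] at h ⊢
  rw [e]
  rw [Finset.sum_range_succ, Finset.sum_range_succ (fun k => v k * F (k+1)),
    Finset.sum_range_succ (fun k => v k * F (k+1)), h1] at h
  linear_combination h - F (m+1) * h2

/-- extended cofactors -/
noncomputable def vS {n : ℕ} (f : Fin n → ℂ[X]) (k : ℕ) : ℂ[X] :=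
  if h : k < n + 1 then Vc f ⟨k, h⟩ else 0

theorem vS_fin {n : ℕ} (f : Fin n → ℂ[X]) (k : Fin (n+1)) : vS f k = Vc f k := by
  rw [vS, dif_pos k.2]

theorem vS_ann {n : ℕ} (f : Fin n → ℂ[X]) (j : Fin n) :
    ∑ k ∈ Finset.range (n+1), vS f k * derivative^[k] (f j) = 0 := by
  rw [← Vc_ann f j, Finset.sum_range]
  simp only [vS_fin]

theorem vS_last {n : ℕ} (f : Fin n → ℂ[X]) : vS f n = wr f := by
  rw [← Vc_last, ← vS_fin, Fin.val_last]

theorem vS_pen {m : ℕ} (f : Fin (m+1) → ℂ[X]) : vS f m = - derivative (wr f) := by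
  rw [← Vc_pen, ← vS_fin, Fin.val_castSucc, Fin.val_last]

theorem vS_degree {n : ℕ} (f : Fin n → ℂ[X]) (hf : ∀ j, (f j).natDegree ≤ n + 1 + (j : ℕ)) (k : ℕ) (hk : k < n) :
    (vS f k).degree < (n * (n+1) : ℕ) := by
  rw [vS, dif_pos (by omega)]
  by_cases h0 : Vc f ⟨k, by omega⟩ = 0
  · rw [h0, degree_zero]; exact WithBot.bot_lt_coe _
  · have := Vc_natDegree f ⟨k, by omega⟩ hf h0
    rw [degree_eq_natDegree h0]
    simp only at this
    exact_mod_cast (by omega : _ < n * (n+1))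

/-- pointwise relation at a simple root -/
theorem root_rel {m : ℕ} (f : Fin (m+1) → ℂ[X]) (a : ℂ) (h0 : (wr f).eval a = 0)
    (h1 : (derivative (wr f)).eval a ≠ 0) :
    ∃ r : ℂ, ∀ k, k < m + 1 →
      (derivative (vS f k)).eval a + prevS (fun k => (vS f k).eval a) k = r * (vS f k).eval a := by
  set v : ℕ → ℂ := fun k => (vS f k).eval a with hv
  set v' : ℕ → ℂ := fun k => (derivative (vS f k)).eval a with hv'
  have hvl : v (m+1) = 0 := by simp only [hv, vS_last, h0]
  have hvp : v' (m+1) + v m = 0 := by simp only [hv, hv', vS_last, vS_pen, eval_neg]; ring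
  have hvm : v m ≠ 0 := by simp only [hv, vS_pen, eval_neg]; exact neg_ne_zero.2 h1
  let M : Matrix (Fin (m+1)) (Fin (m+1)) ℂ := Matrix.of fun i j => (derivative^[(i:ℕ)] (f j)).eval a
  let M' : Matrix (Fin (m+1)) (Fin (m+1)) ℂ := Matrix.of fun i j =>
    (derivative^[(((Fin.last m).castSucc.succAbove i : Fin (m+2)) : ℕ)] (f j)).eval a
  have hM' : M'.det ≠ 0 := by
    convert h1 using 1
    rw [derivative_wr, ← coe_evalRingHom, RingHom.map_det]
    rfl
  have hMM : ∀ i, i ≠ Fin.last m → M i = M' i := by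
    intro i hi
    funext j
    simp only [M, M', Matrix.of_apply]
    rw [Fin.succAbove_of_castSucc_lt]
    · rfl
    · rw [Fin.castSucc_lt_castSucc_iff]; exact Fin.lt_last_iff_ne_last.2 hi
  have hvM : Matrix.vecMul (fun k : Fin (m+1) => v k) M = 0 := by
    funext j
    simp only [Matrix.vecMul, dotProduct, M, Matrix.of_apply, Pi.zero_apply]
    have := congrArg (eval a) (vS_ann f j)
    rw [eval_finset_sum, Finset.sum_range_succ] at this
    simp only [eval_mul, eval_zero] at this
    rw [show eval a (vS f (m+1)) = 0 from hvl, zero_mul, add_zero, Finset.sum_range] at this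
    exact this
  have hyM : Matrix.vecMul (fun k : Fin (m+1) => v' k + prevS v k) M = 0 := by
    funext j
    simp only [Matrix.vecMul, dotProduct, M, Matrix.of_apply, Pi.zero_apply]
    have := congrArg (fun p => eval a (derivative p)) (vS_ann f j)
    simp only [derivative_sum, eval_finset_sum, derivative_mul, derivative_zero, eval_zero, eval_add, eval_mul,
      ← Function.iterate_succ_apply' (f := fun p : ℂ[X] => derivative p)] at this
    have h3 := shift_sum m (fun k => (derivative^[k] (f j)).eval a) v v' this hvl hvp
    rw [Finset.sum_range] at h3
    exact h3
  have key := left_kernel M M' hM' hMM _ _ hvM hyM (by simpa using hvm)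
  exact ⟨_, fun k hk => key ⟨k, hk⟩⟩

theorem trace_zero_of_comm {N : ℕ} (a : Fin N → ℝ) (ha : Function.Injective a) (p : Fin N → ℂ) (n : ℕ)
    (h : ∀ k, n ≤ k → ((Zm a p 1)^k).mulVec (fun _ => 1) = 0) (k : ℕ) (hk : n ≤ k) :
    ((Zm a p 1)^k).trace = 0 := by
  set Z := Zm a p 1 with hZ
  let D : Matrix (Fin N) (Fin N) ℂ := Matrix.diagonal fun i => (a i : ℂ)
  let J : Matrix (Fin N) (Fin N) ℂ := Matrix.of fun _ _ => 1
  have hc : D * Z - Z * D = 1 - J := by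
    ext i j
    rw [Matrix.sub_apply, Matrix.diagonal_mul, Matrix.mul_diagonal, hZ, Zm]
    simp only [Matrix.sub_apply, Matrix.of_apply, J, one_mul]
    by_cases hij : i = j
    · subst hij
      simp [cc]
      ring
    · have : (a i : ℂ) - a j ≠ 0 := by
        rw [sub_ne_zero]; intro h; exact hij (ha (by exact_mod_cast h))
      rw [Matrix.diagonal_apply_ne _ hij, Matrix.one_apply_ne hij, cc]
      simp
      field_simp
      ring
  have h1 : (Z^k * (D * Z - Z * D)).trace = 0 := by
    rw [mul_sub, Matrix.trace_sub, ← mul_assoc, ← mul_assoc, Matrix.trace_mul_comm (Z^k * D), ← mul_assoc,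
      ← pow_succ', ← pow_succ, sub_self]
  have h2 : (Z^k * J).trace = 0 := by
    rw [Matrix.trace]
    refine Finset.sum_eq_zero fun i _ => ?_
    have := congrFun (h k hk) i
    simpa [Matrix.mulVec, dotProduct, Matrix.mul_apply, J] using this
  rw [hc, mul_sub, Matrix.trace_sub, h2, mul_one, sub_zero] at h1
  exact h1

end WD
end OG
end PartWD

section PartWE
namespace OG

section WE
open Polynomial


theorem cell_real_simple {m : ℕ} (A : Fin (m+1) → Fin (m+2) → ℂ) (a : Fin ((m+1)*(m+2)) → ℝ)
    (ha : Function.Injective a)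
    (h : wr (cellP A) = C (cW (m+1) : ℂ) * ∏ l, (X - C (a l : ℂ))) (i : Fin (m+1)) (j : Fin (m+2)) :
    (A i j).im = 0 := by
  set f := cellP A with hf
  set W := wr f with hWdef
  have hc : (cW (m+1) : ℂ) ≠ 0 := by exact_mod_cast cW_ne_zero (m+1)
  let aC : Fin ((m+1)*(m+2)) → ℂ := fun l => (a l : ℂ)
  have haC : Function.Injective aC := fun x y hxy => ha (Complex.ofReal_injective hxy)
  have hW : W = C (cW (m+1) : ℂ) * ∏ l, (X - C (aC l)) := h
  have hd : ∀ l, (derivative W).eval (aC l) ≠ 0 := fun l => by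
    rw [W'_eval aC _ W hW]; exact W'_ne aC haC _ hc l
  have hz : ∀ l, W.eval (aC l) = 0 := fun l => by
    rw [hW, W_eq aC _ l]; simp
  choose r hr using fun l => root_rel f (aC l) (hz l) (hd l)
  have hdeg : ∀ k, k < m+1 → (vS f k).degree < ((m+1)*(m+2) : ℕ) := fun k hk =>
    vS_degree f (cellP_natDegree_le A) k hk
  let c : ℕ → Fin ((m+1)*(m+2)) → ℂ := fun k l => (vS f k).eval (aC l) / (derivative W).eval (aC l)
  let p : Fin ((m+1)*(m+2)) → ℂ := fun l =>
    r l - (derivative (derivative W)).eval (aC l) / (2 * (derivative W).eval (aC l))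
  have hZ : ∀ k, k < m+1 → (Zm a p 1).mulVec (c k) = fun l => prevS (fun k => c k l) k := by
    intro k hk
    funext l
    have h1 := lagrange_deriv aC haC _ hc W hW (vS f k) (hdeg k hk) l
    have h2 := hr l k hk
    have h3 : prevS (fun k => c k l) k = prevS (fun k => (vS f k).eval (aC l)) k / (derivative W).eval (aC l) := by
      cases k <;> simp [prevS, c]
    rw [h3, ← sub_eq_iff_eq_add'.2 h2.symm, sub_div, h1, Zm, Matrix.sub_mulVec, Pi.sub_apply, Matrix.mulVec_diagonal]
    have h4 : (Matrix.of fun i j => (1:ℂ) * algebraMap ℝ ℂ (cc a i j)).mulVec (c k) l =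
        ∑ j, 1 / (aC l - aC j) * c k j := by
      simp only [Matrix.mulVec, dotProduct, Matrix.of_apply, cc, one_mul]
      refine Finset.sum_congr rfl fun j _ => ?_
      simp [aC]
    rw [h4]
    simp only [p, c]
    ring
  have hcm : c m = fun _ => -1 := by
    funext l
    simp only [c, vS_pen, eval_neg]
    rw [neg_div, div_self (hd l)]
  have hpow : ∀ k, k ≤ m → ((Zm a p 1)^k).mulVec (c m) = c (m - k) := by
    intro k
    induction k with
    | zero => intro _; simp
    | succ k ih =>
      intro hk
      rw [pow_succ', ← Matrix.mulVec_mulVec, ih (by omega), hZ _ (by omega)]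
      obtain ⟨q, hq⟩ : ∃ q, m - k = q + 1 := ⟨m - k - 1, by omega⟩
      rw [hq]
      simp only [prevS]
      rw [show m - (k+1) = q by omega]
  have hpow2 : ((Zm a p 1)^(m+1)).mulVec (c m) = 0 := by
    rw [pow_succ', ← Matrix.mulVec_mulVec, hpow m le_rfl, Nat.sub_self, hZ 0 (by omega)]
    rfl
  have hone : ∀ k, m + 1 ≤ k → ((Zm a p 1)^k).mulVec (fun _ => 1) = 0 := by
    intro k hk
    obtain ⟨q, rfl⟩ := Nat.exists_eq_add_of_le' hk
    have h1 : (fun _ => 1 : Fin ((m+1)*(m+2)) → ℂ) = - c m := by rw [hcm]; funext; simp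
    rw [h1, Matrix.mulVec_neg, pow_add, ← Matrix.mulVec_mulVec, hpow2, Matrix.mulVec_zero, neg_zero]
  have htr := trace_zero_of_comm a ha p (m+1) hone
  have hnil := nilpotent_of_trace (Zm a p 1) (m+1) htr
  have hreal := CM_real a ha p fun k => by
    have : IsNilpotent ((Zm a p 1)^((k:ℕ)+1)) := hnil.pow_of_pos (by omega)
    exact (Matrix.isNilpotent_trace_of_isNilpotent this).eq_zero
  have hpc : ∀ l, (starRingEnd ℂ) (p l) = p l := fun l => Complex.conj_eq_iff_im.2 (hreal l)
  have hZc : ∀ k l, (starRingEnd ℂ) (Zm a p 1 k l) = Zm a p 1 k l := by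
    intro k l
    rw [Zm]
    simp only [Matrix.sub_apply, Matrix.of_apply, map_sub, one_mul]
    congr 1
    · by_cases hkl : k = l
      · subst hkl; simp [hpc]
      · simp [hkl]
    · simp
  have hmv : ∀ v : Fin ((m+1)*(m+2)) → ℂ, (∀ l, (starRingEnd ℂ) (v l) = v l) →
      ∀ l, (starRingEnd ℂ) ((Zm a p 1).mulVec v l) = (Zm a p 1).mulVec v l := by
    intro v hv l
    simp only [Matrix.mulVec, dotProduct, map_sum, map_mul, hZc, hv]
  have hcc : ∀ k, k ≤ m → ∀ l, (starRingEnd ℂ) (c (m - k) l) = c (m - k) l := by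
    intro k
    induction k with
    | zero => intro _ l; rw [Nat.sub_zero, hcm]; simp
    | succ k ih =>
      intro hk
      have : c (m - (k+1)) = (Zm a p 1).mulVec (c (m-k)) := by
        rw [hZ _ (by omega)]
        obtain ⟨q, hq⟩ : ∃ q, m - k = q + 1 := ⟨m - k - 1, by omega⟩
        rw [hq]
        simp only [prevS]
        rw [show m - (k+1) = q by omega]
      rw [this]
      exact hmv _ (ih (by omega))
  have hWc : W.map (starRingEnd ℂ) = W := by
    rw [hW, Polynomial.map_mul, Polynomial.map_prod]
    simp [aC]
  have hevc : ∀ (P : ℂ[X]) l, (P.map (starRingEnd ℂ)).eval (aC l) = (starRingEnd ℂ) (P.eval (aC l)) := by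
    intro P l
    have : aC l = (starRingEnd ℂ) (aC l) := by simp [aC]
    conv_lhs => rw [this]
    rw [eval_map, eval₂_hom]
  have hVc : ∀ k, k < m + 2 → (vS f k).map (starRingEnd ℂ) = vS f k := by
    intro k hk
    rcases Nat.lt_succ_iff_lt_or_eq.1 hk with hk | rfl
    · refine Polynomial.eq_of_degrees_lt_of_eval_finset_eq (Finset.univ.image aC) ?_ ?_ ?_
      · rw [Finset.card_image_of_injective _ haC, Finset.card_univ, Fintype.card_fin]
        exact degree_map_le.trans_lt (hdeg k hk)
      · rw [Finset.card_image_of_injective _ haC, Finset.card_univ, Fintype.card_fin]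
        exact hdeg k hk
      · intro z hz'
        obtain ⟨l, _, rfl⟩ := Finset.mem_image.1 hz'
        have h1 := hcc (m - k) (by omega) l
        rw [show m - (m - k) = k by omega] at h1
        simp only [c, map_div₀, ← hevc, ← derivative_map, hWc] at h1
        exact (div_left_inj' (hd l)).1 h1
    · rw [vS_last]; exact hWc
  have hg0 : f i - (f i).map (starRingEnd ℂ) = 0 := by
    set g := f i - (f i).map (starRingEnd ℂ) with hg
    have hgd : g.natDegree ≤ m + 1 := by
      rw [natDegree_le_iff_coeff_eq_zero]
      intro N hN
      rw [hg, coeff_sub, coeff_map, hf, cellP_coeff_high A i N hN]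
      split_ifs <;> simp
    have hw : wr (Fin.snoc f g : Fin (m+2) → ℂ[X]) = 0 := by
      rw [wr_snoc]
      have h1 := Vc_ann f i
      have h2 := congrArg (Polynomial.map (starRingEnd ℂ)) h1
      rw [Polynomial.map_sum, Polynomial.map_zero] at h2
      have : ∀ k : Fin (m+2), Vc f k * derivative^[(k:ℕ)] g =
          Vc f k * derivative^[(k:ℕ)] (f i) - (Vc f k * derivative^[(k:ℕ)] (f i)).map (starRingEnd ℂ) := by
        intro k
        rw [Polynomial.map_mul, ← vS_fin, hVc _ k.2, hg, iterate_derivative_sub, iterate_derivative_map, mul_sub]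
      rw [Finset.sum_congr rfl fun k _ => this k, Finset.sum_sub_distrib, h1, h2, sub_zero]
    by_contra hg0
    let d : Fin (m+2) → ℕ := Fin.snoc (fun i : Fin (m+1) => m + 2 + (i:ℕ)) g.natDegree
    have hdle : ∀ j, ((Fin.snoc f g : Fin (m+2) → ℂ[X]) j).natDegree ≤ d j := by
      intro j
      refine Fin.lastCases ?_ (fun j => ?_) j
      · simp [d]
      · simp only [d, Fin.snoc_castSucc]; exact cellP_natDegree_le A j
    have hdinj : Function.Injective d := by
      intro x y
      refine Fin.lastCases ?_ (fun x => ?_) x <;> refine Fin.lastCases ?_ (fun y => ?_) y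
      · simp
      · simp only [d, Fin.snoc_castSucc, Fin.snoc_last]; intro; omega
      · simp only [d, Fin.snoc_castSucc, Fin.snoc_last]; intro; omega
      · simp only [d, Fin.snoc_castSucc]; intro hxy; congr 1; exact Fin.ext (by omega)
    have h1 := (wr_top _ d hdle).2
    rw [hw, mul_zero, coeff_zero, Fin.prod_univ_castSucc] at h1
    simp only [d, Fin.snoc_castSucc, Fin.snoc_last] at h1
    rw [Finset.prod_eq_one, one_mul] at h1
    · rcases mul_eq_zero.1 h1.symm with h | h
      · exact hg0 (leadingCoeff_eq_zero.1 h)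
      · exact vdm_ne_zero _ hdinj (by exact_mod_cast h)
    · intro j _
      rw [hf, cellP_coeff_high A j _ (by omega), if_pos (by ring)]
  have := congrArg (fun P => P.coeff (j:ℕ)) hg0
  simp only [coeff_sub, coeff_map, coeff_zero, hf, cellP_coeff_low] at this
  exact Complex.conj_eq_iff_im.1 (sub_eq_zero.1 this).symm

end WE
end OG
end PartWE

section PartWF
namespace OG

section WF
open Polynomial

variable {n : ℕ}

theorem iter_comp {R : Type*} [CommRing R] (s : R) (f : R[X]) (k : ℕ) :
    derivative^[k] (f.comp (C s * X)) = C (s^k) * (derivative^[k] f).comp (C s * X) := by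
  induction k with
  | zero => simp
  | succ k ih =>
    rw [Function.iterate_succ_apply', ih, Function.iterate_succ_apply', derivative_C_mul, derivative_comp]
    simp [pow_succ]
    ring

theorem wr_comp {R : Type*} [CommRing R] (s : R) (f : Fin n → R[X]) :
    wr (fun j => (f j).comp (C s * X)) = C (s ^ (∑ i : Fin n, (i:ℕ))) * (wr f).comp (C s * X) := by
  rw [wr, wr, ← coe_compRingHom_apply, RingHom.map_det, ← Finset.prod_pow_eq_pow_sum, map_prod,
    ← Matrix.det_mul_column]
  congr 1
  ext1 i j
  rw [Matrix.of_apply, Matrix.of_apply]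
  exact iter_comp s (f j) i

theorem wr_scale {R : Type*} [CommRing R] (c : Fin n → R) (f : Fin n → R[X]) :
    wr (fun j => C (c j) * f j) = C (∏ j, c j) * wr f := by
  have h := wr_mul f (Matrix.diagonal c)
  rw [Matrix.det_diagonal] at h
  rw [← h]
  congr 1
  funext j
  rw [Finset.sum_eq_single j]
  · simp
  · intro k _ hk; simp [hk]
  · simp

theorem cellP_scale {R : Type*} [CommRing R] (s : R) (A : Fin n → Fin (n+1) → R) (i : Fin n) :
    (cellP (fun i j => s ^ (n + 1 + (i:ℕ) - (j:ℕ)) * A i j) i).comp (C s * X) =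
      C (s ^ (n + 1 + (i:ℕ))) * cellP A i := by
  rw [cellP, cellP, add_comp, ← coe_compRingHom_apply (∑ j : Fin (n+1), _), map_sum, mul_add, Finset.mul_sum]
  congr 1
  · simp [mul_pow]
  · refine Finset.sum_congr rfl fun j _ => ?_
    have : s ^ (n + 1 + (i:ℕ)) = s ^ (n + 1 + (i:ℕ) - (j:ℕ)) * s ^ (j:ℕ) := by
      rw [← pow_add]; congr 1; have := j.2; omega
    rw [this]
    simp [mul_pow]
    ring

theorem coeff_scale (A : Fin n → Fin (n+1) → ℝ) (k : ℕ) (hk : k ≤ n * (n+1)) :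
    (wr (cellP fun i j => (2:ℝ) ^ (n + 1 + (i:ℕ) - (j:ℕ)) * A i j)).coeff k =
      2 ^ (n * (n+1) - k) * (wr (cellP A)).coeff k := by
  have h := wr_comp (2:ℝ) (cellP fun i j => (2:ℝ) ^ (n + 1 + (i:ℕ) - (j:ℕ)) * A i j)
  rw [funext fun i => cellP_scale (2:ℝ) A i, wr_scale, Finset.prod_pow_eq_pow_sum, sum_cell] at h
  have h2 := congrArg (fun p => p.coeff k) h
  simp only [coeff_C_mul, comp_C_mul_X_coeff] at h2
  have e : (2:ℝ) ^ (∑ i : Fin n, (i:ℕ) + n * (n+1)) = 2 ^ (∑ i : Fin n, (i:ℕ)) * (2 ^ (n * (n+1) - k) * 2 ^ k) := by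
    rw [← pow_add, ← pow_add]; congr 1; omega
  rw [e] at h2
  have p1 : (2:ℝ) ^ (∑ i : Fin n, (i:ℕ)) ≠ 0 := by positivity
  have p2 : (2:ℝ) ^ k ≠ 0 := by positivity
  apply mul_left_cancel₀ p1
  apply mul_right_cancel₀ p2
  linear_combination -h2

theorem cellP_map {R S : Type*} [CommRing R] [CommRing S] (φ : R →+* S) (A : Fin n → Fin (n+1) → R) (i : Fin n) :
    (cellP A i).map φ = cellP (fun i j => φ (A i j)) i := by
  simp [cellP, Polynomial.map_sum]

theorem wr_cell_map {R S : Type*} [CommRing R] [CommRing S] (φ : R →+* S) (A : Fin n → Fin (n+1) → R) (k : ℕ) :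
    φ ((wr (cellP A)).coeff k) = (wr (cellP fun i j => φ (A i j))).coeff k := by
  rw [← coeff_map, wr_map]
  congr 2
  funext i
  exact cellP_map φ A i

/-- normalised coefficient of the Wronskian of a polynomially parametrised family -/
noncomputable def coefP {σ : Type} (Φ : Fin n → Fin (n+1) → MvPolynomial σ ℝ) (k : ℕ) : MvPolynomial σ ℝ :=
  MvPolynomial.C (cW n : ℝ)⁻¹ * (wr (cellP Φ)).coeff k

theorem coefP_aeval {σ : Type} (Φ : Fin n → Fin (n+1) → MvPolynomial σ ℝ) (k : ℕ) (x : σ → ℂ) :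
    MvPolynomial.aeval x (coefP Φ k) = (cW n : ℂ)⁻¹ *
      (wr (cellP fun i j => MvPolynomial.aeval x (Φ i j))).coeff k := by
  rw [coefP, map_mul, MvPolynomial.aeval_C]
  congr 1
  · simp
  · exact wr_cell_map (MvPolynomial.aeval x : MvPolynomial σ ℝ →ₐ[ℝ] ℂ).toRingHom Φ k

theorem coefP_eval {σ : Type} (Φ : Fin n → Fin (n+1) → MvPolynomial σ ℝ) (k : ℕ) (x : σ → ℝ) :
    MvPolynomial.eval x (coefP Φ k) = (cW n : ℝ)⁻¹ *
      (wr (cellP fun i j => MvPolynomial.eval x (Φ i j))).coeff k := by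
  rw [coefP, map_mul, MvPolynomial.eval_C, wr_cell_map]

theorem coefP_hom {σ : Type} [Fintype σ] (Φ : Fin n → Fin (n+1) → MvPolynomial σ ℝ) (w : σ → ℕ)
    (hΦ : ∀ (x : σ → ℝ) i j, MvPolynomial.eval (fun s => 2 ^ w s * x s) (Φ i j) =
      2 ^ (n + 1 + (i:ℕ) - (j:ℕ)) * MvPolynomial.eval x (Φ i j)) (k : ℕ) (hk : k ≤ n * (n+1)) :
    MvPolynomial.IsWeightedHomogeneous w (coefP Φ k) (n * (n+1) - k) := by
  refine hom_of_scale _ _ _ fun x => ?_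
  rw [coefP_eval, coefP_eval]
  simp only [hΦ]
  rw [coeff_scale _ k hk]
  ring

theorem cW_neC (n : ℕ) : (cW n : ℂ) ≠ 0 := by exact_mod_cast cW_ne_zero n

/-- the Wronskian of a cell point is determined by low coefficients -/
theorem wr_eq_of_coeff (A : Fin n → Fin (n+1) → ℂ) (P : ℂ[X]) (hP : P.Monic) (hd : P.natDegree = n * (n+1))
    (h : ∀ k, k < n * (n+1) → (cW n : ℂ)⁻¹ * (wr (cellP A)).coeff k = P.coeff k) :
    wr (cellP A) = C (cW n : ℂ) * P := by
  ext k
  rw [coeff_C_mul]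
  rcases lt_trichotomy k (n * (n+1)) with hk | hk | hk
  · rw [← h k hk, mul_inv_cancel_left₀ (cW_neC n)]
  · rw [hk, (wr_cell A).2]
    have := hP.coeff_natDegree
    rw [hd] at this
    rw [this, mul_one]
  · rw [coeff_eq_zero_of_natDegree_lt ((wr_cell A).1.trans_lt hk), coeff_eq_zero_of_natDegree_lt (hd ▸ hk), mul_zero]

/-- The Wronski map on the big cell. -/
noncomputable def WrA (n : ℕ) : PMap (Fin n × Fin (n+1)) (Fin (n * (n+1))) where
  f t := coefP (fun i j => MvPolynomial.X (i, j)) (n * (n+1) - 1 - t)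
  w s := n + 1 + (s.1 : ℕ) - (s.2 : ℕ)
  d t := t + 1
  hw s := by have := s.2.2; omega
  hd t := by omega
  hom t := by
    have := coefP_hom (n := n) (fun i j => MvPolynomial.X (i, j)) (fun s : Fin n × Fin (n+1) => n + 1 + (s.1 : ℕ) - (s.2 : ℕ))
      (by intro x i j; simp) (n * (n+1) - 1 - t) (by omega)
    convert this using 1
    have := t.2
    omega
  zero x h := by
    have := wr_eq_of_coeff (fun i j => x (i,j)) (X ^ (n * (n+1))) (monic_X_pow _) (natDegree_X_pow _) (by
      intro k hk
      have := h ⟨n * (n+1) - 1 - k, by omega⟩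
      rw [coefP_aeval] at this
      simp only [MvPolynomial.aeval_X] at this
      rw [show n * (n+1) - 1 - (n * (n+1) - 1 - k) = k by omega] at this
      rw [this, coeff_X_pow, if_neg (by omega)])
    have := cell_zero _ _ (cW_neC n) this
    funext s
    exact congrFun (congrFun this s.1) s.2
  card := by simp

theorem cont_coeff {T ι : Type*} [TopologicalSpace T] (s : Finset ι) (g : ι → T → ℝ) (hg : ∀ i, Continuous (g i))
    (k : ℕ) : Continuous fun t => (∏ l ∈ s, (X - C (g l t))).coeff k := by
  classical
  induction s using Finset.induction_on generalizing k with
  | empty => simpa using continuous_const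
  | insert i s hi ih =>
    simp only [Finset.prod_insert hi, coeff_mul]
    refine continuous_finsetSum _ fun p _ => Continuous.mul ?_ (ih _)
    simp only [coeff_sub]
    refine Continuous.sub continuous_const ?_
    simp only [coeff_C]
    split_ifs
    · exact hg i
    · exact continuous_const

theorem prod_coeff_ofReal {ι : Type*} (s : Finset ι) (g : ι → ℝ) (k : ℕ) :
    (((∏ l ∈ s, (X - C (g l))).coeff k : ℝ) : ℂ) = (∏ l ∈ s, (X - C (g l : ℂ))).coeff k := by
  have := coeff_map (Complex.ofRealHom) (p := ∏ l ∈ s, (X - C (g l))) k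
  rw [Polynomial.map_prod] at this
  simpa using this.symm

theorem cell_real (A : Fin n → Fin (n+1) → ℂ) (a : Fin (n * (n+1)) → ℝ)
    (h : wr (cellP A) = C (cW n : ℂ) * ∏ l, (X - C (a l : ℂ))) (i : Fin n) (j : Fin (n+1)) :
    (A i j).im = 0 := by
  obtain ⟨m, rfl⟩ : ∃ m, n = m + 1 := ⟨n - 1, by have := i.2; omega⟩
  let g : Fin ((m+1) * (m+1+1)) → ℝ → ℝ := fun l s => a l + s * (l : ℝ)
  have hg : ∀ l, Continuous (g l) := fun l => by fun_prop
  let Ψ : ℝ → Fin ((m+1) * (m+1+1)) → ℝ := fun s t => (∏ l, (X - C (g l s))).coeff (((m+1) * (m+1+1)) - 1 - t)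
  have key : (WrA (m+1)).RealAt (Ψ 0) := by
    refine (WrA (m+1)).real_closure Ψ (fun t => cont_coeff _ g hg _)
      {s | Function.Injective fun l => g l s} 0 ?_ ?_
    · have hfin : {s : ℝ | ¬ Function.Injective fun l => g l s}.Finite := by
        refine (Set.finite_range fun p : Fin ((m+1) * (m+1+1)) × Fin ((m+1) * (m+1+1)) => (a p.1 - a p.2) / ((p.2:ℝ) - (p.1:ℝ))).subset ?_
        intro s hs
        simp only [Set.mem_setOf_eq, Function.Injective, not_forall] at hs
        obtain ⟨x, y, hxy, hne⟩ := hs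
        refine ⟨(x, y), ?_⟩
        have : (y:ℝ) - (x:ℝ) ≠ 0 := by
          rw [sub_ne_zero]; intro h; exact hne (Fin.ext (by exact_mod_cast h.symm))
        simp only
        rw [div_eq_iff this]
        simp only [g] at hxy
        linarith
      have : {s : ℝ | Function.Injective fun l => g l s} = {s | ¬ Function.Injective fun l => g l s}ᶜ := by
        ext; simp
      rw [this]
      exact (hfin.countable.dense_compl ℝ) 0
    · intro s hs x hx
      have hw := wr_eq_of_coeff (fun i j => x (i,j)) (∏ l, (X - C ((g l s : ℝ) : ℂ))) (monic_prod_X_sub_C _ _) (by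
          rw [natDegree_finsetProd_X_sub_C_eq_card]; simp) (by
        intro k hk
        have := hx ⟨((m+1) * (m+1+1)) - 1 - k, by omega⟩
        simp only [WrA] at this
        rw [coefP_aeval] at this
        simp only [MvPolynomial.aeval_X, Ψ] at this
        rw [show (m+1) * (m+1+1) - 1 - (((m+1) * (m+1+1)) - 1 - k) = k by omega,
          prod_coeff_ofReal] at this
        exact this)
      intro p
      exact cell_real_simple (fun i j => x (i,j)) (fun l => g l s) hs hw p.1 p.2
  refine key (fun p => A p.1 p.2) ?_ (i, j)
  intro t
  simp only [WrA]
  rw [coefP_aeval]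
  simp only [MvPolynomial.aeval_X, Ψ]
  rw [h, coeff_C_mul, inv_mul_cancel_left₀ (cW_neC _), prod_coeff_ofReal]
  simp [g]

end WF
end OG
end PartWF

section PartYA
namespace OG

section YA
open Polynomial

variable {n : ℕ}

theorem iter_taylor (a : ℂ) (f : ℂ[X]) (k : ℕ) :
    derivative^[k] (f.comp (X + C a)) = (derivative^[k] f).comp (X + C a) := by
  induction k with
  | zero => simp
  | succ k ih =>
    rw [Function.iterate_succ_apply', ih, Function.iterate_succ_apply', derivative_comp]
    simp

theorem wr_taylor (a : ℂ) (f : Fin n → ℂ[X]) :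
    wr (fun j => (f j).comp (X + C a)) = (wr f).comp (X + C a) := by
  rw [wr, wr, ← coe_compRingHom_apply, RingHom.map_det]
  congr 1
  ext1 i j
  exact iter_taylor a (f j) i

/-- The polynomial version of the form. -/
noncomputable def formP (n : ℕ) (p q : ℂ[X]) : ℂ[X] :=
  ∑ m ∈ Finset.range (2*n+1), (-1)^m * (derivative^[m] p * derivative^[2*n-m] q)

theorem eval_iter (p : ℂ[X]) (m : ℕ) : (derivative^[m] p).eval 0 = (m.factorial : ℂ) * p.coeff m := by
  rw [← coeff_zero_eq_eval_zero, coeff_iterate_derivative, zero_add, Nat.descFactorial_self, nsmul_eq_mul]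

theorem formP_eval (p q : ℂ[X]) : (formP n p q).eval 0 = form n p q := by
  rw [formP, form, eval_finset_sum]
  refine Finset.sum_congr rfl fun m _ => ?_
  rw [eval_mul, eval_mul, eval_iter, eval_iter]
  simp
  ring

theorem formP_derivative (p q : ℂ[X]) (hp : p.natDegree ≤ 2*n) (hq : q.natDegree ≤ 2*n) :
    derivative (formP n p q) = 0 := by
  have key : ∀ M, M ≤ 2*n+1 → derivative (∑ m ∈ Finset.range M, (-1)^m * (derivative^[m] p * derivative^[2*n-m] q)) =
      p * derivative^[2*n+1] q - (-1)^M * (derivative^[M] p * derivative^[2*n+1-M] q) := by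
    intro M
    induction M with
    | zero => intro _; simp
    | succ M ih =>
      intro hM
      rw [Finset.sum_range_succ, derivative_add, ih (by omega), derivative_mul, derivative_mul,
        show 2*n+1-M = (2*n-M)+1 by omega, show 2*n+1-(M+1) = 2*n-M by omega]
      simp only [Function.iterate_succ_apply']
      have : derivative ((-1:ℂ[X])^M) = 0 := by
        rcases neg_one_pow_eq_or ℂ[X] M with h | h <;> simp [h]
      rw [this, pow_succ]
      ring
  rw [formP, key _ le_rfl, iterate_derivative_eq_zero (by omega), iterate_derivative_eq_zero (x := 2*n+1) (by omega)]
  simp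

theorem form_taylor (a : ℂ) (p q : ℂ[X]) (hp : p.natDegree ≤ 2*n) (hq : q.natDegree ≤ 2*n) :
    form n (p.comp (X + C a)) (q.comp (X + C a)) = form n p q := by
  have h1 := natDegree_eq_zero_of_derivative_eq_zero (formP_derivative p q hp hq)
  rw [natDegree_eq_zero] at h1
  obtain ⟨c, hc⟩ := h1
  rw [← formP_eval, ← formP_eval, ← hc]
  have : formP n (p.comp (X + C a)) (q.comp (X + C a)) = (formP n p q).comp (X + C a) := by
    rw [formP, formP, ← coe_compRingHom_apply (∑ m ∈ _, _), map_sum]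
    refine Finset.sum_congr rfl fun m _ => ?_
    rw [iter_taylor, iter_taylor]
    simp
  rw [this, ← hc]
  simp

theorem sum_parity (e : Fin n → ℕ) (he : Function.Injective e) (h2 : ∀ j, e j ≤ 2*n)
    (h : ∀ i j, e i + e j ≠ 2*n) : Even (∑ j, e j + ∑ i : Fin n, (i:ℕ)) := by
  have hlt : ∀ j, min (e j) (2*n - e j) < n := fun j => by
    have := h j j; have := h2 j; omega
  let φ : Fin n → Fin n := fun j => ⟨min (e j) (2*n - e j), hlt j⟩
  have hφ : Function.Injective φ := by
    intro i j hij
    have h3 : min (e i) (2*n - e i) = min (e j) (2*n - e j) := congrArg Fin.val hij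
    apply he
    have := h i j; have := h2 i; have := h2 j
    omega
  have hs : ∑ i : Fin n, (i:ℕ) = ∑ j, min (e j) (2*n - e j) :=
    ((Function.Bijective.sum_comp (Finite.injective_iff_bijective.1 hφ) (fun i : Fin n => (i:ℕ)))).symm
  rw [hs, ← Finset.sum_add_distrib]
  refine Finset.even_sum _ fun j _ => ?_
  have := h2 j
  rw [Nat.even_iff]
  omega

theorem form_low (p q : ℂ[X]) (i j : ℕ) (hij : i + j = 2*n) (hp : ∀ k < i, p.coeff k = 0) (hq : ∀ k < j, q.coeff k = 0)
    (hp0 : p.coeff i ≠ 0) (hq0 : q.coeff j ≠ 0) : form n p q ≠ 0 := by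
  rw [form, Finset.sum_eq_single i]
  · rw [show 2*n - i = j by omega]
    have := Nat.factorial_ne_zero i
    have := Nat.factorial_ne_zero j
    simp only [ne_eq, mul_eq_zero, pow_eq_zero_iff', Nat.cast_eq_zero, not_or]
    simp [*]
  · intro k hk hki
    rcases lt_or_gt_of_ne hki with h | h
    · rw [hp k h]; simp
    · rw [hq (2*n-k) (by rw [Finset.mem_range] at hk; omega)]; simp
  · intro h; rw [Finset.mem_range] at h; omega

/-- even vanishing order at zero for isotropic subspaces -/
theorem even_order (f : Fin n → ℂ[X]) (hd : ∀ v ∈ Submodule.span ℂ (Set.range f), v.natDegree ≤ 2*n)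
    (hiso : ∀ p ∈ Submodule.span ℂ (Set.range f), ∀ q ∈ Submodule.span ℂ (Set.range f), form n p q = 0)
    (hfr : Module.finrank ℂ (Submodule.span ℂ (Set.range f)) = n)
    (hw : wr f ≠ 0) : Even (wr f).natTrailingDegree := by
  have : FiniteDimensional ℂ (Submodule.span ℂ (Set.range f)) :=
    FiniteDimensional.span_of_finite ℂ (Set.finite_range f)
  obtain ⟨g, e, he, hspan, hg, -⟩ := echelon (fun k => lcoeff ℂ k) n (Submodule.span ℂ (Set.range f)) this hfr
    (by intro v _ hv; ext k; simpa using hv k)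
  simp only [lcoeff_apply] at hg
  have hmem : ∀ j, g j ∈ Submodule.span ℂ (Set.range f) := fun j => hspan ▸ Submodule.subset_span ⟨j, rfl⟩
  obtain ⟨c, hc, hcw⟩ := wr_span f g hspan.symm
  have hle : ∀ j, e j ≤ 2*n := fun j => (le_natDegree_of_ne_zero (hg j).2).trans (hd _ (hmem j))
  have hpar := sum_parity e he.injective hle fun i j hij =>
    form_low (g i) (g j) (e i) (e j) hij (hg i).1 (hg j).1 (hg i).2 (hg j).2 (hiso _ (hmem i) _ (hmem j))
  obtain ⟨h1, h2⟩ := wr_low g e fun j => X_pow_dvd_iff.2 (hg j).1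
  have hgw : wr g ≠ 0 := by rw [hcw]; exact mul_ne_zero (C_ne_zero.2 hc) hw
  have h3 : (X ^ (∑ i : Fin n, (i:ℕ)) * wr g).natTrailingDegree = ∑ j, e j := by
    apply le_antisymm
    · apply natTrailingDegree_le_of_ne_zero
      rw [h2]
      refine mul_ne_zero (Finset.prod_ne_zero_iff.2 fun j _ => (hg j).2) ?_
      exact_mod_cast vdm_ne_zero e he.injective
    · refine le_natTrailingDegree (mul_ne_zero (pow_ne_zero _ X_ne_zero) hgw) ?_
      rwa [X_pow_dvd_iff] at h1
  have h4 : (wr g).natTrailingDegree = (wr f).natTrailingDegree := by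
    rw [hcw, natTrailingDegree_mul (C_ne_zero.2 hc) hw, natTrailingDegree_C, zero_add]
  rw [natTrailingDegree_mul (pow_ne_zero _ X_ne_zero) hgw, natTrailingDegree_X_pow, h4] at h3
  rw [Nat.even_iff] at hpar ⊢
  omega

theorem square_of_even (W : ℂ[X]) (h0 : W ≠ 0) (h : ∀ a, Even (W.rootMultiplicity a)) :
    ∃ Q : ℂ[X], Q.Monic ∧ W = C W.leadingCoeff * Q ^ 2 := by
  refine ⟨∏ a ∈ W.roots.toFinset, (X - C a) ^ (W.rootMultiplicity a / 2), ?_, ?_⟩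
  · exact monic_prod_of_monic _ _ fun a _ => (monic_X_sub_C a).pow _
  · have h1 := (IsAlgClosed.splits W).eq_prod_roots
    rw [Finset.prod_multiset_map_count] at h1
    conv_lhs => rw [h1]
    rw [← Finset.prod_pow]
    congr 1
    refine Finset.prod_congr rfl fun a _ => ?_
    rw [← pow_mul, count_roots, Nat.div_mul_cancel (even_iff_two_dvd.1 (h a))]

theorem wr_square (f : Fin n → ℂ[X]) (hd : ∀ v ∈ Submodule.span ℂ (Set.range f), v.natDegree ≤ 2*n)
    (hiso : ∀ p ∈ Submodule.span ℂ (Set.range f), ∀ q ∈ Submodule.span ℂ (Set.range f), form n p q = 0)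
    (hfr : Module.finrank ℂ (Submodule.span ℂ (Set.range f)) = n)
    (hw : wr f ≠ 0) : ∃ Q : ℂ[X], Q.Monic ∧ wr f = C (wr f).leadingCoeff * Q ^ 2 := by
  refine square_of_even _ hw fun a => ?_
  rw [rootMultiplicity_eq_natTrailingDegree, ← wr_taylor]
  have hcomp : (X + C a : ℂ[X]) ≠ 0 := X_add_C_ne_zero a
  let T : ℂ[X] →ₗ[ℂ] ℂ[X] := taylor a
  have hT : ∀ p, T p = p.comp (X + C a) := fun p => rfl
  have hTinj : Function.Injective T := taylor_injective a
  have hsp : Submodule.span ℂ (Set.range fun j => (f j).comp (X + C a)) =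
      (Submodule.span ℂ (Set.range f)).map T := by
    rw [Submodule.map_span, ← Set.range_comp]
    congr 2
  apply even_order
  · rw [hsp]
    rintro _ ⟨v, hv, rfl⟩
    rw [hT, natDegree_comp, natDegree_X_add_C, mul_one]
    exact hd v hv
  · rw [hsp]
    rintro _ ⟨p, hp, rfl⟩ _ ⟨q, hq, rfl⟩
    rw [hT, hT, form_taylor a p q (hd p hp) (hd q hq)]
    exact hiso p hp q hq
  · rw [hsp, (Submodule.equivMapOfInjective T hTinj _).symm.finrank_eq, hfr]
  · rw [wr_taylor]
    intro h
    apply hw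
    apply taylor_injective a
    rw [taylor_apply, h, map_zero]

end YA
end OG
end PartYA

section PartYB
namespace OG

section YB
open Polynomial

variable {n : ℕ}

/-- the coefficients of the form -/
noncomputable def kap (n m : ℕ) : ℝ := (-1)^m * (m.factorial : ℝ) * ((2*n-m).factorial : ℝ)

theorem kap_ne (n m : ℕ) : kap n m ≠ 0 := by
  rw [kap]
  have := Nat.factorial_ne_zero m
  have := Nat.factorial_ne_zero (2*n-m)
  simp [*]

theorem kap_symm (n m : ℕ) (h : m ≤ 2*n) : kap n (2*n-m) = kap n m := by
  rw [kap, kap, show 2*n-(2*n-m) = m by omega]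
  have : (-1:ℝ)^(2*n-m) = (-1)^m := by
    rw [neg_one_pow_eq_pow_mod_two, neg_one_pow_eq_pow_mod_two (n := m)]
    congr 1; omega
  rw [this]; ring

theorem form_kap (p q : ℂ[X]) :
    form n p q = ∑ m ∈ Finset.range (2*n+1), (kap n m : ℂ) * (p.coeff m * q.coeff (2*n-m)) := by
  rw [form]
  refine Finset.sum_congr rfl fun m _ => ?_
  rw [kap]; push_cast; ring

theorem form_cell (A : Fin n → Fin (n+1) → ℂ) (i k : Fin n) :
    form n (cellP A i) (cellP A k) = kap n (n+1+i) * (cellP A k).coeff (n-1-i) +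
      kap n (n+1+k) * (cellP A i).coeff (n-1-k) + kap n n * ((cellP A i).coeff n * (cellP A k).coeff n) := by
  have hi := i.2
  have hk := k.2
  rw [form_kap, show 2*n+1 = (n+1)+n by ring, Finset.sum_range_add, Finset.sum_range_succ,
    show 2*n-n = n by omega]
  have h1 : ∑ m ∈ Finset.range n, (kap n m : ℂ) * ((cellP A i).coeff m * (cellP A k).coeff (2*n-m)) =
      kap n (n+1+k) * (cellP A i).coeff (n-1-k) := by
    rw [Finset.sum_eq_single (n-1-k)]
    · rw [cellP_coeff_high A k _ (by omega), if_pos (by omega), mul_one, ← kap_symm n (n-1-k) (by omega)]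
      rw [show 2*n-(n-1-k) = n+1+k by omega]
    · intro m hm hne
      rw [Finset.mem_range] at hm
      rw [cellP_coeff_high A k _ (by omega), if_neg (by omega)]; simp
    · intro h; exact absurd (Finset.mem_range.2 (by omega)) h
  have h2 : ∑ m ∈ Finset.range n, (kap n (n+1+m) : ℂ) * ((cellP A i).coeff (n+1+m) * (cellP A k).coeff (2*n-(n+1+m))) =
      kap n (n+1+i) * (cellP A k).coeff (n-1-i) := by
    rw [Finset.sum_eq_single (i:ℕ)]
    · rw [cellP_coeff_high A i _ (by omega), if_pos rfl, one_mul]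
      rw [show 2*n-(n+1+i) = n-1-i by omega]
    · intro m hm hne
      rw [cellP_coeff_high A i _ (by omega), if_neg (by omega)]; simp
    · intro h; exact absurd (Finset.mem_range.2 i.2) h
  rw [h1, h2]; ring

/-- index of the column `n-1-l` -/
def col (l : Fin n) : Fin (n+1) := ⟨n-1-l, by omega⟩

theorem form_cell' (A : Fin n → Fin (n+1) → ℂ) (i k : Fin n) :
    form n (cellP A i) (cellP A k) = kap n (n+1+i) * A k (col i) +
      kap n (n+1+k) * A i (col k) + kap n n * (A i (Fin.last n) * A k (Fin.last n)) := by
  rw [form_cell, ← cellP_coeff_low A k (col i), ← cellP_coeff_low A i (col k), ← cellP_coeff_low A i (Fin.last n),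
    ← cellP_coeff_low A k (Fin.last n)]
  rfl

theorem col_cases (j : Fin (n+1)) : j = Fin.last n ∨ ∃ l : Fin n, j = col l := by
  by_cases h : (j:ℕ) = n
  · left; exact Fin.ext h
  · right
    have := j.2
    refine ⟨⟨n-1-j, by omega⟩, Fin.ext ?_⟩
    simp only [col]; omega

theorem col_ne (l : Fin n) : col l ≠ Fin.last n := by
  intro h
  have h1 := congrArg Fin.val h
  have h2 := l.2
  simp only [col, Fin.val_last] at h1
  omega

/-- index set of the coordinates on the cell of the orthogonal Grassmannian -/
abbrev YI (n : ℕ) : Type := Σ k : Fin n, Fin ((k:ℕ)+1)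

variable {S : Type*}

/-- coordinates, indexed by pairs `i ≤ k` -/
def co (x : YI n → S) (k i : Fin n) (h : i ≤ k) : S := x ⟨k, ⟨i, Nat.lt_succ_of_le h⟩⟩

section
variable [CommRing S] [Algebra ℝ S]

/-- The parametrisation of isotropic points. -/
noncomputable def paramA (x : YI n → S) (i : Fin n) (j : Fin (n+1)) : S :=
  if hj : (j:ℕ) = n then co x i i le_rfl
  else
    if h : (i:ℕ) < n-1-j then co x ⟨n-1-j, by omega⟩ i (by rw [Fin.le_def]; exact h.le)
    else if h2 : (i:ℕ) = n-1-j then algebraMap ℝ S (-kap n n / (2 * kap n (n+1+i))) * co x i i le_rfl ^ 2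
    else algebraMap ℝ S (-kap n (n+1+i) / kap n (n+1+(n-1-j))) *
        co x i ⟨n-1-j, by omega⟩ (by rw [Fin.le_def]; show n-1-(j:ℕ) ≤ i; omega) +
      algebraMap ℝ S (-kap n n / kap n (n+1+(n-1-j))) *
        (co x i i le_rfl * co x ⟨n-1-j, by omega⟩ ⟨n-1-j, by omega⟩ le_rfl)

theorem paramA_last (x : YI n → S) (i : Fin n) : paramA x i (Fin.last n) = co x i i le_rfl := by
  rw [paramA, dif_pos (Fin.val_last n)]

theorem col_val (l : Fin n) : n - 1 - (col l : ℕ) = l := by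
  have := l.2
  simp only [col]; omega

theorem col_val_ne (l : Fin n) : ¬ (col l : ℕ) = n := by
  have := l.2
  simp only [col]; omega

theorem paramA_lt (x : YI n → S) (i l : Fin n) (h : i < l) : paramA x i (col l) = co x l i h.le := by
  have hl := col_val l
  rw [paramA, dif_neg (col_val_ne l), dif_pos (by rw [hl]; exact h)]
  congr 1
  exact Fin.ext hl

theorem paramA_eq (x : YI n → S) (i : Fin n) : paramA x i (col i) =
    algebraMap ℝ S (-kap n n / (2 * kap n (n+1+i))) * co x i i le_rfl ^ 2 := by
  have hl := col_val i
  rw [paramA, dif_neg (col_val_ne i), dif_neg (by rw [hl]; exact lt_irrefl _), dif_pos (by rw [hl])]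

theorem paramA_gt (x : YI n → S) (i l : Fin n) (h : l < i) : paramA x i (col l) =
    algebraMap ℝ S (-kap n (n+1+i) / kap n (n+1+l)) * co x i l h.le +
      algebraMap ℝ S (-kap n n / kap n (n+1+l)) * (co x i i le_rfl * co x l l le_rfl) := by
  have hl := col_val l
  have h' : (l:ℕ) < i := h
  rw [paramA, dif_neg (col_val_ne l), dif_neg (by rw [hl]; omega), dif_neg (by rw [hl]; omega)]
  have e : (⟨n - 1 - (col l : ℕ), by have := l.2; omega⟩ : Fin n) = l := Fin.ext hl
  simp only [hl]

theorem paramA_map {S' : Type*} [CommRing S'] [Algebra ℝ S'] (φ : S →ₐ[ℝ] S') (x : YI n → S) (i : Fin n)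
    (j : Fin (n+1)) : φ (paramA x i j) = paramA (fun s => φ (x s)) i j := by
  rcases col_cases j with rfl | ⟨l, rfl⟩
  · rw [paramA_last, paramA_last]; rfl
  · rcases lt_trichotomy i l with h | rfl | h
    · rw [paramA_lt _ _ _ h, paramA_lt _ _ _ h]; rfl
    · rw [paramA_eq, paramA_eq, map_mul, map_pow, AlgHom.commutes]; rfl
    · rw [paramA_gt _ _ _ h, paramA_gt _ _ _ h, map_add, map_mul, map_mul, map_mul, AlgHom.commutes,
        AlgHom.commutes]; rfl

/-- weights -/
def wY (s : YI n) : ℕ := if (s.2:ℕ) = s.1 then (s.1:ℕ) + 1 else (s.2:ℕ) + s.1 + 2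

theorem co_scale (x : YI n → ℝ) (k i : Fin n) (h : i < k) :
    co (fun s => (2:ℝ) ^ wY s * x s) k i h.le = 2 ^ ((i:ℕ)+k+2) * co x k i h.le := by
  have h' : (i:ℕ) < k := h
  rw [co, co, wY, if_neg (by simp only; omega)]

theorem co_scale_eq (x : YI n → ℝ) (k : Fin n) :
    co (fun s => (2:ℝ) ^ wY s * x s) k k le_rfl = 2 ^ ((k:ℕ)+1) * co x k k le_rfl := by
  rw [co, co, wY, if_pos rfl]

theorem paramA_scale (x : YI n → ℝ) (i : Fin n) (j : Fin (n+1)) :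
    paramA (fun s => (2:ℝ) ^ wY s * x s) i j = 2 ^ (n+1+(i:ℕ)-(j:ℕ)) * paramA x i j := by
  rcases col_cases j with rfl | ⟨l, rfl⟩
  · rw [paramA_last, paramA_last, co_scale_eq, Fin.val_last]
    congr 2; omega
  · have e : n+1+(i:ℕ)-(col l : ℕ) = i + l + 2 := by have := l.2; simp only [col]; omega
    rw [e]
    rcases lt_trichotomy i l with h | rfl | h
    · rw [paramA_lt _ _ _ h, paramA_lt _ _ _ h, co_scale _ _ _ h]
    · rw [paramA_eq, paramA_eq, co_scale_eq]; ring
    · rw [paramA_gt _ _ _ h, paramA_gt _ _ _ h, co_scale _ _ _ h, co_scale_eq, co_scale_eq]; ring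

end

/-- reading off the coordinates -/
def getY (A : Fin n → Fin (n+1) → S) (s : YI n) : S :=
  if (s.2:ℕ) = s.1 then A s.1 (Fin.last n) else A ⟨s.2, by have := s.2.2; have := s.1.2; omega⟩ (col s.1)

theorem co_getY (A : Fin n → Fin (n+1) → S) (k i : Fin n) (h : i < k) : co (getY A) k i h.le = A i (col k) := by
  have h' : (i:ℕ) < k := h
  rw [co, getY, if_neg (by simp only; omega)]

theorem co_getY_eq (A : Fin n → Fin (n+1) → S) (k : Fin n) : co (getY A) k k le_rfl = A k (Fin.last n) := by
  rw [co, getY, if_pos rfl]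

theorem YI_cases (s : YI n) : ∃ (k i : Fin n) (h : i ≤ k), s = ⟨k, ⟨i, Nat.lt_succ_of_le h⟩⟩ := by
  obtain ⟨k, i⟩ := s
  exact ⟨k, ⟨i, by have := i.2; have := k.2; omega⟩, by rw [Fin.le_def]; exact Nat.le_of_lt_succ i.2, rfl⟩

theorem getY_paramA [CommRing S] [Algebra ℝ S] (x : YI n → S) : getY (paramA x) = x := by
  funext s
  obtain ⟨k, i, h, rfl⟩ := YI_cases s
  change co (getY (paramA x)) k i h = co x k i h
  rcases h.lt_or_eq with h1 | rfl
  · rw [co_getY _ _ _ h1, paramA_lt _ _ _ h1]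
  · rw [co_getY_eq, paramA_last]

theorem kapC (n m : ℕ) : (kap n m : ℂ) ≠ 0 := by exact_mod_cast kap_ne n m

theorem param_iso (x : YI n → ℂ) (i k : Fin n) : form n (cellP (paramA x) i) (cellP (paramA x) k) = 0 := by
  have main : ∀ i k : Fin n, i < k → kap n (n+1+i) * paramA x k (col i) + kap n (n+1+k) * paramA x i (col k) +
      kap n n * (paramA x i (Fin.last n) * paramA x k (Fin.last n)) = 0 := by
    intro i k h
    rw [paramA_lt _ _ _ h, paramA_gt _ _ _ h, paramA_last, paramA_last]
    have h1 := kapC n (n+1+i)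
    simp only [Complex.coe_algebraMap]
    push_cast
    field_simp
    ring
  rw [form_cell']
  rcases lt_trichotomy i k with h | rfl | h
  · exact main i k h
  · rw [paramA_eq, paramA_last]
    have h1 := kapC n (n+1+i)
    simp only [Complex.coe_algebraMap]
    push_cast
    field_simp
    ring
  · rw [← main k i h]; ring

theorem iso_param (A : Fin n → Fin (n+1) → ℂ) (h : ∀ i k, form n (cellP A i) (cellP A k) = 0) :
    A = paramA (getY A) := by
  funext i j
  rcases col_cases j with rfl | ⟨l, rfl⟩
  · rw [paramA_last, co_getY_eq]
  · rcases lt_trichotomy i l with h1 | rfl | h1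
    · rw [paramA_lt _ _ _ h1, co_getY _ _ _ h1]
    · rw [paramA_eq, co_getY_eq]
      have h2 := h i i
      rw [form_cell'] at h2
      have h3 := kapC n (n+1+i)
      simp only [Complex.coe_algebraMap]
      push_cast
      field_simp
      linear_combination h2
    · rw [paramA_gt _ _ _ h1, co_getY _ _ _ h1, co_getY_eq, co_getY_eq]
      have h2 := h i l
      rw [form_cell'] at h2
      have h3 := kapC n (n+1+l)
      simp only [Complex.coe_algebraMap]
      push_cast
      field_simp
      linear_combination h2

end YB
end OG
end PartYB

section PartYC
namespace OG

section YC
open Polynomial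

variable {n : ℕ}

theorem form_add_left (p p' q : ℂ[X]) : form n (p + p') q = form n p q + form n p' q := by
  simp only [form, coeff_add, ← Finset.sum_add_distrib]
  exact Finset.sum_congr rfl fun _ _ => by ring
theorem form_add_right (p q q' : ℂ[X]) : form n p (q + q') = form n p q + form n p q' := by
  simp only [form, coeff_add, ← Finset.sum_add_distrib]
  exact Finset.sum_congr rfl fun _ _ => by ring
theorem form_smul_left (c : ℂ) (p q : ℂ[X]) : form n (c • p) q = c * form n p q := by
  simp only [form, coeff_smul, Finset.mul_sum, smul_eq_mul]
  exact Finset.sum_congr rfl fun _ _ => by ring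
theorem form_smul_right (c : ℂ) (p q : ℂ[X]) : form n p (c • q) = c * form n p q := by
  simp only [form, coeff_smul, Finset.mul_sum, smul_eq_mul]
  exact Finset.sum_congr rfl fun _ _ => by ring
theorem form_zero_left (q : ℂ[X]) : form n 0 q = 0 := by simp [form]
theorem form_zero_right (p : ℂ[X]) : form n p 0 = 0 := by simp [form]

theorem span_iso (f : Fin n → ℂ[X]) (h : ∀ i k, form n (f i) (f k) = 0) :
    ∀ p ∈ Submodule.span ℂ (Set.range f), ∀ q ∈ Submodule.span ℂ (Set.range f), form n p q = 0 := by
  intro p hp q hq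
  induction hp using Submodule.span_induction with
  | zero => exact form_zero_left q
  | add x y _ _ hx hy => rw [form_add_left, hx, hy, add_zero]
  | smul c x _ hx => rw [form_smul_left, hx, mul_zero]
  | mem x hx =>
    obtain ⟨i, rfl⟩ := hx
    induction hq using Submodule.span_induction with
    | zero => exact form_zero_right _
    | add x y _ _ hx hy => rw [form_add_right, hx, hy, add_zero]
    | smul c x _ hx => rw [form_smul_right, hx, mul_zero]
    | mem y hy => obtain ⟨k, rfl⟩ := hy; exact h i k

theorem cell_comb_coeff (A : Fin n → Fin (n+1) → ℂ) (c : Fin n → ℂ) (k : Fin n) :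
    (∑ i, c i • cellP A i).coeff (n+1+k) = c k := by
  rw [finset_sum_coeff, Finset.sum_eq_single k]
  · rw [coeff_smul, cellP_coeff_high _ _ _ (by omega), if_pos rfl]; simp
  · intro i _ hi
    rw [coeff_smul, cellP_coeff_high _ _ _ (by omega), if_neg (by intro h; exact hi (Fin.ext (by omega)))]; simp
  · simp

theorem cell_li (A : Fin n → Fin (n+1) → ℂ) : LinearIndependent ℂ (cellP A) := by
  rw [Fintype.linearIndependent_iff]
  intro c hc k
  rw [← cell_comb_coeff A c k, hc, coeff_zero]

theorem cell_grass (A : Fin n → Fin (n+1) → ℂ) : IsGrassPt n (Submodule.span ℂ (Set.range (cellP A))) := by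
  constructor
  · rw [Submodule.span_le]
    rintro _ ⟨i, rfl⟩
    rw [SetLike.mem_coe, mem_degreeLT]
    refine degree_le_natDegree.trans_lt ?_
    have := cellP_natDegree_le A i
    have := i.2
    exact_mod_cast (by omega : (cellP A i).natDegree < 2*n+1)
  · rw [finrank_span_eq_card (cell_li A), Fintype.card_fin]

theorem cell_inj (A A' : Fin n → Fin (n+1) → ℂ)
    (h : Submodule.span ℂ (Set.range (cellP A)) = Submodule.span ℂ (Set.range (cellP A'))) : A = A' := by
  have key : ∀ i, cellP A i = cellP A' i := by
    intro i
    have h1 : cellP A i ∈ Submodule.span ℂ (Set.range (cellP A')) := h ▸ Submodule.subset_span ⟨i, rfl⟩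
    obtain ⟨c, hc⟩ := (Submodule.mem_span_range_iff_exists_fun ℂ).1 h1
    have h2 : ∀ k, c k = if k = i then 1 else 0 := by
      intro k
      rw [← cell_comb_coeff A' c k, hc, cellP_coeff_high _ _ _ (by omega)]
      congr 1
      rw [Fin.ext_iff]
      exact propext ⟨fun h => by omega, fun h => by omega⟩
    rw [← hc]
    simp [h2]
  funext i j
  rw [← cellP_coeff_low A i j, key, cellP_coeff_low]

theorem natDegree_span (x : Submodule ℂ ℂ[X]) (hx : IsGrassPt n x) (v : ℂ[X]) (hv : v ∈ x) : v.natDegree ≤ 2*n := by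
  have h1 := mem_degreeLT.1 (hx.1 hv)
  by_cases h0 : v = 0
  · simp [h0]
  · rw [degree_eq_natDegree h0] at h1
    have : v.natDegree < 2*n+1 := by exact_mod_cast h1
    omega

theorem half_double (n : ℕ) : n * (n+1) / 2 + n * (n+1) / 2 = n * (n+1) := by
  have := Nat.even_mul_succ_self n
  rw [Nat.even_iff] at this
  omega

theorem wr_cell_lead (A : Fin n → Fin (n+1) → ℂ) : wr (cellP A) ≠ 0 ∧ (wr (cellP A)).natDegree = n*(n+1) ∧
    (wr (cellP A)).leadingCoeff = cW n := by
  have h1 := (wr_cell A).1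
  have h2 := (wr_cell A).2
  have h3 : (wr (cellP A)).coeff (n*(n+1)) ≠ 0 := by rw [h2]; exact cW_neC n
  have h4 : (wr (cellP A)).natDegree = n*(n+1) := le_antisymm h1 (le_natDegree_of_ne_zero h3)
  refine ⟨?_, h4, ?_⟩
  · intro h; rw [h] at h3; simp at h3
  · rw [leadingCoeff, h4, h2]

theorem param_square (x : YI n → ℂ) : ∃ Q : ℂ[X], Q.Monic ∧ Q.natDegree = n*(n+1)/2 ∧
    wr (cellP (paramA x)) = C (cW n : ℂ) * Q ^ 2 := by
  obtain ⟨h0, h1, h2⟩ := wr_cell_lead (paramA x)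
  obtain ⟨Q, hQ, hW⟩ := wr_square (cellP (paramA x)) (natDegree_span _ (cell_grass _))
    (span_iso _ (param_iso x)) (cell_grass _).2 h0
  rw [h2] at hW
  refine ⟨Q, hQ, ?_, hW⟩
  have := h1
  rw [hW, natDegree_C_mul (cW_neC n), hQ.natDegree_pow] at this
  omega

theorem sq_unique {m : ℕ} (Q B : ℂ[X]) (hQ : Q.Monic) (hB : B.Monic) (dQ : Q.natDegree = m) (dB : B.natDegree = m)
    (h : ∀ k, m ≤ k → (Q^2).coeff k = (B^2).coeff k) : Q = B := by
  by_contra hne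
  have h1 : Q - B ≠ 0 := sub_ne_zero.2 hne
  have h2 : (Q + B).coeff m = 2 := by
    rw [coeff_add]
    have e1 := hQ.coeff_natDegree
    have e2 := hB.coeff_natDegree
    rw [dQ] at e1
    rw [dB] at e2
    rw [e1, e2]; norm_num
  have h3 : m ≤ (Q + B).natDegree := le_natDegree_of_ne_zero (by rw [h2]; norm_num)
  have h4 : Q + B ≠ 0 := by intro h; rw [h] at h2; simp at h2
  have h5 := natDegree_mul h1 h4
  have h6 : ((Q - B) * (Q + B)).coeff ((Q - B) * (Q + B)).natDegree ≠ 0 :=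
    leadingCoeff_ne_zero.2 (mul_ne_zero h1 h4)
  apply h6
  have : (Q - B) * (Q + B) = Q^2 - B^2 := by ring
  rw [this, coeff_sub, ← this, h _ (by omega), sub_self]

theorem top_match (x : YI n → ℂ) (B : ℂ[X]) (hB : B.Monic) (dB : B.natDegree = n*(n+1)/2)
    (h : ∀ t, t < n*(n+1)/2 → (cW n : ℂ)⁻¹ * (wr (cellP (paramA x))).coeff (n*(n+1)-1-t) = (B^2).coeff (n*(n+1)-1-t)) :
    wr (cellP (paramA x)) = C (cW n : ℂ) * B^2 := by
  obtain ⟨Q, hQ, dQ, hW⟩ := param_square x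
  have hd := half_double n
  rw [hW]
  rw [hW] at h
  rw [sq_unique Q B hQ hB dQ dB]
  intro k hk
  rcases lt_trichotomy k (n*(n+1)) with hk2 | hk2 | hk2
  · have := h (n*(n+1)-1-k) (by omega)
    rw [coeff_C_mul, inv_mul_cancel_left₀ (cW_neC n), show n*(n+1)-1-(n*(n+1)-1-k) = k by omega] at this
    exact this
  · have e1 := (hQ.pow 2).coeff_natDegree
    have e2 := (hB.pow 2).coeff_natDegree
    rw [hQ.natDegree_pow, dQ, show 2 * (n*(n+1)/2) = k by omega] at e1
    rw [hB.natDegree_pow, dB, show 2 * (n*(n+1)/2) = k by omega] at e2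
    rw [e1, e2]
  · rw [coeff_eq_zero_of_natDegree_lt, coeff_eq_zero_of_natDegree_lt]
    · rw [hB.natDegree_pow, dB]; omega
    · rw [hQ.natDegree_pow, dQ]; omega

theorem card_YI (n : ℕ) : Fintype.card (YI n) = n*(n+1)/2 := by
  rw [Fintype.card_sigma]
  simp only [Fintype.card_fin]
  rw [Fin.sum_univ_eq_sum_range (fun i => i+1) n]
  have h1 : (∑ i ∈ Finset.range n, (i+1)) * 2 = n * (n+1) := by
    clear * -
    induction n with
    | zero => simp
    | succ k ih => rw [Finset.sum_range_succ, add_mul, ih]; ring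
  omega

theorem paramA_zero (n : ℕ) (x : YI n → ℂ) (h : paramA x = 0) : x = 0 := by
  rw [← getY_paramA x, h]
  funext s
  simp [getY]

/-- The Wronski map on the big cell of the orthogonal Grassmannian -/
noncomputable def WrY (n : ℕ) : PMap (YI n) (Fin (n*(n+1)/2)) where
  f t := coefP (paramA MvPolynomial.X) (n*(n+1)-1-t)
  w := wY
  d t := t + 1
  hw s := by rw [wY]; split_ifs <;> omega
  hd t := by omega
  hom t := by
    have h1 := coefP_hom (n := n) (paramA MvPolynomial.X) wY (by
      intro x i j
      have e : ∀ y : YI n → ℝ, MvPolynomial.eval y (paramA MvPolynomial.X i j) = paramA y i j := by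
        intro y
        have := paramA_map (MvPolynomial.aeval y : MvPolynomial (YI n) ℝ →ₐ[ℝ] ℝ) MvPolynomial.X i j
        simp only [MvPolynomial.aeval_X] at this
        rw [← this]; rfl
      rw [e, e, paramA_scale]) (n*(n+1)-1-t) (by omega)
    convert h1 using 1
    have := t.2
    have := half_double n
    omega
  zero x h := by
    have h1 := top_match x (X ^ (n*(n+1)/2)) (monic_X_pow _) (natDegree_X_pow _) (by
      intro t ht
      have := h ⟨t, ht⟩
      rw [coefP_aeval] at this
      simp only [paramA_map, MvPolynomial.aeval_X] at this
      have hd := half_double n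
      rw [this, ← pow_mul, coeff_X_pow, if_neg (by omega)])
    have hd := half_double n
    rw [← pow_mul, show n*(n+1)/2*2 = n*(n+1) by omega] at h1
    exact paramA_zero n x (cell_zero _ _ (cW_neC n) h1)
  card := by rw [card_YI, Fintype.card_fin]

/-- base polynomial -/
noncomputable def Bp {m : ℕ} (b : Fin m → ℝ) : ℝ[X] := ∏ i, (X + C (b i))

/-- parameter map -/
noncomputable def PsiY (n : ℕ) (b : Fin (n*(n+1)/2) → ℝ) (t : Fin (n*(n+1)/2)) : ℝ :=
  ((Bp b)^2).coeff (n*(n+1)-1-t)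

theorem Bp_monic {m : ℕ} (b : Fin m → ℝ) : (Bp b).Monic := monic_prod_of_monic _ _ fun i _ => monic_X_add_C _
theorem Bp_natDegree {m : ℕ} (b : Fin m → ℝ) : (Bp b).natDegree = m := by
  rw [Bp, natDegree_prod_of_monic _ _ fun i _ => monic_X_add_C _]
  simp

theorem mem_fiberY (b : Fin (n*(n+1)/2) → ℝ) (x : YI n → ℂ) :
    x ∈ (WrY n).fiber (PsiY n b) ↔ wr (cellP (paramA x)) = C (cW n : ℂ) * ((Bp b).map Complex.ofRealHom)^2 := by
  have e : ∀ k, (((Bp b)^2).coeff k : ℂ) = (((Bp b).map Complex.ofRealHom)^2).coeff k := by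
    intro k
    rw [← Polynomial.map_pow, coeff_map]; rfl
  constructor
  · intro h
    refine top_match x _ ((Bp_monic b).map _) (by rw [(Bp_monic b).natDegree_map, Bp_natDegree]) ?_
    intro t ht
    have := h ⟨t, ht⟩
    simp only [WrY, PsiY] at this
    rw [coefP_aeval] at this
    simp only [paramA_map, MvPolynomial.aeval_X] at this
    rw [this, e]
  · intro h t
    simp only [WrY, PsiY]
    rw [coefP_aeval]
    simp only [paramA_map, MvPolynomial.aeval_X]
    rw [h, e, coeff_C_mul, inv_mul_cancel_left₀ (cW_neC n)]

theorem real_Y (b : Fin (n*(n+1)/2) → ℝ) : (WrY n).RealAt (PsiY n b) := by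
  intro x hx s
  rw [mem_fiberY] at hx
  let ee : Fin (n*(n+1)/2) ⊕ Fin (n*(n+1)/2) ≃ Fin (n*(n+1)) := finSumFinEquiv.trans (finCongr (half_double n))
  let a : Fin (n*(n+1)) → ℝ := fun l => Sum.elim (fun i => -b i) (fun i => -b i) (ee.symm l)
  have hprod : ∏ l, (X - C (a l : ℂ)) = ((Bp b).map Complex.ofRealHom)^2 := by
    rw [← ee.prod_comp, Fintype.prod_sum_type, Bp, Polynomial.map_prod, sq]
    simp [a]
  have key := cell_real (paramA x) a (by rw [hx, hprod])
  rw [← getY_paramA x, getY]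
  split_ifs
  · exact key _ _
  · exact key _ _

end YC
end OG
end PartYC

section PartYD
namespace OG

section YD
open Polynomial

theorem lagK {K ι : Type*} [Field K] [DecidableEq ι] (s : Finset ι) (a : ι → K) (ha : Set.InjOn a s) (P : K[X])
    (hP : P.degree < s.card) :
    P = ∑ j ∈ s, C (P.eval (a j) / ∏ l ∈ s.erase j, (a j - a l)) * ∏ l ∈ s.erase j, (X - C (a l)) := by
  classical
  refine Polynomial.eq_of_degrees_lt_of_eval_finset_eq (s.image a) ?_ ?_ ?_
  · rwa [Finset.card_image_of_injOn ha]
  · rw [Finset.card_image_of_injOn ha]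
    refine (degree_sum_le _ _).trans_lt ?_
    rw [Finset.sup_lt_iff (by exact WithBot.bot_lt_coe _)]
    intro j hj
    have hN : 0 < s.card := Finset.card_pos.2 ⟨j, hj⟩
    rw [← smul_eq_C_mul]
    refine (degree_smul_le _ _).trans_lt ?_
    rw [degree_prod]
    simp only [degree_X_sub_C, Finset.sum_const, Finset.card_erase_of_mem hj, nsmul_eq_mul, mul_one]
    exact_mod_cast Nat.sub_lt hN one_pos
  · intro z hz
    obtain ⟨i, hi, rfl⟩ := Finset.mem_image.1 hz
    rw [eval_finset_sum, Finset.sum_eq_single i]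
    · rw [eval_mul, eval_C, eval_prod]
      simp only [eval_sub, eval_X, eval_C]
      rw [div_mul_cancel₀]
      refine Finset.prod_ne_zero_iff.2 fun l hl => ?_
      have h2 := Finset.mem_erase.1 hl
      exact sub_ne_zero.2 fun h => h2.1 (ha h2.2 hi h.symm)
    · intro j _ hj
      have h0 : ∏ l ∈ s.erase j, eval (a i) (X - C (a l)) = 0 :=
        Finset.prod_eq_zero (Finset.mem_erase.2 ⟨Ne.symm hj, hi⟩) (by simp)
      rw [eval_mul, eval_prod, h0, mul_zero]
    · intro h; exact absurd hi h

theorem lagK_coeff {K ι : Type*} [Field K] [DecidableEq ι] (s : Finset ι) (a : ι → K) (ha : Set.InjOn a s) (P : K[X])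
    (hP : P.degree < s.card) :
    P.coeff (s.card - 1) = ∑ j ∈ s, P.eval (a j) / ∏ l ∈ s.erase j, (a j - a l) := by
  conv_lhs => rw [lagK s a ha P hP]
  rw [finset_sum_coeff]
  refine Finset.sum_congr rfl fun j hj => ?_
  have hm : (∏ l ∈ s.erase j, (X - C (a l))).Monic := monic_prod_of_monic _ _ fun i _ => monic_X_sub_C _
  have hd : (∏ l ∈ s.erase j, (X - C (a l))).natDegree = s.card - 1 := by
    rw [natDegree_prod_of_monic _ _ fun i _ => monic_X_sub_C _]
    simp [Finset.card_erase_of_mem hj]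
  rw [coeff_C_mul, ← hd, hm.coeff_natDegree, mul_one]

/-- coefficientwise derivative at 0 -/
def HD (P : ℝ → ℝ[X]) (P' : ℝ[X]) : Prop := ∀ k, HasDerivAt (fun s => (P s).coeff k) (P'.coeff k) 0

theorem HD.mul {P Q : ℝ → ℝ[X]} {P' Q' : ℝ[X]} (hP : HD P P') (hQ : HD Q Q') :
    HD (fun s => P s * Q s) (P' * Q 0 + P 0 * Q') := by
  intro k
  simp only [coeff_add, coeff_mul, ← Finset.sum_add_distrib]
  exact HasDerivAt.fun_sum fun i _ => (hP i.1).mul (hQ i.2)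

theorem HD.prod {ι : Type*} [DecidableEq ι] (S : Finset ι) (P : ι → ℝ → ℝ[X]) (P' : ι → ℝ[X])
    (h : ∀ i ∈ S, HD (P i) (P' i)) :
    HD (fun s => ∏ i ∈ S, P i s) (∑ i ∈ S, P' i * ∏ j ∈ S.erase i, P j 0) := by
  induction S using Finset.induction_on with
  | empty => intro k; simpa using hasDerivAt_const _ _
  | insert a S ha ih =>
    have h1 := (h a (Finset.mem_insert_self _ _)).mul (ih fun i hi => h i (Finset.mem_insert_of_mem hi))
    simp only [Finset.prod_insert ha]
    rw [Finset.sum_insert ha, Finset.erase_insert ha]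
    convert h1 using 2
    rw [Finset.mul_sum]
    refine Finset.sum_congr rfl fun i hi => ?_
    have hia : i ≠ a := fun h => ha (h ▸ hi)
    rw [Finset.erase_insert_of_ne hia.symm, Finset.prod_insert (fun h => ha (Finset.mem_of_mem_erase h))]
    ring

theorem HD_Bp {m : ℕ} (b β : Fin m → ℝ) :
    HD (fun s => Bp (b + s • β)) (∑ i, C (β i) * ∏ j ∈ Finset.univ.erase i, (X + C (b j))) := by
  have := HD.prod Finset.univ (fun i s => X + C (b i + s * β i)) (fun i => C (β i)) (by
    intro i _ k
    simp only [coeff_add, coeff_C]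
    by_cases hk : k = 0
    · simp only [hk, if_true]
      have := (((hasDerivAt_id (0:ℝ)).mul_const (β i)).const_add (b i)).const_add ((X:ℝ[X]).coeff 0)
      simpa using this
    · simp only [hk, if_false]
      exact hasDerivAt_const _ _)
  simpa [Bp] using this

theorem HD_sq {m : ℕ} (b β : Fin m → ℝ) (G : ℝ[X])
    (hG : G = ∑ i, C (β i) * ∏ j ∈ Finset.univ.erase i, (X + C (b j))) :
    HD (fun s => (Bp (b + s • β))^2) (C 2 * (Bp b * G)) := by
  have := (HD_Bp b β).mul (HD_Bp b β)
  simp only [← sq, zero_smul, add_zero, ← hG] at this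
  convert this using 1
  rw [show (C 2 : ℝ[X]) = 2 by rfl]
  ring

theorem exists_beta {m : ℕ} (b : Fin m → ℝ) (hb : Function.Injective b) (G : ℝ[X]) (hG : G.degree < m) :
    ∃ β : Fin m → ℝ, G = ∑ i, C (β i) * ∏ j ∈ Finset.univ.erase i, (X + C (b j)) := by
  have := lagK Finset.univ (fun i => - b i) (fun i _ j _ h => hb (neg_injective h)) G (by simpa using hG)
  simp only [map_neg, sub_neg_eq_add X] at this
  exact ⟨_, this⟩

theorem hdiff_Y (n : ℕ) (b β : Fin (n*(n+1)/2) → ℝ) (t) :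
    DifferentiableAt ℝ (fun s : ℝ => PsiY n (b + s • β) t) 0 :=
  (HD_sq b β _ rfl _).differentiableAt

theorem hnd_Y (n : ℕ) (b : Fin (n*(n+1)/2) → ℝ) (hb : Function.Injective b) (ξ : Fin (n*(n+1)/2) → ℝ) (hξ : ξ ≠ 0) :
    ∃ β, deriv (fun s:ℝ => ∑ t, ξ t * PsiY n (b + s • β) t) 0 ≠ 0 := by
  have hd := half_double n
  obtain ⟨t1, ht1⟩ := Function.ne_iff.1 hξ
  obtain ⟨t0, h0, hmax⟩ := Finset.exists_max_image (Finset.univ.filter fun t => ξ t ≠ 0) id ⟨t1, by simpa using ht1⟩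
  have h0' : ξ t0 ≠ 0 := by simpa using h0
  have hz : ∀ t, t0 < t → ξ t = 0 := by
    intro t ht
    by_contra hc
    exact absurd (hmax t (by simpa using hc)) (not_le.2 ht)
  have ht0 := t0.2
  obtain ⟨β, hβ⟩ := exists_beta b hb (X^(n*(n+1)/2 - 1 - t0)) (by
    rw [degree_X_pow]; exact_mod_cast (by omega))
  refine ⟨β, ?_⟩
  have h1 : HasDerivAt (fun s:ℝ => ∑ t, ξ t * PsiY n (b + s • β) t)
      (∑ t, ξ t * (C 2 * (Bp b * X^(n*(n+1)/2 - 1 - t0))).coeff (n*(n+1)-1-t)) 0 :=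
    HasDerivAt.fun_sum fun t _ => (HD_sq b β _ hβ _).const_mul _
  rw [h1.deriv, Finset.sum_eq_single t0]
  · rw [coeff_C_mul, show n*(n+1)-1-(t0:ℕ) = (n*(n+1)/2) + (n*(n+1)/2 - 1 - t0) by omega, coeff_mul_X_pow]
    have := (Bp_monic b).coeff_natDegree
    rw [Bp_natDegree] at this
    rw [this]
    simpa using h0'
  · intro t _ ht
    rcases lt_or_gt_of_ne ht with h | h
    · have hlt : (t:ℕ) < t0 := h
      rw [coeff_C_mul, coeff_eq_zero_of_natDegree_lt, mul_zero, mul_zero]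
      rw [natDegree_mul_X_pow _ (Bp_monic b).ne_zero, Bp_natDegree]
      omega
    · rw [hz t h, zero_mul]
  · simp

theorem count_Y (n : ℕ) (b : Fin (n*(n+1)/2) → ℝ) (hb : Function.Injective b) :
    ((WrY n).fiber (PsiY n b)).ncard * ∏ s : YI n, wY s = (n*(n+1)/2).factorial := by
  have h := (WrY n).count (PsiY n) (real_Y) b (hdiff_Y n b) (hnd_Y n b hb)
  have h2 : ∏ t, (WrY n).d t = (n*(n+1)/2).factorial := by
    simp only [WrY]
    rw [Fin.prod_univ_eq_prod_range (fun i => i+1), Finset.prod_range_add_one_eq_factorial]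
  rw [← h2, ← h]
  rfl

theorem prod_wY (n : ℕ) : ∏ s : YI n, wY s =
    ∏ k ∈ Finset.range n, ((k+1) * ∏ i ∈ Finset.range k, (i + k + 2)) := by
  rw [Fintype.prod_sigma, ← Fin.prod_univ_eq_prod_range (fun k => (k+1) * ∏ i ∈ Finset.range k, (i + k + 2))]
  refine Finset.prod_congr rfl fun k _ => ?_
  rw [Fin.prod_univ_castSucc, mul_comm]
  congr 1
  · simp [wY]
  · rw [← Fin.prod_univ_eq_prod_range (fun i => i + (k:ℕ) + 2)]
    refine Finset.prod_congr rfl fun i _ => ?_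
    have := i.2
    rw [wY, if_neg]
    · simp
    · simp; omega

end YD
end OG
end PartYD

section PartYE
namespace OG

section YE
open Polynomial OnePoint

variable {n : ℕ}

theorem fibrePoly_eq {m : ℕ} (b : Fin m → ℝ) :
    fibrePoly ((Finset.univ.val.map fun i => ((b i : ℝ) : OnePoint ℝ)) +
      (Finset.univ.val.map fun i => ((b i : ℝ) : OnePoint ℝ))) = ((Bp b).map Complex.ofRealHom)^2 := by
  have h : ∀ r : ℝ, linFactor (r : OnePoint ℝ) = X + C (r : ℂ) := fun r => rfl
  rw [fibrePoly, Multiset.map_add, Multiset.prod_add, Multiset.map_map, sq]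
  have : (Multiset.map (linFactor ∘ fun i => ((b i : ℝ) : OnePoint ℝ)) Finset.univ.val).prod
      = (Bp b).map Complex.ofRealHom := by
    rw [Bp, Polynomial.map_prod]
    change ∏ i, linFactor ((b i : ℝ) : OnePoint ℝ) = _
    refine Finset.prod_congr rfl fun i _ => ?_
    rw [h]
    simp
  rw [this]

theorem mem_Y_iff (b : Fin (n*(n+1)/2) → ℝ) (y : Submodule ℂ ℂ[X]) :
    (IsOGPt n y ∧ WrEq n y (((Bp b).map Complex.ofRealHom)^2)) ↔
      ∃ x ∈ (WrY n).fiber (PsiY n b), Submodule.span ℂ (Set.range (cellP (paramA x))) = y := by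
  have hd := half_double n
  have hm : ((Bp b).map Complex.ofRealHom).Monic := (Bp_monic b).map _
  have hm2 := hm.pow 2
  have hdeg : (((Bp b).map Complex.ofRealHom)^2).natDegree = n*(n+1) := by
    rw [hm.natDegree_pow, (Bp_monic b).natDegree_map, Bp_natDegree]; omega
  constructor
  · rintro ⟨⟨hg, hiso⟩, f, hf, c, hc, hw⟩
    replace hw : wr f = C c * ((Bp b).map Complex.ofRealHom)^2 := by
      rw [← smul_eq_C_mul]; exact hw
    obtain ⟨A, hA⟩ := cell_exists y hg f hf (by rw [hw, natDegree_C_mul hc, hdeg])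
      (by rw [hw]; exact mul_ne_zero (C_ne_zero.2 hc) hm2.ne_zero)
    have hAp := iso_param A (fun i k => hiso _ (hA ▸ Submodule.subset_span ⟨i, rfl⟩) _
      (hA ▸ Submodule.subset_span ⟨k, rfl⟩))
    refine ⟨getY A, ?_, by rw [← hAp, hA]⟩
    rw [mem_fiberY, ← hAp]
    obtain ⟨e, he, hwe⟩ := wr_span f (cellP A) (hf.trans hA.symm)
    rw [hw, ← mul_assoc, ← C_mul] at hwe
    have hl := (wr_cell_lead A).2.2
    rw [hwe, leadingCoeff_mul, leadingCoeff_C, hm2.leadingCoeff, mul_one] at hl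
    rw [hwe, hl]
  · rintro ⟨x, hx, rfl⟩
    rw [mem_fiberY] at hx
    refine ⟨⟨cell_grass _, span_iso _ (param_iso x)⟩, cellP (paramA x), rfl, (cW n : ℂ), cW_neC n, ?_⟩
    rw [smul_eq_C_mul]
    exact hx

theorem ncard_Y (b : Fin (n*(n+1)/2) → ℝ) :
    ({y : Submodule ℂ ℂ[X] | IsOGPt n y} ∩ fibre n ((Finset.univ.val.map fun i => ((b i : ℝ) : OnePoint ℝ)) +
      (Finset.univ.val.map fun i => ((b i : ℝ) : OnePoint ℝ)))).ncard = ((WrY n).fiber (PsiY n b)).ncard := by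
  have : ({y : Submodule ℂ ℂ[X] | IsOGPt n y} ∩ fibre n ((Finset.univ.val.map fun i => ((b i : ℝ) : OnePoint ℝ)) +
      (Finset.univ.val.map fun i => ((b i : ℝ) : OnePoint ℝ)))) =
      (fun x => Submodule.span ℂ (Set.range (cellP (paramA x)))) '' ((WrY n).fiber (PsiY n b)) := by
    ext y
    rw [Set.mem_image, ← mem_Y_iff, ← fibrePoly_eq]
    constructor
    · rintro ⟨h1, h2⟩; exact ⟨h1, h2.2⟩
    · rintro ⟨h1, h2⟩; exact ⟨h1, h1.1, h2⟩
  rw [this, Set.ncard_image_of_injOn]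
  intro x _ x' _ h
  have := cell_inj _ _ h
  rw [← getY_paramA x, this, getY_paramA]

end YE
end OG
end PartYE

section PartTA
namespace OG

section TA

open Classical in
/-- standard tableaux on a set of cells -/
noncomputable def tabs (D : Finset Cell) : Finset Filling :=
  (D ×ˢ Finset.Icc 1 D.card).powerset.filter fun T => IsTableauOn T D (Finset.Icc 1 D.card)

theorem mem_tabs {D : Finset Cell} {T : Filling} : T ∈ tabs D ↔ IsTableauOn T D (Finset.Icc 1 D.card) := by
  classical
  rw [tabs, Finset.mem_filter, Finset.mem_powerset]
  constructor
  · exact fun h => h.2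
  · intro h
    refine ⟨?_, h⟩
    intro p hp
    rw [Finset.mem_product]
    exact ⟨h.2.1 ▸ Finset.mem_image_of_mem _ hp, h.2.2 ▸ Finset.mem_image_of_mem _ hp⟩

/-- corner cells -/
def IsCorner (D : Finset Cell) (c : Cell) : Prop :=
  c ∈ D ∧ (∀ d ∈ D, d.1 = c.1 → ¬ c.2 < d.2) ∧ (∀ d ∈ D, d.2 = c.2 → ¬ c.1 < d.1)

theorem tab_cell {D : Finset Cell} {E : Finset ℕ} {T : Filling} (h : IsTableauOn T D E) {p : Cell × ℕ} (hp : p ∈ T) :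
    p.1 ∈ D := h.2.1 ▸ Finset.mem_image_of_mem _ hp
theorem tab_entry {D : Finset Cell} {E : Finset ℕ} {T : Filling} (h : IsTableauOn T D E) {p : Cell × ℕ} (hp : p ∈ T) :
    p.2 ∈ E := h.2.2 ▸ Finset.mem_image_of_mem _ hp

theorem tab_insert {D : Finset Cell} {c : Cell} (hc : IsCorner D c) {T : Filling} (hT : T ∈ tabs (D.erase c)) :
    insert (c, D.card) T ∈ tabs D := by
  rw [mem_tabs, Finset.card_erase_of_mem hc.1] at hT
  rw [mem_tabs]
  have hpos : 0 < D.card := Finset.card_pos.2 ⟨c, hc.1⟩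
  have hce : ∀ p ∈ T, p.1 ≠ c ∧ p.1 ∈ D ∧ p.2 < D.card := by
    intro p hp
    have h1 := Finset.mem_erase.1 (tab_cell hT hp)
    have h2 := Finset.mem_Icc.1 (tab_entry hT hp)
    exact ⟨h1.1, h1.2, by omega⟩
  obtain ⟨⟨t1, t2, t3, t4⟩, tc, te⟩ := hT
  refine ⟨⟨?_, ?_, ?_, ?_⟩, ?_, ?_⟩
  · intro p hp q hq h
    rw [Finset.mem_insert] at hp hq
    rcases hp with rfl | hp <;> rcases hq with rfl | hq
    · rfl
    · exact absurd h.symm (hce q hq).1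
    · exact absurd h (hce p hp).1
    · exact t1 p hp q hq h
  · intro p hp q hq h
    rw [Finset.mem_insert] at hp hq
    rcases hp with rfl | hp <;> rcases hq with rfl | hq
    · rfl
    · exact absurd h.symm (hce q hq).2.2.ne
    · exact absurd h (hce p hp).2.2.ne
    · exact t2 p hp q hq h
  · intro p hp q hq h h'
    rw [Finset.mem_insert] at hp hq
    rcases hp with rfl | hp <;> rcases hq with rfl | hq
    · exact absurd h' (lt_irrefl _)
    · exact absurd h' (hc.2.1 _ (hce q hq).2.1 h.symm)
    · exact (hce p hp).2.2
    · exact t3 p hp q hq h h'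
  · intro p hp q hq h h'
    rw [Finset.mem_insert] at hp hq
    rcases hp with rfl | hp <;> rcases hq with rfl | hq
    · exact absurd h' (lt_irrefl _)
    · exact absurd h' (hc.2.2 _ (hce q hq).2.1 h.symm)
    · exact (hce p hp).2.2
    · exact t4 p hp q hq h h'
  · rw [cellsOf, Finset.image_insert]
    rw [cellsOf] at tc
    rw [tc, Finset.insert_erase hc.1]
  · rw [entriesOf, Finset.image_insert]
    rw [entriesOf] at te
    rw [te]
    ext k
    simp only [Finset.mem_insert, Finset.mem_Icc]
    omega

theorem tab_remove {D : Finset Cell} (hpos : 0 < D.card) {T : Filling} (hT : T ∈ tabs D) :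
    ∃ c, IsCorner D c ∧ ∃ T' ∈ tabs (D.erase c), insert (c, D.card) T' = T := by
  rw [mem_tabs] at hT
  have hN : D.card ∈ entriesOf T := by rw [hT.2.2, Finset.mem_Icc]; omega
  obtain ⟨⟨c, e⟩, hp, he⟩ := Finset.mem_image.1 hN
  simp only at he
  subst he
  have hcD : c ∈ D := tab_cell hT hp
  have hex : ∀ d ∈ D, ∃ k, (d, k) ∈ T ∧ k ≤ D.card := by
    intro d hd
    rw [← hT.2.1] at hd
    obtain ⟨⟨d', k⟩, hdk, rfl⟩ := Finset.mem_image.1 hd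
    exact ⟨k, hdk, (Finset.mem_Icc.1 (tab_entry hT hdk)).2⟩
  have hcor : IsCorner D c := by
    refine ⟨hcD, ?_, ?_⟩
    · intro d hd h h'
      obtain ⟨k, hk, hk'⟩ := hex d hd
      exact absurd (hT.1.2.2.1 _ hp _ hk h.symm h') (not_lt.2 hk')
    · intro d hd h h'
      obtain ⟨k, hk, hk'⟩ := hex d hd
      exact absurd (hT.1.2.2.2 _ hp _ hk h.symm h') (not_lt.2 hk')
  refine ⟨c, hcor, T.erase (c, D.card), ?_, Finset.insert_erase hp⟩
  rw [mem_tabs, Finset.card_erase_of_mem hcD]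
  obtain ⟨⟨t1, t2, t3, t4⟩, tc, te⟩ := hT
  have hm : ∀ p ∈ T.erase (c, D.card), p ∈ T := fun p hp => Finset.mem_of_mem_erase hp
  refine ⟨⟨fun p hp q hq => t1 p (hm p hp) q (hm q hq), fun p hp q hq => t2 p (hm p hp) q (hm q hq),
    fun p hp q hq => t3 p (hm p hp) q (hm q hq), fun p hp q hq => t4 p (hm p hp) q (hm q hq)⟩, ?_, ?_⟩
  · ext d
    have htc : d ∈ D ↔ d ∈ cellsOf T := by rw [tc]
    rw [Finset.mem_erase, htc, cellsOf, cellsOf, Finset.mem_image, Finset.mem_image]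
    constructor
    · rintro ⟨p, hp', rfl⟩
      refine ⟨fun h => (Finset.mem_erase.1 hp').1 (t1 _ (hm _ hp') _ hp h), p, hm _ hp', rfl⟩
    · rintro ⟨h, p, hp', rfl⟩
      exact ⟨p, Finset.mem_erase.2 ⟨fun h' => h (by rw [h']), hp'⟩, rfl⟩
  · ext k
    have : k ∈ Finset.Icc 1 (D.card - 1) ↔ k ≠ D.card ∧ k ∈ entriesOf T := by
      rw [te]; simp only [Finset.mem_Icc]; omega
    rw [this, entriesOf, entriesOf, Finset.mem_image, Finset.mem_image]
    constructor
    · rintro ⟨p, hp', rfl⟩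
      refine ⟨fun h => (Finset.mem_erase.1 hp').1 (t2 _ (hm _ hp') _ hp h), p, hm _ hp', rfl⟩
    · rintro ⟨h, p, hp', rfl⟩
      exact ⟨p, Finset.mem_erase.2 ⟨fun h' => h (by rw [h']), hp'⟩, rfl⟩

theorem tabs_not_mem {D : Finset Cell} {c c' : Cell} (hc : c ∈ D) {T : Filling} (hT : T ∈ tabs (D.erase c)) :
    (c', D.card) ∉ T := by
  intro h
  rw [mem_tabs, Finset.card_erase_of_mem hc] at hT
  have := Finset.mem_Icc.1 (tab_entry hT h)
  have hpos : 0 < D.card := Finset.card_pos.2 ⟨c, hc⟩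
  simp only at this
  omega

/-- Branching: remove the largest entry. -/
theorem tabs_card (D S : Finset Cell) (hpos : 0 < D.card) (hS : ∀ c, c ∈ S ↔ IsCorner D c) :
    (tabs D).card = ∑ c ∈ S, (tabs (D.erase c)).card := by
  classical
  have h1 : tabs D = S.biUnion fun c => (tabs (D.erase c)).image (insert (c, D.card)) := by
    ext T
    rw [Finset.mem_biUnion]
    constructor
    · intro h
      obtain ⟨c, hc, T', hT', rfl⟩ := tab_remove hpos h
      exact ⟨c, (hS c).2 hc, Finset.mem_image_of_mem _ hT'⟩
    · rintro ⟨c, hc, h⟩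
      obtain ⟨T', hT', rfl⟩ := Finset.mem_image.1 h
      exact tab_insert ((hS c).1 hc) hT'
  rw [h1, Finset.card_biUnion]
  · refine Finset.sum_congr rfl fun c hc => Finset.card_image_of_injOn ?_
    intro T hT T' hT' h
    have hcD := ((hS c).1 hc).1
    have e := congrArg (fun U => Finset.erase U (c, D.card)) h
    rwa [Finset.erase_insert (tabs_not_mem hcD hT), Finset.erase_insert (tabs_not_mem hcD hT')] at e
  · intro c hc c' hc' hne
    rw [Function.onFun, Finset.disjoint_left]
    intro T hT hT'
    obtain ⟨U, hU, rfl⟩ := Finset.mem_image.1 hT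
    obtain ⟨U', hU', h⟩ := Finset.mem_image.1 hT'
    have : (c, D.card) ∈ insert (c', D.card) U' := by rw [h]; exact Finset.mem_insert_self _ _
    rcases Finset.mem_insert.1 this with h | h
    · exact hne (Prod.ext_iff.1 h).1
    · exact tabs_not_mem ((hS c').1 hc').1 hU' h

theorem tabs_empty : (tabs ∅).card = 1 := by
  have : tabs ∅ = {∅} := by
    ext T
    rw [mem_tabs, Finset.mem_singleton]
    constructor
    · intro h; exact Finset.image_eq_empty.1 h.2.1
    · rintro rfl
      refine ⟨⟨?_, ?_, ?_, ?_⟩, ?_, ?_⟩ <;> simp [cellsOf, entriesOf]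
  rw [this, Finset.card_singleton]

/-- shifted diagrams -/
def shD (n : ℕ) (s : ℕ → ℕ) : Finset Cell :=
  (Finset.range n).biUnion fun i => (Finset.range (s i)).image fun j => (i, i + j)

theorem mem_shD {n : ℕ} {s : ℕ → ℕ} {c : Cell} : c ∈ shD n s ↔ c.1 < n ∧ c.1 ≤ c.2 ∧ c.2 < c.1 + s c.1 := by
  obtain ⟨i, j⟩ := c
  simp only [shD, Finset.mem_biUnion, Finset.mem_range, Finset.mem_image, Prod.mk.injEq]
  constructor
  · rintro ⟨a, h, k, hk, rfl, rfl⟩; omega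
  · rintro ⟨h1, h2, h3⟩; exact ⟨i, h1, j - i, by omega, rfl, by omega⟩

theorem card_shD (n : ℕ) (s : ℕ → ℕ) : (shD n s).card = ∑ i ∈ Finset.range n, s i := by
  rw [shD, Finset.card_biUnion]
  · refine Finset.sum_congr rfl fun i _ => ?_
    rw [Finset.card_image_of_injective _ (fun a b h => by simpa using h), Finset.card_range]
  · intro i _ j _ hij
    rw [Function.onFun, Finset.disjoint_left]
    intro c hc hc'
    obtain ⟨_, _, rfl⟩ := Finset.mem_image.1 hc
    obtain ⟨_, _, h⟩ := Finset.mem_image.1 hc'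
    exact hij (Prod.ext_iff.1 h).1.symm

/-- strictness -/
def HS (n : ℕ) (s : ℕ → ℕ) : Prop := ∀ i, i + 1 < n → s (i+1) = 0 ∨ s (i+1) < s i

theorem HS.add {n : ℕ} {s : ℕ → ℕ} (h : HS n s) {i j : ℕ} (hij : i ≤ j) (hj : j < n) (hp : 0 < s j) :
    s j + j ≤ s i + i := by
  induction j, hij using Nat.le_induction with
  | base => exact le_rfl
  | succ k hk ih =>
    have := h k hj
    have := ih (by omega) (by omega)
    omega

/-- lower row `i` by one -/
def dec (s : ℕ → ℕ) (i : ℕ) : ℕ → ℕ := Function.update s i (s i - 1)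

theorem shD_dec (n : ℕ) (s : ℕ → ℕ) (i : ℕ) :
    shD n (dec s i) = (shD n s).erase (i, i + s i - 1) := by
  ext ⟨a, b⟩
  rw [Finset.mem_erase, mem_shD, mem_shD, dec]
  by_cases h : a = i
  · subst h
    simp only [Function.update_self, ne_eq, Prod.mk.injEq, true_and]
    omega
  · simp only [Function.update_of_ne h, ne_eq, Prod.mk.injEq, h, false_and, not_false_eq_true, true_and]

/-- removable rows -/
def Rm (n : ℕ) (s : ℕ → ℕ) : Finset ℕ :=
  (Finset.range n).filter fun i => 0 < s i ∧ (i + 1 < n → s (i+1) = 0 ∨ s (i+1) + 1 < s i)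

theorem mem_Rm {n : ℕ} {s : ℕ → ℕ} {i : ℕ} : i ∈ Rm n s ↔ i < n ∧ 0 < s i ∧ (i + 1 < n → s (i+1) = 0 ∨ s (i+1) + 1 < s i) := by
  rw [Rm, Finset.mem_filter, Finset.mem_range]

theorem corner_iff {n : ℕ} {s : ℕ → ℕ} (h : HS n s) (c : Cell) :
    c ∈ (Rm n s).image (fun i => (i, i + s i - 1)) ↔ IsCorner (shD n s) c := by
  rw [Finset.mem_image]
  constructor
  · rintro ⟨i, hi, rfl⟩
    rw [mem_Rm] at hi
    refine ⟨mem_shD.2 ⟨hi.1, by simp only; omega, by simp only; omega⟩, ?_, ?_⟩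
    · intro d hd h1 h2
      rw [mem_shD] at hd
      simp only at h1 h2
      rw [h1] at hd
      omega
    · intro d hd h1 h2
      rw [mem_shD] at hd
      simp only at h1 h2
      have h3 := hi.2.2 (by omega)
      have h4 := h.add (i := i+1) (j := d.1) (by omega) (by omega) (by omega)
      have h5 := h.add (i := i) (j := d.1) (by omega) (by omega) (by omega)
      omega
  · rintro ⟨hc, h1, h2⟩
    obtain ⟨i, j⟩ := c
    rw [mem_shD] at hc
    simp only at hc h1 h2
    have e : j = i + s i - 1 := by
      by_contra hne
      exact h1 (i, j+1) (mem_shD.2 ⟨hc.1, by simp only; omega, by simp only; omega⟩) rfl (by simp)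
    refine ⟨i, mem_Rm.2 ⟨hc.1, by omega, ?_⟩, by rw [e]⟩
    intro hn
    by_contra hcon
    have h3 := h i hn
    exact h2 (i+1, j) (mem_shD.2 ⟨hn, by simp only; omega, by simp only; omega⟩) rfl (by simp)

theorem HS_dec {n : ℕ} {s : ℕ → ℕ} (h : HS n s) {i : ℕ} (hi : i ∈ Rm n s) : HS n (dec s i) := by
  rw [mem_Rm] at hi
  intro k hk
  have h1 := h k hk
  simp only [dec, Function.update_apply]
  by_cases e : k = i
  · subst e
    have := hi.2.2 hk
    simp
    omega
  · by_cases e' : k + 1 = i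
    · simp [e, e']
      rw [e'] at h1
      omega
    · simpa [e, e'] using h1

theorem tabs_rec {n : ℕ} {s : ℕ → ℕ} (h : HS n s) (hpos : 0 < ∑ i ∈ Finset.range n, s i) :
    (tabs (shD n s)).card = ∑ i ∈ Rm n s, (tabs (shD n (dec s i))).card := by
  rw [tabs_card _ _ (by rwa [card_shD]) (corner_iff h), Finset.sum_image]
  · exact Finset.sum_congr rfl fun i _ => by rw [shD_dec]
  · intro i _ j _ e
    exact (Prod.ext_iff.1 e).1

end TA
end OG
end PartTA

section PartTB
namespace OG

section TB
open Polynomial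

/-- pair factor -/
noncomputable def rho (x y : ℕ) : ℚ := if y = 0 then 1 else ((x:ℚ) - y) / (x + y)

/-- product of pair factors -/
noncomputable def Rp (n : ℕ) (s : ℕ → ℕ) : ℚ := ∏ k ∈ Finset.range n, ∏ j ∈ Finset.range k, rho (s j) (s k)

/-- the closed formula -/
noncomputable def Gf (n : ℕ) (s : ℕ → ℕ) : ℚ :=
  ((∑ i ∈ Finset.range n, s i).factorial : ℚ) / (∏ i ∈ Finset.range n, ((s i).factorial : ℚ)) * Rp n s

theorem prod_pairs (q : ℕ → ℚ) (i n : ℕ) :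
    ∏ k ∈ Finset.range n, ∏ j ∈ Finset.range k, (if j = i then q k else if k = i then q j else 1) =
      if i < n then ∏ k ∈ (Finset.range n).erase i, q k else 1 := by
  induction n with
  | zero => simp
  | succ n ih =>
    rw [Finset.prod_range_succ, ih]
    rcases lt_trichotomy i n with h | h | h
    · rw [if_pos h, if_pos (by omega), Finset.range_add_one, Finset.erase_insert_of_ne (by omega), Finset.prod_insert (by simp),
        mul_comm]
      congr 1
      rw [Finset.prod_eq_single_of_mem i (Finset.mem_range.2 h)]
      · simp
      · intro j _ hj; rw [if_neg hj, if_neg (by omega)]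
    · subst h
      rw [if_neg (lt_irrefl _), if_pos (by omega), one_mul, Finset.range_add_one, Finset.erase_insert (by simp)]
      refine Finset.prod_congr rfl fun j hj => ?_
      rw [if_neg (by have := Finset.mem_range.1 hj; omega), if_pos rfl]
    · rw [if_neg (by omega), if_neg (by omega), one_mul]
      refine Finset.prod_eq_one fun j hj => ?_
      have := Finset.mem_range.1 hj
      rw [if_neg (by omega), if_neg (by omega)]

/-- `V` -/
def Vq (x : ℕ) : ℚ := (x:ℚ) * (x - 1)

/-- ratio -/
noncomputable def qr (x y : ℕ) : ℚ := if y = 0 then 1 else (Vq x - Vq y - 2 * y) / (Vq x - Vq y)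

theorem HS.lt {n : ℕ} {s : ℕ → ℕ} (h : HS n s) {i j : ℕ} (hij : i < j) (hj : j < n) : s j = 0 ∨ s j < s i := by
  rcases Nat.eq_zero_or_pos (s j) with h0 | h0
  · exact Or.inl h0
  · have := h.add hij.le hj h0; right; omega

theorem qr_eq (x y : ℕ) (hy : 0 < y) : qr x y = (((x:ℚ) + y) * (x - y - 1)) / ((x - y) * (x + y - 1)) := by
  rw [qr, if_neg hy.ne', Vq, Vq]
  congr 1 <;> ring

theorem rho_left (x y : ℕ) (hx : 0 < x) (h : y = 0 ∨ y < x) : rho (x - 1) y = qr x y * rho x y := by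
  rcases Nat.eq_zero_or_pos y with h0 | h0
  · rw [rho, rho, qr, if_pos h0, if_pos h0, if_pos h0, one_mul]
  · have hlt : y < x := by omega
    rw [rho, rho, qr_eq _ _ h0, if_neg h0.ne', if_neg h0.ne', Nat.cast_sub hx]
    have h1 : ((x:ℚ) - y) ≠ 0 := sub_ne_zero.2 (by exact_mod_cast hlt.ne')
    have h2 : ((x:ℚ) + y) ≠ 0 := by positivity
    have h3 : ((x:ℚ) + y - 1) ≠ 0 := by
      have : (2:ℚ) ≤ x := by exact_mod_cast (by omega)
      have : (0:ℚ) ≤ y := by positivity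
      linarith
    have h4 : ((x:ℚ) - 1 + y) ≠ 0 := by intro h; apply h3; linarith
    push_cast
    field_simp
    ring

theorem rho_right (x y : ℕ) (hx : 0 < x) (h : x < y) : rho y (x - 1) = qr x y * rho y x := by
  have h0 : 0 < y := by omega
  have h1 : ((x:ℚ) - y) ≠ 0 := sub_ne_zero.2 (by exact_mod_cast h.ne)
  have h2 : ((y:ℚ) + x) ≠ 0 := by positivity
  have h3 : ((x:ℚ) + y - 1) ≠ 0 := by
    have : (2:ℚ) ≤ y := by exact_mod_cast (by omega)
    have : (0:ℚ) ≤ x := by positivity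
    linarith
  have h4 : ((y:ℚ) + (x - 1)) ≠ 0 := by intro h; apply h3; linarith
  have key : ((y:ℚ) - (x - 1)) / (y + (x - 1)) = qr x y * rho y x := by
    rw [rho, qr_eq _ _ h0, if_neg hx.ne']
    field_simp
    ring
  rw [← key, rho]
  split_ifs with he
  · have : x = 1 := by omega
    subst this
    have : (y:ℚ) ≠ 0 := by positivity
    simp [this]
  · rw [Nat.cast_sub hx]; simp

theorem Rp_dec {n : ℕ} {s : ℕ → ℕ} (h : HS n s) {i : ℕ} (hi : i < n) (hp : 0 < s i) :
    Rp n (dec s i) = (∏ k ∈ (Finset.range n).erase i, qr (s i) (s k)) * Rp n s := by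
  have h1 := prod_pairs (fun k => qr (s i) (s k)) i n
  rw [if_pos hi] at h1
  rw [← h1, Rp, Rp, ← Finset.prod_mul_distrib]
  refine Finset.prod_congr rfl fun k hk => ?_
  rw [← Finset.prod_mul_distrib]
  refine Finset.prod_congr rfl fun j hj => ?_
  have hk' := Finset.mem_range.1 hk
  have hj' := Finset.mem_range.1 hj
  have hs := h.lt hj' hk'
  simp only [dec, Function.update_apply]
  by_cases e : j = i
  · subst e
    rw [if_pos rfl, if_pos rfl, if_neg (by omega)]
    exact rho_left _ _ hp hs
  · rw [if_neg e, if_neg e]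
    by_cases e' : k = i
    · subst e'
      rw [if_pos rfl, if_pos rfl]
      exact rho_right _ _ hp (by omega)
    · rw [if_neg e', if_neg e', one_mul]

theorem sum_dec {n : ℕ} {s : ℕ → ℕ} {i : ℕ} (hi : i < n) (hp : 0 < s i) :
    ∑ k ∈ Finset.range n, dec s i k + 1 = ∑ k ∈ Finset.range n, s k := by
  rw [← Finset.add_sum_erase _ _ (Finset.mem_range.2 hi), ← Finset.add_sum_erase _ s (Finset.mem_range.2 hi)]
  have : ∑ k ∈ (Finset.range n).erase i, dec s i k = ∑ k ∈ (Finset.range n).erase i, s k :=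
    Finset.sum_congr rfl fun k hk => by rw [dec, Function.update_of_ne (Finset.ne_of_mem_erase hk)]
  rw [this, dec, Function.update_self]
  omega

theorem fact_dec {n : ℕ} {s : ℕ → ℕ} {i : ℕ} (hi : i < n) (hp : 0 < s i) :
    (∏ k ∈ Finset.range n, ((dec s i k).factorial : ℚ)) * s i = ∏ k ∈ Finset.range n, ((s k).factorial : ℚ) := by
  rw [← Finset.mul_prod_erase _ _ (Finset.mem_range.2 hi),
    ← Finset.mul_prod_erase _ (fun k => ((s k).factorial : ℚ)) (Finset.mem_range.2 hi)]
  have : ∏ k ∈ (Finset.range n).erase i, ((dec s i k).factorial : ℚ) = ∏ k ∈ (Finset.range n).erase i, ((s k).factorial : ℚ) :=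
    Finset.prod_congr rfl fun k hk => by rw [dec, Function.update_of_ne (Finset.ne_of_mem_erase hk)]
  rw [this, dec, Function.update_self, ← Nat.mul_factorial_pred hp.ne']
  push_cast
  ring

theorem Gf_dec {n : ℕ} {s : ℕ → ℕ} (h : HS n s) {i : ℕ} (hi : i < n) (hp : 0 < s i) :
    Gf n (dec s i) * ((∑ k ∈ Finset.range n, s k : ℕ) : ℚ) = Gf n s * (s i * ∏ k ∈ (Finset.range n).erase i, qr (s i) (s k)) := by
  rw [Gf, Gf, Rp_dec h hi hp, ← fact_dec hi hp, ← sum_dec hi hp, Nat.factorial_succ]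
  have h1 : (∏ k ∈ Finset.range n, ((dec s i k).factorial : ℚ)) ≠ 0 :=
    Finset.prod_ne_zero_iff.2 fun k _ => by exact_mod_cast Nat.factorial_ne_zero _
  have h2 : (s i : ℚ) ≠ 0 := by exact_mod_cast hp.ne'
  rw [Nat.cast_mul]
  field_simp

/-- Lagrange identity -/
theorem lag_id {ι : Type*} [DecidableEq ι] (S : Finset ι) (V t : ι → ℚ) (hV : Set.InjOn V S) :
    ∑ i ∈ S, t i * ∏ j ∈ S.erase i, ((V i - V j - t j) / (V i - V j)) = ∑ i ∈ S, t i := by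
  rcases S.eq_empty_or_nonempty with rfl | hne
  · simp
  have hc : 0 < S.card := Finset.card_pos.2 hne
  set P : ℚ[X] := ∏ j ∈ S, (X - C (V j)) - ∏ j ∈ S, (X - C (V j + t j)) with hPd
  have hdeg : P.degree < S.card := by
    have d1 : (∏ j ∈ S, (X - C (V j))).degree = (S.card : WithBot ℕ) := by
      rw [degree_prod]; simp
    have d2 : (∏ j ∈ S, (X - C (V j + t j))).degree = (S.card : WithBot ℕ) := by
      rw [degree_prod]; simp only [degree_X_sub_C]; simp
    have := degree_sub_lt (d1.trans d2.symm) (monic_prod_of_monic _ _ fun i _ => monic_X_sub_C _).ne_zero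
      ((monic_prod_of_monic _ _ fun i _ => monic_X_sub_C _).leadingCoeff.trans
        (monic_prod_of_monic _ _ fun i _ => monic_X_sub_C _).leadingCoeff.symm)
    rwa [d1] at this
  have h1 := lagK_coeff S V hV P hdeg
  have h2 : P.coeff (S.card - 1) = ∑ i ∈ S, t i := by
    rw [hPd, coeff_sub, prod_X_sub_C_coeff_card_pred _ _ hc, prod_X_sub_C_coeff_card_pred _ _ hc,
      Finset.sum_add_distrib]
    ring
  rw [← h2, h1]
  refine Finset.sum_congr rfl fun i hi => ?_
  have h3 : P.eval (V i) = t i * ∏ j ∈ S.erase i, (V i - V j - t j) := by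
    rw [hPd, eval_sub, eval_prod, eval_prod, Finset.prod_eq_zero hi (by simp), ← Finset.mul_prod_erase _ _ hi]
    simp only [eval_sub, eval_X, eval_C]
    rw [show V i - (V i + t i) = - t i by ring]
    simp only [sub_sub]
    ring
  rw [h3, Finset.prod_div_distrib, mul_div_assoc]

theorem Gf_rec {n : ℕ} {s : ℕ → ℕ} (h : HS n s) (hpos : 0 < ∑ i ∈ Finset.range n, s i) :
    ∑ i ∈ (Finset.range n).filter (fun i => 0 < s i), Gf n (dec s i) = Gf n s := by
  set S := (Finset.range n).filter (fun i => 0 < s i) with hS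
  have hM : ((∑ k ∈ Finset.range n, s k : ℕ) : ℚ) ≠ 0 := by exact_mod_cast hpos.ne'
  have hmem : ∀ i ∈ S, i < n ∧ 0 < s i := fun i hi => by simpa [hS] using hi
  have hinj : Set.InjOn (fun i => Vq (s i)) S := by
    intro i hi j hj e
    have hi := hmem i hi
    have hj := hmem j hj
    simp only [Vq] at e
    have e2 : ((s i : ℚ) - s j) * (s i + s j - 1) = 0 := by linear_combination e
    have h1 : (1:ℚ) ≤ s i := by exact_mod_cast hi.2
    have h2 : (1:ℚ) ≤ s j := by exact_mod_cast hj.2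
    have e3 : s i = s j := by
      rcases mul_eq_zero.1 e2 with e | e
      · exact_mod_cast sub_eq_zero.1 e
      · linarith
    rcases lt_trichotomy i j with hl | hl | hl
    · have := h.lt hl hj.1; omega
    · exact hl
    · have := h.lt hl hi.1; omega
  have key := lag_id S (fun i => Vq (s i)) (fun i => 2 * (s i : ℚ)) hinj
  have hprod : ∀ i ∈ S, ∏ k ∈ (Finset.range n).erase i, qr (s i) (s k) =
      ∏ j ∈ S.erase i, ((Vq (s i) - Vq (s j) - 2 * (s j : ℚ)) / (Vq (s i) - Vq (s j))) := by
    intro i _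
    rw [← Finset.prod_subset (s₁ := S.erase i) (Finset.erase_subset_erase _ (Finset.filter_subset _ _))]
    · refine Finset.prod_congr rfl fun j hj => ?_
      rw [qr, if_neg (hmem j (Finset.mem_of_mem_erase hj)).2.ne']
    · intro k hk hk'
      rw [Finset.mem_erase] at hk hk'
      have : s k = 0 := by
        by_contra hc
        exact hk' ⟨hk.1, Finset.mem_filter.2 ⟨hk.2, Nat.pos_of_ne_zero hc⟩⟩
      rw [qr, if_pos this]
  have hsum : ∑ i ∈ S, (s i : ℚ) = ((∑ k ∈ Finset.range n, s k : ℕ) : ℚ) := by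
    rw [Nat.cast_sum]
    refine Finset.sum_subset (Finset.filter_subset _ _) fun k hk hk' => ?_
    have : s k = 0 := by
      by_contra hc
      exact hk' (Finset.mem_filter.2 ⟨hk, Nat.pos_of_ne_zero hc⟩)
    simp [this]
  apply mul_right_cancel₀ hM
  rw [Finset.sum_mul, Finset.sum_congr rfl fun i hi => Gf_dec h (hmem i hi).1 (hmem i hi).2, ← Finset.mul_sum]
  congr 1
  rw [← hsum, Finset.sum_congr rfl fun i hi => by rw [hprod i hi]]
  simp only [mul_assoc, ← Finset.mul_sum] at key
  exact mul_left_cancel₀ two_ne_zero key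

theorem Gf_bad {n : ℕ} {s : ℕ → ℕ} (h : HS n s) {i : ℕ} (hp : 0 < s i) (hi : i < n) (hR : i ∉ Rm n s) :
    Gf n (dec s i) = 0 := by
  rw [mem_Rm] at hR
  have hn : i + 1 < n := by by_contra hc; exact hR ⟨hi, hp, fun h => absurd h hc⟩
  have h1 : ¬ (s (i+1) = 0 ∨ s (i+1) + 1 < s i) := fun hc => hR ⟨hi, hp, fun _ => hc⟩
  have h2 := h i hn
  have h3 : s (i+1) = s i - 1 := by omega
  have : Rp n (dec s i) = 0 := by
    rw [Rp]
    refine Finset.prod_eq_zero (Finset.mem_range.2 hn) (Finset.prod_eq_zero (Finset.mem_range.2 (Nat.lt_succ_self i)) ?_)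
    rw [dec, Function.update_self, Function.update_of_ne (by omega), rho, if_neg (by omega), h3, sub_self, zero_div]
  rw [Gf, this, mul_zero]

theorem tabs_Gf (n M : ℕ) : ∀ s, HS n s → ∑ i ∈ Finset.range n, s i = M → ((tabs (shD n s)).card : ℚ) = Gf n s := by
  induction M with
  | zero =>
    intro s _ hs
    have h0 : ∀ i ∈ Finset.range n, s i = 0 := by simpa using hs
    have h1 : shD n s = ∅ := by rw [← Finset.card_eq_zero, card_shD, hs]
    have h2 : Rp n s = 1 := Finset.prod_eq_one fun k hk => Finset.prod_eq_one fun j _ => by rw [rho, if_pos (h0 k hk)]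
    rw [h1, tabs_empty, Gf, hs, h2, Finset.prod_eq_one fun k hk => by rw [h0 k hk]; simp]
    simp
  | succ M ih =>
    intro s h hs
    rw [tabs_rec h (by omega), ← Gf_rec h (by omega), Nat.cast_sum]
    have hsub : Rm n s ⊆ (Finset.range n).filter (fun i => 0 < s i) := by
      intro i hi
      rw [mem_Rm] at hi
      simp [hi.1, hi.2.1]
    rw [← Finset.sum_subset hsub]
    · refine Finset.sum_congr rfl fun i hi => ih _ (HS_dec h hi) ?_
      rw [mem_Rm] at hi
      have := sum_dec hi.1 hi.2.1
      omega
    · intro i hi hi'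
      rw [Finset.mem_filter, Finset.mem_range] at hi
      exact Gf_bad h hi.2 hi.1 hi'

/-! ### staircase -/

theorem stair_pairs (n : ℕ) : ∏ k ∈ Finset.range n, ∏ j ∈ Finset.range k, (((n - j : ℕ) : ℚ) + ((n - k : ℕ) : ℚ)) =
    ∏ k ∈ Finset.range n, ∏ j ∈ Finset.range k, ((j : ℚ) + k + 2) := by
  rw [Finset.prod_sigma', Finset.prod_sigma']
  refine Finset.prod_nbij' (fun p => ⟨n - 1 - p.2, n - 1 - p.1⟩) (fun p => ⟨n - 1 - p.2, n - 1 - p.1⟩) ?_ ?_ ?_ ?_ ?_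
  · rintro ⟨k, j⟩ h; simp only [Finset.mem_sigma, Finset.mem_range] at h ⊢; omega
  · rintro ⟨k, j⟩ h; simp only [Finset.mem_sigma, Finset.mem_range] at h ⊢; omega
  · rintro ⟨k, j⟩ h
    simp only [Finset.mem_sigma, Finset.mem_range] at h
    have e1 : n - 1 - (n - 1 - k) = k := by omega
    have e2 : n - 1 - (n - 1 - j) = j := by omega
    simp only [e1, e2]
  · rintro ⟨k, j⟩ h
    simp only [Finset.mem_sigma, Finset.mem_range] at h
    have e1 : n - 1 - (n - 1 - k) = k := by omega
    have e2 : n - 1 - (n - 1 - j) = j := by omega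
    simp only [e1, e2]
  · rintro ⟨k, j⟩ h
    simp only [Finset.mem_sigma, Finset.mem_range] at h
    have : (n - j) + (n - k) = (n - 1 - k) + (n - 1 - j) + 2 := by omega
    simp only
    exact_mod_cast this

theorem stair_num (n : ℕ) : ∏ k ∈ Finset.range n, ∏ j ∈ Finset.range k, (((n - j : ℕ) : ℚ) - ((n - k : ℕ) : ℚ)) =
    ∏ k ∈ Finset.range n, (k.factorial : ℚ) := by
  refine Finset.prod_congr rfl fun k hk => ?_
  rw [← Finset.prod_range_add_one_eq_factorial, ← Finset.prod_range_reflect, Nat.cast_prod]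
  refine Finset.prod_congr rfl fun j hj => ?_
  have hk := Finset.mem_range.1 hk
  have hj := Finset.mem_range.1 hj
  rw [sub_eq_iff_eq_add]
  have : n - (k - 1 - j) = j + 1 + (n - k) := by omega
  exact_mod_cast this

theorem stair_sum (n : ℕ) : ∑ i ∈ Finset.range n, (n - i) = n * (n+1) / 2 := by
  have := Finset.sum_range_reflect (fun i => i + 1) n
  have h2 : ∑ i ∈ Finset.range n, (n - i) = ∑ i ∈ Finset.range n, (i + 1) := by
    rw [← this]
    exact Finset.sum_congr rfl fun i hi => by have := Finset.mem_range.1 hi; omega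
  have h1 : (∑ i ∈ Finset.range n, (i+1)) * 2 = n * (n+1) := by
    clear * -
    induction n with
    | zero => simp
    | succ k ih => rw [Finset.sum_range_succ, add_mul, ih]; ring
  omega

theorem stair_Gf (n : ℕ) : Gf n (fun i => n - i) *
    ((∏ k ∈ Finset.range n, ((k+1) * ∏ i ∈ Finset.range k, (i + k + 2)) : ℕ) : ℚ) = ((n*(n+1)/2).factorial : ℚ) := by
  have hR : Rp n (fun i => n - i) = (∏ k ∈ Finset.range n, (k.factorial : ℚ)) /
      ∏ k ∈ Finset.range n, ∏ j ∈ Finset.range k, ((j : ℚ) + k + 2) := by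
    rw [← stair_num, ← stair_pairs, ← Finset.prod_div_distrib, Rp]
    refine Finset.prod_congr rfl fun k hk => ?_
    rw [← Finset.prod_div_distrib]
    refine Finset.prod_congr rfl fun j hj => ?_
    rw [rho, if_neg (by have := Finset.mem_range.1 hk; omega)]
  have hf : ∏ i ∈ Finset.range n, ((n - i).factorial : ℚ) =
      (∏ k ∈ Finset.range n, ((k:ℚ)+1)) * ∏ k ∈ Finset.range n, (k.factorial : ℚ) := by
    rw [← Finset.prod_mul_distrib, ← Finset.prod_range_reflect]
    refine Finset.prod_congr rfl fun k hk => ?_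
    have := Finset.mem_range.1 hk
    rw [show n - (n - 1 - k) = k + 1 by omega, Nat.factorial_succ]
    push_cast; ring
  have h1 : ∏ k ∈ Finset.range n, ((k:ℚ)+1) ≠ 0 := Finset.prod_ne_zero_iff.2 fun k _ => by positivity
  have h2 : ∏ k ∈ Finset.range n, (k.factorial : ℚ) ≠ 0 := Finset.prod_ne_zero_iff.2 fun k _ => by positivity
  have h3 : ∏ k ∈ Finset.range n, ∏ j ∈ Finset.range k, ((j : ℚ) + k + 2) ≠ 0 :=
    Finset.prod_ne_zero_iff.2 fun k _ => Finset.prod_ne_zero_iff.2 fun j _ => by positivity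
  rw [Gf, hR, hf, stair_sum, Nat.cast_prod]
  push_cast
  rw [Finset.prod_mul_distrib]
  field_simp

theorem shD_stair (n : ℕ) : shiftedDiag n (staircase n) = shD n (fun i => n - i) := by
  ext c
  rw [mem_shD, shiftedDiag, Finset.mem_filter, Finset.mem_product, Finset.mem_range, Finset.mem_range]
  simp only [staircase]
  omega

theorem card_SST (n : ℕ) : Nat.card {T : Filling // IsSSTstaircase n T} *
    ∏ k ∈ Finset.range n, ((k+1) * ∏ i ∈ Finset.range k, (i + k + 2)) = (n*(n+1)/2).factorial := by
  have h1 : Nat.card {T : Filling // IsSSTstaircase n T} = (tabs (shD n (fun i => n - i))).card := by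
    rw [← Nat.card_eq_finsetCard]
    refine Nat.card_congr (Equiv.subtypeEquivRight fun T => ?_)
    rw [mem_tabs, card_shD, stair_sum, IsSSTstaircase, shD_stair]
  have h2 := tabs_Gf n _ (fun i => n - i) (by intro i hi; simp only; omega) rfl
  have h3 := stair_Gf n
  rw [← h2] at h3
  rw [h1]
  exact_mod_cast h3

theorem main_thm (n : ℕ) (b : Fin (n*(n+1)/2) → ℝ) (hb : Function.Injective b) :
    ({y : Submodule ℂ ℂ[X] | IsOGPt n y} ∩ fibre n ((Finset.univ.val.map fun i => ((b i : ℝ) : OnePoint ℝ)) +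
      (Finset.univ.val.map fun i => ((b i : ℝ) : OnePoint ℝ)))).ncard = Nat.card {T : Filling // IsSSTstaircase n T} := by
  have h1 := count_Y n b hb
  rw [prod_wY, ← card_SST] at h1
  rw [ncard_Y]
  refine Nat.eq_of_mul_eq_mul_right ?_ h1
  exact Finset.prod_pos fun k _ => Nat.mul_pos (Nat.succ_pos _) (Finset.prod_pos fun i _ => by omega)

end TB
end OG
end PartTB

open Polynomial OnePoint

namespace OG

/-- If `b` is a set of `n(n+1)/2` distinct real numbers, the fibre
`Y(b) = Y ∩ X(b⋆)` has exactly `|SST(δ)|` points, the number of standard shifted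
tableaux of staircase shape. -/
theorem fibreY_card (n : ℕ) (b : Fin (n*(n+1)/2) → ℝ) (hb : Function.Injective b) :
    ({y | IsOGPt n y} ∩ fibre n
        ((Finset.univ.val.map fun i => ((b i : ℝ) : OnePoint ℝ)) +
         (Finset.univ.val.map fun i => ((b i : ℝ) : OnePoint ℝ)))).ncard
      = Nat.card {T : Filling // IsSSTstaircase n T} := by
  exact main_thm n b hb

end OG
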